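/- Let M be a matroid without large uniform minors and let r ≥ 3 be an odd integer. Then M is representable over both the finite field 𝔽_{2^r} and 𝔽₃ if and only if M is representable over every field with at least three elements. -/

import Mathlib

universe u v w

open Matroid Set

namespace Paper

/-- The deletion of the set `D` from the matroid `M`. -/
def delete {α : Type u} (M : Matroid α) (D : Set α) : Matroid α := M ↾ (M.E \ D)

/-- The contraction of the set `C` in the matroid `M`. -/
def contract {α : Type u} (M : Matroid α) (C : Set α) : Matroid α := (delete M✶ C)✶

/-- `N` is a minor of `M`: it is obtained from `M` by a sequence of deletions and
contractions, equivalently by a single contraction followed by a single deletion. -/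
def IsMinor {α : Type u} (N M : Matroid α) : Prop :=
  ∃ C D : Set α, N = delete (contract M C) D

/-- `M` is a copy of the uniform matroid `U(r,n)`: its ground set has `n` elements and its
independent sets are exactly the subsets of the ground set with at most `r` elements. -/
def IsUniform {α : Type u} (M : Matroid α) (r n : ℕ) : Prop :=
  M.E.Finite ∧ M.E.ncard = n ∧ ∀ I ⊆ M.E, (M.Indep I ↔ I.ncard ≤ r)

/-- `M` has a minor isomorphic to the uniform matroid `U(r,n)`. -/
def HasUniformMinor {α : Type u} (M : Matroid α) (r n : ℕ) : Prop :=
  ∃ N : Matroid α, IsMinor N M ∧ IsUniform N r n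

/-- `M` is without large uniform minors: no minor of `M` is isomorphic to `U(2,5)` or
`U(3,5)`. -/
def NoLargeUniformMinors {α : Type u} (M : Matroid α) : Prop :=
  ¬ HasUniformMinor M 2 5 ∧ ¬ HasUniformMinor M 3 5

/-- `M` is isomorphic to the Fano matroid `F₇`, the matroid on the seven nonzero vectors of
`(𝔽₂)³` whose independent sets are the `𝔽₂`-linearly independent subsets. -/
def IsFano {α : Type u} (M : Matroid α) : Prop :=
  ∃ f : α → (Fin 3 → ZMod 2),
    Set.BijOn f M.E {x | x ≠ 0} ∧
    ∀ I ⊆ M.E, (M.Indep I ↔ Set.InjOn f I ∧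
      LinearIndependent (ZMod 2) (fun x : (f '' I) => (x : Fin 3 → ZMod 2)))

/-- `M` has a minor isomorphic to the Fano matroid `F₇`. -/
def HasFanoMinor {α : Type u} (M : Matroid α) : Prop :=
  ∃ N : Matroid α, IsMinor N M ∧ IsFano N

/-- `M` has a minor isomorphic to the dual Fano matroid `F₇*`. -/
def HasFanoDualMinor {α : Type u} (M : Matroid α) : Prop :=
  ∃ N : Matroid α, IsMinor N M ∧ IsFano N✶

/-- `M` is representable over the field `K`: there are a `K`-vector space `V` and a map
`φ` from the ground type to `V` such that a set `I ⊆ M.E` is independent in `M` if and only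
if the family `φ` restricted to `I` is linearly independent over `K` (equivalently, `φ` is
injective on `I` and the image `φ '' I` is linearly independent). -/
def Representable {α : Type u} (M : Matroid α) (K : Type v) [Field K] : Prop :=
  ∃ (V : Type (max u v)) (_ : AddCommGroup V) (_ : Module K V) (φ : α → V),
    ∀ I ⊆ M.E, (M.Indep I ↔ LinearIndependent K (fun x : I => φ x))

end Paper

set_option linter.unusedSectionVars false

namespace Paper

section Frames

variable {E : Type*} [DecidableEq E] {F : Type*} [Field F]

/-- `B` is a basis of the configuration with row space `U` on the ground set `D`, and `A` is the
matrix of the remaining elements with respect to `B`. -/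
def IsFrame (D : Finset E) (U : Set (E → F)) (B : Finset E) (A : E → E → F) : Prop :=
  B ⊆ D ∧ ∀ u, u ∈ U ↔ ∀ c ∈ D \ B, u c = ∑ b ∈ B, A b c * u b

/-- `B` is a basis of the configuration with row space `U` on the ground set `D`. -/
def HasFrame (D : Finset E) (U : Set (E → F)) (B : Finset E) : Prop :=
  ∃ A, IsFrame D U B A

/-- The row space of the matrix `[I | A]` with basis `B` on the ground set `D`. -/
def frameSpace (D B : Finset E) (A : E → E → F) : Set (E → F) :=
  {u | ∀ c ∈ D \ B, u c = ∑ b ∈ B, A b c * u b}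

/-- The matrix obtained from `A` by exchanging the basis element `x` for `y`. -/
def pivot (A : E → E → F) (x y i j : E) : F :=
  if i = y then (if j = x then (A x y)⁻¹ else A x j / A x y)
  else (if j = x then -A i y / A x y else A i j - A i y * A x j / A x y)

/-- The cross-ratio of the rows `a`, `b` and the columns `c`, `d` of `A`. -/
def crossRatio (A : E → E → F) (a b c d : E) : F := A a c * A b d / (A a d * A b c)

variable {D B B' : Finset E} {U : Set (E → F)} {A A' : E → E → F} {x y : E}

theorem isFrame_frameSpace (h : B ⊆ D) (A : E → E → F) : IsFrame D (frameSpace D B A) B A :=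
  ⟨h, fun _ => Iff.rfl⟩

theorem pivot_self (A : E → E → F) (x y : E) : pivot A x y y x = (A x y)⁻¹ := by
  simp [pivot]

theorem pivot_row (A : E → E → F) {x y j : E} (h : j ≠ x) :
    pivot A x y y j = A x j / A x y := by
  simp [pivot, h]

theorem pivot_col (A : E → E → F) {x y i : E} (h : i ≠ y) :
    pivot A x y i x = -A i y / A x y := by
  simp [pivot, h]

theorem pivot_of_ne (A : E → E → F) {x y i j : E} (hi : i ≠ y) (hj : j ≠ x) :
    pivot A x y i j = A i j - A i y * A x j / A x y := by
  simp [pivot, hi, hj]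

namespace IsFrame

theorem hasFrame (h : IsFrame D U B A) : HasFrame D U B := ⟨A, h⟩

theorem eq_frameSpace (h : IsFrame D U B A) : U = frameSpace D B A := by
  ext u; exact h.2 u

theorem congr (h : IsFrame D U B A) (hA : ∀ b ∈ B, ∀ c ∈ D \ B, A b c = A' b c) :
    IsFrame D U B A' := by
  refine ⟨h.1, fun u => (h.2 u).trans (forall₂_congr fun c hc => ?_)⟩
  rw [Finset.sum_congr rfl fun b hb => by rw [hA b hb c hc]]

theorem exists_extend (h : IsFrame D U B A) (v : E → F) : ∃ u ∈ U, ∀ b ∈ B, u b = v b := by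
  refine ⟨fun c => if c ∈ B then v c else ∑ b ∈ B, A b c * v b, (h.2 _).2 ?_, ?_⟩
  · intro c hc
    simp only [(Finset.mem_sdiff.1 hc).2, if_false]
    exact Finset.sum_congr rfl fun b hb => by simp [hb]
  · intro b hb
    simp [hb]

theorem exists_single (h : IsFrame D U B A) {x : E} (hx : x ∈ B) :
    ∃ u ∈ U, u x = 1 ∧ (∀ b ∈ B, b ≠ x → u b = 0) ∧ ∀ c ∈ D \ B, u c = A x c := by
  obtain ⟨u, hu, huv⟩ := h.exists_extend (fun b => if b = x then 1 else 0)
  refine ⟨u, hu, by simp [huv x hx], fun b hb hbx => by simp [huv b hb, hbx], fun c hc => ?_⟩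
  rw [(h.2 u).1 hu c hc, Finset.sum_eq_single x]
  · simp [huv x hx]
  · intro b hb hbx
    simp [huv b hb, hbx]
  · exact fun hx' => absurd hx hx'

theorem unique (h : IsFrame D U B A) (h' : IsFrame D U B A') {b c : E} (hb : b ∈ B)
    (hc : c ∈ D \ B) : A b c = A' b c := by
  obtain ⟨u, hu, h1, h0, hA⟩ := h.exists_single hb
  rw [← hA c hc, (h'.2 u).1 hu c hc, Finset.sum_eq_single b]
  · simp [h1]
  · intro b' hb' hne
    simp [h0 b' hb' hne]
  · exact fun hx' => absurd hb hx'

theorem pivot (h : IsFrame D U B A) (hx : x ∈ B) (hy : y ∈ D \ B) (hxy : A x y ≠ 0) :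
    IsFrame D U (insert y (B.erase x)) (pivot A x y) := by
  obtain ⟨hyD, hyB⟩ := Finset.mem_sdiff.1 hy
  have hyx : y ≠ x := fun h => hyB (h ▸ hx)
  have hye : y ∉ B.erase x := fun h => hyB (Finset.mem_of_mem_erase h)
  have hsum : ∀ u : E → F, ∀ c, ∑ b ∈ B, A b c * u b =
      A x c * u x + ∑ b ∈ B.erase x, A b c * u b := fun u c =>
    (Finset.add_sum_erase B (fun b => A b c * u b) hx).symm
  have hsum' : ∀ u : E → F, ∀ c, c ≠ x → ∑ b ∈ insert y (B.erase x), Paper.pivot A x y b c * u b =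
      A x c / A x y * u y + (∑ b ∈ B.erase x, A b c * u b -
        A x c / A x y * ∑ b ∈ B.erase x, A b y * u b) := by
    intro u c hc
    rw [Finset.sum_insert hye, pivot_row A hc, Finset.mul_sum, ← Finset.sum_sub_distrib]
    congr 1
    refine Finset.sum_congr rfl fun b hb => ?_
    rw [pivot_of_ne A (ne_of_mem_of_not_mem hb hye) hc]
    ring
  have hsumx : ∀ u : E → F, ∑ b ∈ insert y (B.erase x), Paper.pivot A x y b x * u b =
      (A x y)⁻¹ * (u y - ∑ b ∈ B.erase x, A b y * u b) := by
    intro u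
    rw [Finset.sum_insert hye, pivot_self, mul_sub, Finset.mul_sum, sub_eq_add_neg,
      ← Finset.sum_neg_distrib]
    congr 1
    refine Finset.sum_congr rfl fun b hb => ?_
    rw [pivot_col A (ne_of_mem_of_not_mem hb hye)]
    ring
  refine ⟨Finset.insert_subset hyD ((Finset.erase_subset _ _).trans h.1), fun u => ?_⟩
  rw [h.2 u]
  constructor
  · intro hu c hc
    simp only [Finset.mem_sdiff, Finset.mem_insert, Finset.mem_erase, not_or, not_and] at hc
    have h1 := hu y hy
    rw [hsum] at h1
    by_cases hcx : c = x
    · subst hcx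
      rw [hsumx, h1]
      field_simp
      ring
    · have h2 := hu c (Finset.mem_sdiff.2 ⟨hc.1, hc.2.2 hcx⟩)
      rw [hsum] at h2
      rw [hsum' u c hcx, h1, h2]
      field_simp
      ring
  · intro hu c hc
    obtain ⟨hcD, hcB⟩ := Finset.mem_sdiff.1 hc
    have h1 := hu x (by simp [h.1 hx, hyx.symm])
    rw [hsumx] at h1
    have h1' : u y = A x y * u x + ∑ b ∈ B.erase x, A b y * u b := by
      rw [h1]; field_simp; ring
    rw [hsum]
    by_cases hcy : c = y
    · subst hcy; exact h1'
    · have hcx : c ≠ x := fun h => hcB (h ▸ hx)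
      have h2 := hu c (by simp [hcD, hcy, hcB])
      rw [hsum' u c hcx, h1'] at h2
      rw [h2]
      field_simp
      ring

theorem exists_exchange (h : IsFrame D U B A) (h' : HasFrame D U B') (hy : y ∈ B' \ B) :
    ∃ x ∈ B \ B', A x y ≠ 0 := by
  obtain ⟨A', h'⟩ := h'
  obtain ⟨hy', hyB⟩ := Finset.mem_sdiff.1 hy
  obtain ⟨u, hu, h1, h0, -⟩ := h'.exists_single hy'
  by_contra! hcon
  have := (h.2 u).1 hu y (Finset.mem_sdiff.2 ⟨h'.1 hy', hyB⟩)
  rw [h1, Finset.sum_eq_zero] at this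
  · exact one_ne_zero this
  intro b hb
  by_cases hbB : b ∈ B'
  · rw [h0 b hbB (fun h => hyB (h ▸ hb)), mul_zero]
  · rw [hcon b (Finset.mem_sdiff.2 ⟨hb, hbB⟩), zero_mul]

theorem exists_exchange_symm (h : IsFrame D U B A) (h' : HasFrame D U B') (hx : x ∈ B \ B') :
    ∃ y ∈ B' \ B, A x y ≠ 0 := by
  obtain ⟨A', h'⟩ := h'
  obtain ⟨hxB, hxB'⟩ := Finset.mem_sdiff.1 hx
  obtain ⟨u, hu, h1, h0, hA⟩ := h.exists_single hxB
  by_contra! hcon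
  have := (h'.2 u).1 hu x (Finset.mem_sdiff.2 ⟨h.1 hxB, hxB'⟩)
  rw [h1, Finset.sum_eq_zero] at this
  · exact one_ne_zero this
  intro b hb
  by_cases hbB : b ∈ B
  · rw [h0 b hbB (fun h => hxB' (h ▸ hb)), mul_zero]
  · rw [hA b (Finset.mem_sdiff.2 ⟨h'.1 hb, hbB⟩), hcon b (Finset.mem_sdiff.2 ⟨hb, hbB⟩), mul_zero]

theorem hasFrame_exchange_iff (h : IsFrame D U B A) (hx : x ∈ B) (hy : y ∈ D \ B) :
    HasFrame D U (insert y (B.erase x)) ↔ A x y ≠ 0 := by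
  refine ⟨fun h' => ?_, fun h' => (h.pivot hx hy h').hasFrame⟩
  have hyB := (Finset.mem_sdiff.1 hy).2
  obtain ⟨z, hz, hzy⟩ := h.exists_exchange h' (y := y) (by simp [hyB])
  simp only [Finset.mem_sdiff, Finset.mem_insert, Finset.mem_erase, not_or, not_and] at hz
  have : z = x := by
    by_contra hne
    exact hz.2.2 hne hz.1
  rwa [← this]

/-- Any two bases are joined by a sequence of exchanges that moves towards the second one. -/
theorem induction (h : IsFrame D U B A) (h' : HasFrame D U B') (p : Finset E → Prop) (hB : p B)
    (step : ∀ C A x y, IsFrame D U C A → p C → x ∈ C \ B' → y ∈ B' \ C → A x y ≠ 0 →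
      p (insert y (C.erase x))) : p B' := by
  induction hn : (B' \ B).card using Nat.strong_induction_on generalizing B A with
  | _ n ih =>
    by_cases hne : (B' \ B).Nonempty
    · obtain ⟨y, hy⟩ := hne
      obtain ⟨x, hx, hxy⟩ := h.exists_exchange h' hy
      have hy' := Finset.mem_sdiff.1 hy
      have hx' := Finset.mem_sdiff.1 hx
      obtain ⟨A', hA'⟩ := h'
      have hf := h.pivot hx'.1 (Finset.mem_sdiff.2 ⟨hA'.1 hy'.1, hy'.2⟩) hxy
      refine ih _ ?_ hf (step B A x y h hB hx hy hxy) rfl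
      rw [← hn]
      refine Finset.card_lt_card ⟨?_, fun hsub => ?_⟩
      · intro z hz
        simp only [Finset.mem_sdiff, Finset.mem_insert, Finset.mem_erase, not_or, not_and] at hz ⊢
        exact ⟨hz.1, fun hzB => hz.2.2 (fun e => hx'.2 (e ▸ hz.1)) hzB⟩
      · have := hsub hy
        simp at this
    · have hsub : B' ⊆ B := by
        rw [← Finset.sdiff_eq_empty_iff_subset]
        exact Finset.not_nonempty_iff_eq_empty.1 hne
      have : B = B' := by
        refine Finset.Subset.antisymm (fun x hx => ?_) hsub
        by_contra hxB
        obtain ⟨y, hy, -⟩ := h.exists_exchange_symm h' (Finset.mem_sdiff.2 ⟨hx, hxB⟩)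
        exact hne ⟨y, hy⟩
      rwa [← this]

end IsFrame

theorem IsFrame.card_eq {B'} (h : IsFrame D U B A) (h' : HasFrame D U B') : B'.card = B.card := by
  refine h.induction h' (fun C => C.card = B.card) rfl fun C A x y _ hC hx hy _ => ?_
  simp only [Finset.mem_sdiff] at hx hy
  rw [Finset.card_insert_of_notMem (by simp [hy.2]), Finset.card_erase_of_mem hx.1, ← hC]
  have := Finset.card_pos.2 ⟨x, hx.1⟩
  omega

end Frames

section Minors

variable {E : Type*} [DecidableEq E] {F : Type*} [Field F]

/-- The row space obtained from `U` by contracting `X` and restricting to `D`. -/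
def minorSpace (D X : Finset E) (U : Set (E → F)) : Set (E → F) :=
  {v | ∃ u ∈ U, (∀ x ∈ X, u x = 0) ∧ ∀ e ∈ D, u e = v e}

/-- The orthogonal space of `U`, the row space of the dual configuration. -/
def perp (D : Finset E) (U : Set (E → F)) : Set (E → F) :=
  {w | ∀ u ∈ U, ∑ e ∈ D, w e * u e = 0}

/-- The row space obtained from `U` by scaling the columns. -/
def scale (g : E → F) (U : Set (E → F)) : Set (E → F) :=
  {u | (fun e => g e * u e) ∈ U}

variable {D D' B B' C X : Finset E} {U : Set (E → F)} {A A' : E → E → F} {x y : E} {g : E → F}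

theorem IsFrame.minor (h : IsFrame D U C A) (hD : D' ⊆ D) :
    IsFrame D' (minorSpace D' (C \ D') U) (C ∩ D') A := by
  have hsum : ∀ u : E → F, (∀ x ∈ C \ D', u x = 0) → ∀ c, ∑ b ∈ C, A b c * u b =
      ∑ b ∈ C ∩ D', A b c * u b := by
    intro u hu c
    refine (Finset.sum_subset Finset.inter_subset_left fun b hb hb' => ?_).symm
    rw [hu b (Finset.mem_sdiff.2 ⟨hb, fun h => hb' (Finset.mem_inter.2 ⟨hb, h⟩)⟩), mul_zero]
  refine ⟨Finset.inter_subset_right, fun v => ⟨?_, fun hv => ?_⟩⟩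
  · rintro ⟨u, hu, h0, huv⟩ c hc
    simp only [Finset.mem_sdiff, Finset.mem_inter, not_and] at hc
    rw [← huv c hc.1, (h.2 u).1 hu c (Finset.mem_sdiff.2 ⟨hD hc.1, fun h => hc.2 h hc.1⟩),
      hsum u h0]
    exact Finset.sum_congr rfl fun b hb => by rw [huv b (Finset.mem_inter.1 hb).2]
  · obtain ⟨u, hu, huv⟩ := h.exists_extend (fun e => if e ∈ D' then v e else 0)
    have h0 : ∀ x ∈ C \ D', u x = 0 := fun x hx => by
      rw [Finset.mem_sdiff] at hx
      simp [huv x hx.1, hx.2]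
    refine ⟨u, hu, h0, fun e he => ?_⟩
    by_cases heC : e ∈ C
    · simp [huv e heC, he]
    · rw [(h.2 u).1 hu e (Finset.mem_sdiff.2 ⟨hD he, heC⟩), hsum u h0,
        hv e (by simp [he, heC])]
      refine Finset.sum_congr rfl fun b hb => ?_
      rw [Finset.mem_inter] at hb
      simp [huv b hb.1, hb.2]

theorem IsFrame.minor' (h : IsFrame D U (C ∪ X) A) (hD : D' ⊆ D) (hC : C ⊆ D')
    (hX : Disjoint X D') : IsFrame D' (minorSpace D' X U) C A := by
  have h1 : (C ∪ X) \ D' = X := by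
    ext e
    have h1 := Finset.disjoint_left.1 hX
    have h2 := @h1 e
    have h3 := @hC e
    simp only [Finset.mem_sdiff, Finset.mem_union]
    tauto
  have h2 : (C ∪ X) ∩ D' = C := by
    ext e
    have h1 := Finset.disjoint_left.1 hX
    have h2 := @h1 e
    have h3 := @hC e
    simp only [Finset.mem_inter, Finset.mem_union]
    tauto
  have := h.minor hD
  rwa [h1, h2] at this

theorem HasFrame.minor_iff (h : HasFrame D U (C ∪ X)) (hD : D' ⊆ D) (hC : C ⊆ D')
    (hX : Disjoint X D') :
    HasFrame D' (minorSpace D' X U) B ↔ B ⊆ D' ∧ HasFrame D U (B ∪ X) := by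
  constructor
  · rintro ⟨A', h'⟩
    refine ⟨h'.1, ?_⟩
    obtain ⟨A, hA⟩ := h
    refine (hA.minor' hD hC hX).induction ⟨A', h'⟩ (fun B => HasFrame D U (B ∪ X)) ⟨A, hA⟩ ?_
    rintro C1 A1 x y hC1 ⟨A2, hC2⟩ hx hy hxy
    simp only [Finset.mem_sdiff] at hx hy
    have hyD := h'.1 hy.1
    have hyX : y ∉ X := fun hy' => Finset.disjoint_left.1 hX hy' hyD
    have hxX : x ∉ X := fun hx' => Finset.disjoint_left.1 hX hx' (hC1.1 hx.1)
    have h2 := hC2.minor' hD hC1.1 hX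
    have hxy2 : A2 x y ≠ 0 := by
      rwa [← hC1.unique h2 hx.1 (Finset.mem_sdiff.2 ⟨hyD, hy.2⟩)]
    have h3 := hC2.pivot (x := x) (y := y) (by simp [hx.1]) (by simp [hD hyD, hy.2, hyX]) hxy2
    have e1 : insert y ((C1 ∪ X).erase x) = insert y (C1.erase x) ∪ X := by
      ext e
      simp only [Finset.mem_insert, Finset.mem_erase, Finset.mem_union]
      have : e ∈ X → e ≠ x := fun h h' => hxX (h' ▸ h)
      tauto
    rw [← e1]
    exact h3.hasFrame
  · rintro ⟨hB, A', h'⟩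
    exact (h'.minor' hD hB hX).hasFrame

theorem IsFrame.exists_of_minor (h : HasFrame D U (C ∪ X)) (hD : D' ⊆ D) (hC : C ⊆ D')
    (hX : Disjoint X D') (h' : IsFrame D' (minorSpace D' X U) B A) :
    ∃ A', IsFrame D U (B ∪ X) A' ∧ ∀ b ∈ B, ∀ c ∈ D' \ B, A' b c = A b c := by
  obtain ⟨A', hA'⟩ := ((h.minor_iff hD hC hX).1 h'.hasFrame).2
  exact ⟨A', hA', fun b hb c hc => (hA'.minor' hD h'.1 hX).unique h' hb hc⟩

theorem IsFrame.perp (h : IsFrame D U B A) :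
    IsFrame D (perp D U) (D \ B) (fun c b => -A b c) := by
  refine ⟨Finset.sdiff_subset, fun w => ?_⟩
  rw [Finset.sdiff_sdiff_eq_self h.1]
  constructor
  · intro hw b hb
    obtain ⟨u, hu, h1, h0, hA⟩ := h.exists_single hb
    have := hw u hu
    rw [← Finset.sum_sdiff h.1, Finset.sum_eq_single_of_mem (s := B) b hb, h1, mul_one,
      add_comm] at this
    · rw [eq_neg_of_add_eq_zero_left this, ← Finset.sum_neg_distrib]
      exact Finset.sum_congr rfl fun c hc => by rw [hA c hc]; ring
    · intro b' hb' hne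
      rw [h0 b' hb' hne, mul_zero]
  · intro hw u hu
    rw [← Finset.sum_sdiff h.1]
    have h1 : ∑ b ∈ B, w b * u b = ∑ b ∈ B, ∑ c ∈ D \ B, -A b c * w c * u b :=
      Finset.sum_congr rfl fun b hb => by rw [hw b hb, Finset.sum_mul]
    have h2 : ∑ c ∈ D \ B, w c * u c = ∑ c ∈ D \ B, ∑ b ∈ B, A b c * w c * u b :=
      Finset.sum_congr rfl fun c hc => by
        rw [(h.2 u).1 hu c hc, Finset.mul_sum]
        exact Finset.sum_congr rfl fun b _ => by ring
    rw [h1, h2, Finset.sum_comm, ← Finset.sum_add_distrib]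
    refine Finset.sum_eq_zero fun b _ => ?_
    rw [← Finset.sum_add_distrib]
    exact Finset.sum_eq_zero fun c _ => by ring

theorem HasFrame.subset (h : HasFrame D U B) : B ⊆ D := h.choose_spec.1

theorem HasFrame.perp_perp (h : HasFrame D U B) : perp D (perp D U) = U := by
  obtain ⟨A, h⟩ := h
  have := h.perp.perp
  rw [Finset.sdiff_sdiff_eq_self h.1] at this
  rw [this.eq_frameSpace, h.eq_frameSpace]
  simp

theorem HasFrame.perp_iff (h : HasFrame D U B) :
    HasFrame D (perp D U) C ↔ C ⊆ D ∧ HasFrame D U (D \ C) := by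
  constructor
  · rintro ⟨A', h'⟩
    refine ⟨h'.1, ?_⟩
    rw [← h.perp_perp]
    exact h'.perp.hasFrame
  · rintro ⟨hC, A', h'⟩
    rw [← Finset.sdiff_sdiff_eq_self hC]
    exact h'.perp.hasFrame

theorem crossRatio_transpose (A : E → E → F) (a b c d : E) :
    crossRatio (fun c b => -A b c) c d a b = crossRatio A a b c d := by
  simp [crossRatio, mul_comm]

theorem IsFrame.scale (h : IsFrame D U B A) (hg : ∀ e, g e ≠ 0) :
    IsFrame D (scale g U) B (fun b c => (g c)⁻¹ * A b c * g b) := by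
  refine ⟨h.1, fun u => (h.2 _).trans (forall₂_congr fun c _ => ?_)⟩
  rw [← eq_inv_mul_iff_mul_eq₀ (hg c), Finset.mul_sum]
  rw [Finset.sum_congr rfl fun b _ => (by ring :
    (g c)⁻¹ * (A b c * (g b * u b)) = (g c)⁻¹ * A b c * g b * u b)]

theorem scale_scale (g g' : E → F) (U : Set (E → F)) :
    scale g (scale g' U) = scale (g * g') U := by
  ext u
  simp only [scale, Set.mem_ofPred_eq, Pi.mul_apply]
  rw [show (fun e => g' e * (g e * u e)) = fun e => g e * g' e * u e by ext; ring]

theorem scale_inv_scale (hg : ∀ e, g e ≠ 0) (U : Set (E → F)) : scale g⁻¹ (scale g U) = U := by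
  rw [scale_scale]
  ext u
  simp [scale, hg]

theorem perp_scale (hg : ∀ e, g e ≠ 0) (U : Set (E → F)) :
    perp D (scale g U) = scale g⁻¹ (perp D U) := by
  ext w
  constructor
  · intro hw u hu
    have := hw (fun e => (g e)⁻¹ * u e) (by simpa [scale, hg] using hu)
    rw [← this]
    exact Finset.sum_congr rfl fun e _ => by simp; ring
  · intro hw u hu
    have := hw _ hu
    rw [← this]
    refine Finset.sum_congr rfl fun e _ => ?_
    have := hg e
    simp
    field_simp

theorem HasFrame.scale_iff (hg : ∀ e, g e ≠ 0) : HasFrame D (scale g U) B ↔ HasFrame D U B := by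
  refine ⟨fun ⟨A, h⟩ => ?_, fun ⟨A, h⟩ => (h.scale hg).hasFrame⟩
  have := h.scale (g := g⁻¹) (by simpa using hg)
  rw [scale_inv_scale hg] at this
  exact this.hasFrame

theorem crossRatio_scale (hg : ∀ e, g e ≠ 0) (A : E → E → F) (a b c d : E) :
    crossRatio (fun b c => (g c)⁻¹ * A b c * g b) a b c d = crossRatio A a b c d := by
  have := hg a; have := hg b; have := hg c; have := hg d
  simp only [crossRatio]
  rw [show (g c)⁻¹ * A a c * g a * ((g d)⁻¹ * A b d * g b) =
    ((g c)⁻¹ * (g d)⁻¹ * g a * g b) * (A a c * A b d) by ring,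
    show (g d)⁻¹ * A a d * g a * ((g c)⁻¹ * A b c * g b) =
    ((g c)⁻¹ * (g d)⁻¹ * g a * g b) * (A a d * A b c) by ring]
  exact mul_div_mul_left _ _ (by simp [*])

theorem crossRatio_congr {a b c d : E} (h1 : A a c = A' a c) (h2 : A a d = A' a d)
    (h3 : A b c = A' b c) (h4 : A b d = A' b d) : crossRatio A a b c d = crossRatio A' a b c d := by
  simp [crossRatio, *]

end Minors

section Good

variable {E : Type*} [DecidableEq E] {T F K : Type*} [Field T] [Field F] [Field K]

/-- Two configurations, possibly over different fields, with the same bases. -/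
structure SameFrames (D : Finset E) (U : Set (E → F)) (U' : Set (E → K)) : Prop where
  exists_frame : ∃ B, HasFrame D U B
  iff : ∀ B, HasFrame D U B ↔ HasFrame D U' B

/-- A function that commutes with the operations `p ↦ 1 - p` and `p ↦ p⁻¹` on cross-ratios. -/
structure IsLift (L : F → K) : Prop where
  zero : L 0 = 0
  one : L 1 = 1
  one_sub : ∀ p, L (1 - p) = 1 - L p
  inv : ∀ p, L p⁻¹ = (L p)⁻¹
  eq_zero : ∀ p, L p = 0 → p = 0

/-- The cross-ratio of the rows `a`, `b` and columns `c`, `d` of `A'` is the lift of that of `A`. -/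
def Lifts (L : F → K) (A : E → E → F) (A' : E → E → K) (a b c d : E) : Prop :=
  crossRatio A' a b c d = L (crossRatio A a b c d)

/-- `U'` has the same bases as `U` and its cross-ratios are the lifts of those of `U`. -/
structure Good (L : F → K) (D : Finset E) (U : Set (E → F)) (U' : Set (E → K)) : Prop where
  same : SameFrames D U U'
  lifts : ∀ B A A', IsFrame D U B A → IsFrame D U' B A' →
    ∀ a ∈ B, ∀ b ∈ B, ∀ c ∈ D \ B, ∀ d ∈ D \ B, Lifts L A A' a b c d

/-- There is a good configuration over `K`, unique up to scaling. -/
def HasUniqueGood (L : F → K) (D : Finset E) (U : Set (E → F)) : Prop :=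
  (∃ U', Good L D U U') ∧ ∀ U' U'', Good L D U U' → Good L D U U'' →
    ∃ g : E → K, (∀ e, g e ≠ 0) ∧ U'' = scale g U'

/-- Two scalars agree in being zero or one. -/
def Compat (p : T) (q : F) : Prop := (p = 0 ↔ q = 0) ∧ (p = 1 ↔ q = 1)

variable {D D' B B' C X : Finset E} {U : Set (E → F)} {U' : Set (E → K)}
  {A : E → E → F} {A' : E → E → K} {L : F → K} {a b c d e x y : E} {g : E → K}

theorem IsLift.eq_one (hL : IsLift L) {p : F} (h : L p = 1) : p = 1 := by
  have := hL.eq_zero (1 - p) (by rw [hL.one_sub, h, sub_self])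
  exact (sub_eq_zero.1 this).symm

theorem IsLift.ne_zero (hL : IsLift L) {p : F} (h : p ≠ 0) : L p ≠ 0 := mt (hL.eq_zero p) h

theorem SameFrames.exists_pair (h : SameFrames D U U') :
    ∃ B A A', IsFrame D U B A ∧ IsFrame D U' B A' := by
  obtain ⟨B, A, hA⟩ := h.exists_frame
  obtain ⟨A', hA'⟩ := (h.iff B).1 ⟨A, hA⟩
  exact ⟨B, A, A', hA, hA'⟩

theorem IsFrame.support_iff (hA : IsFrame D U B A) (hA' : IsFrame D U' B A')
    (hb : b ∈ B) (hc : c ∈ D \ B)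
    (h : HasFrame D U (insert c (B.erase b)) ↔ HasFrame D U' (insert c (B.erase b))) :
    A b c = 0 ↔ A' b c = 0 := by
  rw [hA.hasFrame_exchange_iff hb hc, hA'.hasFrame_exchange_iff hb hc] at h
  exact not_iff_not.1 h

theorem SameFrames.support_iff (h : SameFrames D U U') (hA : IsFrame D U B A)
    (hA' : IsFrame D U' B A') (hb : b ∈ B) (hc : c ∈ D \ B) : A b c = 0 ↔ A' b c = 0 :=
  hA.support_iff hA' hb hc (h.iff _)

theorem SameFrames.minor (h : SameFrames D U U') (hB : HasFrame D U (C ∪ X)) (hD : D' ⊆ D)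
    (hC : C ⊆ D') (hX : Disjoint X D') :
    SameFrames D' (minorSpace D' X U) (minorSpace D' X U') := by
  refine ⟨⟨C, (hB.minor_iff hD hC hX).2 ⟨hC, hB⟩⟩, fun B => ?_⟩
  rw [hB.minor_iff hD hC hX, ((h.iff _).1 hB).minor_iff hD hC hX, h.iff]

theorem Good.minor (h : Good L D U U') (hB : HasFrame D U (C ∪ X)) (hD : D' ⊆ D)
    (hC : C ⊆ D') (hX : Disjoint X D') :
    Good L D' (minorSpace D' X U) (minorSpace D' X U') := by
  refine ⟨h.same.minor hB hD hC hX, fun B A A' hA hA' a ha b hb c hc d hd => ?_⟩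
  obtain ⟨A1, h1, e1⟩ := IsFrame.exists_of_minor hB hD hC hX hA
  obtain ⟨A2, h2, e2⟩ := IsFrame.exists_of_minor ((h.same.iff _).1 hB) hD hC hX hA'
  have hsub : ∀ c ∈ D' \ B, c ∈ D \ (B ∪ X) := fun c hc => by
    simp only [Finset.mem_sdiff, Finset.mem_union] at hc ⊢
    exact ⟨hD hc.1, fun h => h.elim hc.2 fun h => Finset.disjoint_left.1 hX h hc.1⟩
  have := h.lifts _ _ _ h1 h2 a (Finset.mem_union_left _ ha) b (Finset.mem_union_left _ hb)
    c (hsub c hc) d (hsub d hd)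
  unfold Lifts at this ⊢
  rwa [crossRatio_congr (e1 a ha c hc) (e1 a ha d hd) (e1 b hb c hc) (e1 b hb d hd),
    crossRatio_congr (e2 a ha c hc) (e2 a ha d hd) (e2 b hb c hc) (e2 b hb d hd)] at this

theorem SameFrames.perp (h : SameFrames D U U') : SameFrames D (perp D U) (perp D U') := by
  obtain ⟨B, A, A', hA, hA'⟩ := h.exists_pair
  refine ⟨⟨_, hA.perp.hasFrame⟩, fun C => ?_⟩
  rw [hA.hasFrame.perp_iff, hA'.hasFrame.perp_iff, h.iff]

theorem Good.perp (h : Good L D U U') : Good L D (perp D U) (perp D U') := by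
  refine ⟨h.same.perp, fun B A A' hA hA' a ha b hb c hc d hd => ?_⟩
  obtain ⟨B0, A0, A0', hA0, hA0'⟩ := h.same.exists_pair
  have h1 := hA.perp
  have h2 := hA'.perp
  rw [hA0.hasFrame.perp_perp] at h1
  rw [hA0'.hasFrame.perp_perp] at h2
  have hB := Finset.sdiff_sdiff_eq_self hA.1
  have := h.lifts _ _ _ h1 h2 c hc d hd a (by rwa [hB]) b (by rwa [hB])
  unfold Lifts at this ⊢
  rwa [crossRatio_transpose, crossRatio_transpose] at this

theorem Good.scale (h : Good L D U U') (hg : ∀ e, g e ≠ 0) : Good L D U (scale g U') := by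
  refine ⟨⟨h.same.exists_frame, fun B => ?_⟩, fun B A A' hA hA' a ha b hb c hc d hd => ?_⟩
  · rw [HasFrame.scale_iff hg, h.same.iff]
  · obtain ⟨A1, h1⟩ := (h.same.iff _).1 hA.hasFrame
    have h2 := h1.scale hg
    have := h.lifts _ _ _ hA h1 a ha b hb c hc d hd
    unfold Lifts at this ⊢
    rwa [← crossRatio_scale hg, crossRatio_congr (h2.unique hA' ha hc) (h2.unique hA' ha hd)
      (h2.unique hA' hb hc) (h2.unique hA' hb hd)] at this

theorem HasUniqueGood.of_perp (hU : HasFrame D U B) (h : HasUniqueGood L D (perp D U)) :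
    HasUniqueGood L D U := by
  obtain ⟨⟨U', h'⟩, huniq⟩ := h
  refine ⟨⟨perp D U', ?_⟩, fun U1 U2 h1 h2 => ?_⟩
  · have := h'.perp
    rwa [hU.perp_perp] at this
  · obtain ⟨g, hg, e⟩ := huniq _ _ h1.perp h2.perp
    obtain ⟨B1, A1, A1', -, hA1⟩ := h1.same.exists_pair
    obtain ⟨B2, A2, A2', -, hA2⟩ := h2.same.exists_pair
    refine ⟨g⁻¹, by simpa using hg, ?_⟩
    rw [← hA2.hasFrame.perp_perp, e, perp_scale hg, hA1.hasFrame.perp_perp]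

theorem crossRatio_swap_rows (A : E → E → F) (a b c d : E) :
    crossRatio A b a c d = (crossRatio A a b c d)⁻¹ := by
  simp [crossRatio, mul_comm]

theorem crossRatio_swap_cols (A : E → E → F) (a b c d : E) :
    crossRatio A a b d c = (crossRatio A a b c d)⁻¹ := by
  simp [crossRatio]

theorem crossRatio_mul_cols (a b c e : E) (h1 : A a d ≠ 0) (h2 : A b d ≠ 0) :
    crossRatio A a b c d * crossRatio A a b d e = crossRatio A a b c e := by
  unfold crossRatio
  by_cases h3 : A a e = 0
  · simp [h3]
  by_cases h4 : A b c = 0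
  · simp [h4]
  field_simp

theorem crossRatio_mul_rows (a x c d : E) (h1 : A b c ≠ 0) (h2 : A b d ≠ 0) :
    crossRatio A a b c d * crossRatio A b x c d = crossRatio A a x c d := by
  unfold crossRatio
  by_cases h3 : A a d = 0
  · simp [h3]
  by_cases h4 : A x c = 0
  · simp [h4]
  field_simp

theorem crossRatio_pivot (hac : A a c ≠ 0) (had : A a d ≠ 0) (hbc : A b c ≠ 0) (hb : b ≠ c)
    (hd : d ≠ a) : crossRatio (pivot A a c) c b a d = 1 - crossRatio A a b c d := by
  unfold crossRatio
  rw [pivot_self, pivot_of_ne A hb hd, pivot_row A hd, pivot_col A hb]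
  field_simp
  ring

theorem crossRatio_pivot_of_eq_zero (ha : A a y = 0) (hb : A b y = 0) (ha' : a ≠ y) (hb' : b ≠ y)
    (hc : c ≠ x) (hd : d ≠ x) : crossRatio (pivot A x y) a b c d = crossRatio A a b c d := by
  unfold crossRatio
  simp [pivot_of_ne A ha' hc, pivot_of_ne A ha' hd, pivot_of_ne A hb' hc, pivot_of_ne A hb' hd,
    ha, hb]

theorem crossRatio_pivot_col (hy : A x y ≠ 0) (hc : A x c = 0) (ha' : a ≠ y) (hb' : b ≠ y)
    (hcx : c ≠ x) : crossRatio (pivot A x y) a b c x = crossRatio A a b c y := by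
  unfold crossRatio
  simp only [pivot_of_ne A ha' hcx, pivot_of_ne A hb' hcx, pivot_col A ha', pivot_col A hb', hc]
  simp only [mul_zero, zero_div, sub_zero]
  by_cases h1 : A a y = 0
  · simp [h1]
  by_cases h2 : A b c = 0
  · simp [h2]
  field_simp

theorem lifts_self_rows (hL : IsLift L) (h : A a c = 0 ↔ A' a c = 0) (h' : A a d = 0 ↔ A' a d = 0) :
    Lifts L A A' a a c d := by
  unfold Lifts crossRatio
  by_cases h1 : A a c = 0
  · simp [h1, h.1 h1, hL.zero]
  by_cases h2 : A a d = 0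
  · simp [h2, h'.1 h2, hL.zero]
  rw [mul_comm, div_self (mul_ne_zero (mt h'.2 h2) (mt h.2 h1)), mul_comm,
    div_self (mul_ne_zero h2 h1), hL.one]

theorem lifts_self_cols (hL : IsLift L) (h : A a c = 0 ↔ A' a c = 0) (h' : A b c = 0 ↔ A' b c = 0) :
    Lifts L A A' a b c c := by
  unfold Lifts crossRatio
  by_cases h1 : A a c = 0
  · simp [h1, h.1 h1, hL.zero]
  by_cases h2 : A b c = 0
  · simp [h2, h'.1 h2, hL.zero]
  rw [div_self (mul_ne_zero (mt h.2 h1) (mt h'.2 h2)), div_self (mul_ne_zero h1 h2), hL.one]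

theorem Lifts.swap_rows (hL : IsLift L) (h : Lifts L A A' a b c d) : Lifts L A A' b a c d := by
  unfold Lifts at *
  rw [crossRatio_swap_rows, crossRatio_swap_rows A, h, hL.inv]

theorem Lifts.swap_cols (hL : IsLift L) (h : Lifts L A A' a b c d) : Lifts L A A' a b d c := by
  unfold Lifts at *
  rw [crossRatio_swap_cols, crossRatio_swap_cols A, h, hL.inv]

theorem lifts_pivot_iff (hL : IsLift L) (hac : A a c ≠ 0) (had : A a d ≠ 0) (hbc : A b c ≠ 0)
    (hac' : A' a c ≠ 0) (had' : A' a d ≠ 0) (hbc' : A' b c ≠ 0) (hb : b ≠ c) (hd : d ≠ a) :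
    Lifts L (pivot A a c) (pivot A' a c) c b a d ↔ Lifts L A A' a b c d := by
  unfold Lifts
  rw [crossRatio_pivot hac had hbc hb hd, crossRatio_pivot hac' had' hbc' hb hd, hL.one_sub]
  constructor <;> intro h
  · linear_combination -h
  · linear_combination -h

theorem SameFrames.compat (h : SameFrames D U U') (hA : IsFrame D U B A) (hA' : IsFrame D U' B A')
    (ha : a ∈ B) (hb : b ∈ B) (hc : c ∈ D \ B) (hd : d ∈ D \ B) :
    Compat (crossRatio A a b c d) (crossRatio A' a b c d) := by
  have e1 := h.support_iff hA hA' ha hc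
  have e2 := h.support_iff hA hA' ha hd
  have e3 := h.support_iff hA hA' hb hc
  have e4 := h.support_iff hA hA' hb hd
  refine ⟨by simp [crossRatio, e1, e2, e3, e4], ?_⟩
  by_cases h0 : A a c = 0 ∨ A a d = 0 ∨ A b c = 0 ∨ A b d = 0
  · have h0' := h0
    rw [e1, e2, e3, e4] at h0'
    have h1 : crossRatio A a b c d = 0 := by simpa [crossRatio] using by tauto
    have h2 : crossRatio A' a b c d = 0 := by simpa [crossRatio] using by tauto
    simp [h1, h2]
  push Not at h0
  obtain ⟨h1, h2, h3, h4⟩ := h0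
  have hbc : b ≠ c := fun h => (Finset.mem_sdiff.1 hc).2 (h ▸ hb)
  have hda : d ≠ a := fun h => (Finset.mem_sdiff.1 hd).2 (h ▸ ha)
  by_cases hab : a = b
  · subst hab
    have h1' := mt e1.2 h1
    have h2' := mt e2.2 h2
    simp [crossRatio, mul_comm, h1, h2, h1', h2']
  by_cases hcd : c = d
  · subst hcd
    have h1' := mt e1.2 h1
    have h3' := mt e3.2 h3
    simp [crossRatio, h1, h3, h1', h3']
  have p1 := hA.pivot ha hc h1
  have p2 := hA'.pivot ha hc (mt e1.2 h1)
  have := h.support_iff p1 p2 (b := b) (c := d) (by simp [hb, Ne.symm hab])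
    (by simp [(Finset.mem_sdiff.1 hd).1, Ne.symm hcd, (Finset.mem_sdiff.1 hd).2])
  rw [pivot_of_ne A hbc hda, pivot_of_ne A' hbc hda] at this
  rw [crossRatio, crossRatio, div_eq_one_iff_eq (mul_ne_zero h2 h3),
    div_eq_one_iff_eq (mul_ne_zero (mt e2.2 h2) (mt e3.2 h3))]
  rw [sub_eq_zero, sub_eq_zero, eq_div_iff h1, eq_div_iff (mt e1.2 h1)] at this
  rw [mul_comm (A a c), mul_comm (A a d), mul_comm (A' a c), mul_comm (A' a d)]
  exact this

theorem zmod_three (p : ZMod 3) : p = 0 ∨ p = 1 ∨ p = -1 := by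
  revert p; decide

theorem IsLift.mul (hL : IsLift L) {p q : ZMod 3} {p' q' : F} (hp : Compat p p') (hq : Compat q q')
    (hpq : Compat (p * q) (p' * q')) : L (p' * q') = L p' * L q' := by
  rcases zmod_three p with rfl | rfl | rfl
  · simp [hp.1.1 rfl, hL.zero]
  · simp [hp.2.1 rfl, hL.one]
  rcases zmod_three q with rfl | rfl | rfl
  · simp [hq.1.1 rfl, hL.zero]
  · simp [hq.2.1 rfl, hL.one]
  have h1 := hpq.2.1 (by decide)
  have h0 : p' ≠ 0 := left_ne_zero_of_mul_eq_one h1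
  rw [h1, eq_inv_of_mul_eq_one_right h1, hL.inv, mul_inv_cancel₀ (hL.ne_zero h0), hL.one]

end Good

section Parallel

variable {E : Type*} [DecidableEq E] {F K : Type*} [Field F] [Field K]

/-- The configurations `U` and `U'` restricted to `D \ {e}` have the same bases, and cross-ratios
in `U'` are the lifts of those in `U`. -/
structure GoodOff (L : F → K) (D : Finset E) (U : Set (E → F)) (U' : Set (E → K)) (e : E) :
    Prop where
  iff : ∀ B, e ∉ B → (HasFrame D U B ↔ HasFrame D U' B)
  lifts : ∀ B A A', e ∉ B → IsFrame D U B A → IsFrame D U' B A' →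
    ∀ a ∈ B, ∀ b ∈ B, ∀ c ∈ D \ B, ∀ d ∈ D \ B, c ≠ e → d ≠ e → Lifts L A A' a b c d

/-- The elements `u` and `v` are adjacent in the fundamental graph of the basis `B`. -/
def Meets (D B : Finset E) (A : E → E → F) (u v : E) : Prop :=
  (u ∈ B ∧ v ∈ D \ B ∧ A u v ≠ 0) ∨ (v ∈ B ∧ u ∈ D \ B ∧ A v u ≠ 0)

/-- The elements `u` and `v` are adjacent in the fundamental graph of `B` with `e`, `f` deleted. -/
def MeetsOff (D B : Finset E) (A : E → E → F) (e f u v : E) : Prop :=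
  Meets D B A u v ∧ u ≠ e ∧ u ≠ f ∧ v ≠ e ∧ v ≠ f

/-- The neighbours of `e` in the fundamental graph of `B` lie in the same component
after deleting `e` and `f`. -/
def Clustered (D B : Finset E) (A : E → E → F) (e f : E) : Prop :=
  ∃ z, ∀ i ∈ B, A i e ≠ 0 → Relation.ReflTransGen (MeetsOff D B A e f) i z

/-- The rows `a` and `b` have a common nonzero column other than `e`, `f`. -/
def Shares (D B : Finset E) (A : E → E → F) (e f a b : E) : Prop :=
  a ∈ B ∧ b ∈ B ∧ ∃ c ∈ D \ B, c ≠ e ∧ c ≠ f ∧ A a c ≠ 0 ∧ A b c ≠ 0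

/-- There is a chain of `n` steps from row `a` to row `b`. -/
def Link (D B : Finset E) (A : E → E → F) (e f : E) : ℕ → E → E → Prop
  | 0, a, b => a = b
  | n + 1, a, b => ∃ r, Shares D B A e f a r ∧ Link D B A e f n r b

variable {D D' B B' C X : Finset E} {U₃ : Set (E → ZMod 3)} {U : Set (E → F)} {U' : Set (E → K)}
  {A₃ : E → E → ZMod 3} {A : E → E → F} {A' : E → E → K} {L : F → K}
  {a b c d e f x y z : E} {g : E → K}

theorem GoodOff.support_iff (h : GoodOff L D U U' e) (hA : IsFrame D U B A)
    (hA' : IsFrame D U' B A') (he : e ∉ B) (hb : b ∈ B) (hc : c ∈ D \ B) (hce : c ≠ e) :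
    A b c = 0 ↔ A' b c = 0 :=
  hA.support_iff hA' hb hc (h.iff _ (by simp [Ne.symm hce, he]))

theorem good_erase_iff (hB : HasFrame D U B) (hB' : HasFrame D U' B) (he : e ∉ B) :
    Good L (D.erase e) (minorSpace (D.erase e) ∅ U) (minorSpace (D.erase e) ∅ U') ↔
      GoodOff L D U U' e := by
  have hD : D.erase e ⊆ D := Finset.erase_subset _ _
  have hC : B ⊆ D.erase e := Finset.subset_erase.2 ⟨hB.subset, he⟩
  have hX : Disjoint ∅ (D.erase e) := Finset.disjoint_empty_left _
  have k1 : ∀ C, HasFrame (D.erase e) (minorSpace (D.erase e) ∅ U) C ↔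
      C ⊆ D.erase e ∧ HasFrame D U C := fun C => by
    have := HasFrame.minor_iff (X := ∅) (B := C) (by simpa using hB) hD hC hX
    simpa using this
  have k2 : ∀ C, HasFrame (D.erase e) (minorSpace (D.erase e) ∅ U') C ↔
      C ⊆ D.erase e ∧ HasFrame D U' C := fun C => by
    have := HasFrame.minor_iff (X := ∅) (B := C) (by simpa using hB') hD hC hX
    simpa using this
  constructor
  · intro h
    have hfr : ∀ C, e ∉ C → (HasFrame D U C ↔ HasFrame D U' C) := fun C hC => by
      have := h.same.iff C
      rw [k1, k2] at this
      constructor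
      · intro hU
        exact (this.1 ⟨Finset.subset_erase.2 ⟨hU.subset, hC⟩, hU⟩).2
      · intro hU
        exact (this.2 ⟨Finset.subset_erase.2 ⟨hU.subset, hC⟩, hU⟩).2
    refine ⟨hfr, fun C A A' heC hA hA' a ha b hb c hc d hd hce hde => ?_⟩
    have hCe : C ⊆ D.erase e := Finset.subset_erase.2 ⟨hA.1, heC⟩
    rw [Finset.mem_sdiff] at hc hd
    exact h.lifts C A A' (IsFrame.minor' (by simpa using hA) hD hCe hX)
      (IsFrame.minor' (by simpa using hA') hD hCe hX) a ha b hb c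
      (by simp [hc, hce]) d (by simp [hd, hde])
  · intro h
    refine ⟨⟨⟨B, (k1 B).2 ⟨hC, hB⟩⟩, fun C => ?_⟩,
      fun C A A' hA hA' a ha b hb c hc d hd => ?_⟩
    · rw [k1, k2]
      exact and_congr_right fun hC => h.iff C fun h => by simpa using hC h
    · obtain ⟨A1, h1, e1⟩ := IsFrame.exists_of_minor (by simpa using hB) hD hC hX hA
      obtain ⟨A2, h2, e2⟩ := IsFrame.exists_of_minor (by simpa using hB') hD hC hX hA'
      rw [Finset.union_empty] at h1 h2
      have heC : e ∉ C := fun h => by simpa using hA.1 h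
      have hc' := hc
      have hd' := hd
      simp only [Finset.mem_sdiff, Finset.mem_erase] at hc hd
      have := h.lifts C A1 A2 heC h1 h2 a ha b hb c (by simp [hc]) d (by simp [hd]) hc.1.1 hd.1.1
      unfold Lifts at this ⊢
      rwa [crossRatio_congr (e1 a ha c hc') (e1 a ha d hd') (e1 b hb c hc') (e1 b hb d hd'),
        crossRatio_congr (e2 a ha c hc') (e2 a ha d hd') (e2 b hb c hc') (e2 b hb d hd')] at this

theorem Lifts.mul_cols (hL : IsLift L) (hP : SameFrames D U₃ U) (h₃ : IsFrame D U₃ B A₃)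
    (h : IsFrame D U B A) (ha : a ∈ B) (hb : b ∈ B) (hc : c ∈ D \ B) (hd : d ∈ D \ B)
    (he : e ∈ D \ B) (had : A a d ≠ 0) (hbd : A b d ≠ 0) (had' : A' a d ≠ 0) (hbd' : A' b d ≠ 0)
    (h1 : Lifts L A A' a b c d) (h2 : Lifts L A A' a b d e) : Lifts L A A' a b c e := by
  unfold Lifts at *
  rw [← crossRatio_mul_cols a b c e had' hbd', ← crossRatio_mul_cols a b c e had hbd, h1, h2]
  refine (hL.mul (hP.compat h₃ h ha hb hc hd) (hP.compat h₃ h ha hb hd he) ?_).symm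
  rw [crossRatio_mul_cols a b c e had hbd, crossRatio_mul_cols a b c e
    (mt (hP.support_iff h₃ h ha hd).1 had) (mt (hP.support_iff h₃ h hb hd).1 hbd)]
  exact hP.compat h₃ h ha hb hc he

theorem Lifts.mul_rows (hL : IsLift L) (hP : SameFrames D U₃ U) (h₃ : IsFrame D U₃ B A₃)
    (h : IsFrame D U B A) (ha : a ∈ B) (hb : b ∈ B) (hx : x ∈ B) (hc : c ∈ D \ B) (hd : d ∈ D \ B)
    (hbc : A b c ≠ 0) (hbd : A b d ≠ 0) (hbc' : A' b c ≠ 0) (hbd' : A' b d ≠ 0)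
    (h1 : Lifts L A A' a b c d) (h2 : Lifts L A A' b x c d) : Lifts L A A' a x c d := by
  unfold Lifts at *
  rw [← crossRatio_mul_rows a x c d hbc' hbd', ← crossRatio_mul_rows a x c d hbc hbd, h1, h2]
  refine (hL.mul (hP.compat h₃ h ha hb hc hd) (hP.compat h₃ h hb hx hc hd) ?_).symm
  rw [crossRatio_mul_rows a x c d hbc hbd, crossRatio_mul_rows a x c d
    (mt (hP.support_iff h₃ h hb hc).1 hbc) (mt (hP.support_iff h₃ h hb hd).1 hbd)]
  exact hP.compat h₃ h ha hx hc hd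

/-- The setting in which two columns `e`, `f` are compared: both `U \ e` and `U \ f` lift. -/
structure Pair (L : F → K) (D : Finset E) (U₃ : Set (E → ZMod 3)) (U : Set (E → F))
    (U' : Set (E → K)) (e f : E) : Prop where
  lift : IsLift L
  same : SameFrames D U₃ U
  left : GoodOff L D U U' e
  right : GoodOff L D U U' f
  ne : e ≠ f
  mem_left : e ∈ D
  mem_right : f ∈ D

/-- Matrices of the three configurations with respect to a common basis. -/
structure Frames (D : Finset E) (U₃ : Set (E → ZMod 3)) (U : Set (E → F)) (U' : Set (E → K))
    (B : Finset E) (A₃ : E → E → ZMod 3) (A : E → E → F) (A' : E → E → K) : Prop where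
  three : IsFrame D U₃ B A₃
  two : IsFrame D U B A
  lift : IsFrame D U' B A'

theorem Pair.symm (h : Pair L D U₃ U U' e f) : Pair L D U₃ U U' f e :=
  ⟨h.lift, h.same, h.right, h.left, h.ne.symm, h.mem_right, h.mem_left⟩

theorem Pair.support_iff (h : Pair L D U₃ U U' e f) (hA : Frames D U₃ U U' B A₃ A A')
    (he : e ∉ B) (hf : f ∉ B) (hb : b ∈ B) (hc : c ∈ D \ B) : A b c = 0 ↔ A' b c = 0 := by
  by_cases hce : c = e
  · subst hce
    exact h.right.support_iff hA.two hA.lift hf hb hc h.ne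
  · exact h.left.support_iff hA.two hA.lift he hb hc hce

theorem Frames.pivot (hA : Frames D U₃ U U' B A₃ A A') (hP : SameFrames D U₃ U) (hx : x ∈ B)
    (hy : y ∈ D \ B) (h : A x y ≠ 0) (h' : A' x y ≠ 0) :
    Frames D U₃ U U' (insert y (B.erase x)) (pivot A₃ x y) (pivot A x y) (pivot A' x y) :=
  ⟨hA.three.pivot hx hy (mt (hP.support_iff hA.three hA.two hx hy).1 h), hA.two.pivot hx hy h,
    hA.lift.pivot hx hy h'⟩

theorem Pair.lifts_of_common (h : Pair L D U₃ U U' e f) (hA : Frames D U₃ U U' B A₃ A A')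
    (he : e ∉ B) (hf : f ∉ B) (ha : a ∈ B) (hb : b ∈ B) (hc : c ∈ D \ B) (hce : c ≠ e)
    (hcf : c ≠ f) (hac : A a c ≠ 0) (hbc : A b c ≠ 0) : Lifts L A A' a b e f := by
  have heD : e ∈ D \ B := by simp [h.mem_left, he]
  have hfD : f ∈ D \ B := by simp [h.mem_right, hf]
  exact Lifts.mul_cols h.lift h.same hA.three hA.two ha hb heD hc hfD hac hbc
    (mt (h.support_iff hA he hf ha hc).2 hac) (mt (h.support_iff hA he hf hb hc).2 hbc)
    (h.right.lifts _ _ _ hf hA.two hA.lift a ha b hb e heD c hc h.ne hcf)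
    (h.left.lifts _ _ _ he hA.two hA.lift a ha b hb c hc f hfD hce h.ne.symm)

theorem crossRatio_pivot_row_zero (hxy : A x y ≠ 0) (hae : A a e ≠ 0) (hby : A b y = 0)
    (hxf : A x f = 0) (hay : a ≠ y) (hb : b ≠ y) (he : e ≠ x) (hf : f ≠ x) :
    crossRatio (pivot A x y) a b e f = crossRatio A a b e f * (1 - crossRatio A a x y e) := by
  unfold crossRatio
  rw [pivot_of_ne _ hay he, pivot_of_ne _ hay hf, pivot_of_ne _ hb he, pivot_of_ne _ hb hf, hby,
    hxf]
  simp only [mul_zero, zero_mul, zero_div, sub_zero]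
  by_cases h5 : A a f = 0
  · simp [h5]
  by_cases h6 : A b e = 0
  · simp [h6]
  field_simp

theorem crossRatio_pivot_fano (hxy : A x y ≠ 0) (hxz : A x z ≠ 0) (hae : A a e ≠ 0)
    (hay : A a y ≠ 0) (hbe : A b e ≠ 0) (hbf : A b f ≠ 0) (hby : A b y = 0)
    (haz : A a z = 0) (hxf : A x f = 0) (hxe : A x e ≠ 0) (hbz : A b z ≠ 0)
    (hq : crossRatio A a x y e = 1) (hq' : crossRatio A b x z e = 1) (ha : a ≠ z) (hb : b ≠ z)
    (hf : f ≠ x) (hy : y ≠ x) :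
    crossRatio (pivot A x z) a b f y = -(crossRatio A a b e f)⁻¹ := by
  unfold crossRatio at *
  rw [pivot_of_ne _ ha hy, pivot_of_ne _ ha hf, pivot_of_ne _ hb hy, pivot_of_ne _ hb hf, hby,
    haz, hxf]
  rw [div_eq_one_iff_eq (mul_ne_zero hae hxy)] at hq
  rw [div_eq_one_iff_eq (mul_ne_zero hbe hxz)] at hq'
  have e1 : A x y = A a y * A x e / A a e := by rw [hq]; field_simp
  have e2 : A x z = A b z * A x e / A b e := by rw [hq']; field_simp
  rw [e1, e2]
  field_simp
  ring

theorem crossRatio_pivot_of_row_eq_zero (he : A x e = 0) (hf : A x f = 0) (ha : a ≠ y)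
    (hb : b ≠ y) (hex : e ≠ x) (hfx : f ≠ x) :
    crossRatio (pivot A x y) a b e f = crossRatio A a b e f := by
  unfold crossRatio
  rw [pivot_of_ne _ ha hex, pivot_of_ne _ ha hfx, pivot_of_ne _ hb hex, pivot_of_ne _ hb hfx, he,
    hf]
  simp

section Local

variable (h : Pair L D U₃ U U' e f) (hA : Frames D U₃ U U' B A₃ A A')
  (he : e ∉ B) (hf : f ∉ B) (ha : a ∈ B) (hb : b ∈ B) (hx : x ∈ B) (hy : y ∈ D \ B)
  (hz : z ∈ D \ B) (hye : y ≠ e) (hyf : y ≠ f) (hze : z ≠ e) (hzf : z ≠ f)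
  (hay : A a y ≠ 0) (hxy : A x y ≠ 0) (hxz : A x z ≠ 0) (hbz : A b z ≠ 0) (haz : A a z = 0)
  (hby : A b y = 0) (hae : A a e ≠ 0) (haf : A a f ≠ 0) (hbe : A b e ≠ 0) (hbf : A b f ≠ 0)

include h hA he hf ha hb hx hy hz hye hyf hze hzf hay hxy hxz hbz haz hby hae haf hbe hbf

theorem Pair.lifts_of_ne_one (hxe : A x e ≠ 0) (hxf : A x f = 0)
    (hq : crossRatio A a x y e ≠ 1) : Lifts L A A' a b e f := by
  have heD : e ∈ D \ B := by simp [h.mem_left, he]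
  have hfD : f ∈ D \ B := by simp [h.mem_right, hf]
  have S := fun {r c} (hr : r ∈ B) (hc : c ∈ D \ B) => h.support_iff hA he hf hr hc
  have S3 := fun {r c} (hr : r ∈ B) (hc : c ∈ D \ B) => h.same.support_iff hA.three hA.two hr hc
  have hxy' := mt (S hx hy).2 hxy
  have hae' := mt (S ha heD).2 hae
  have ne : ∀ {r c}, r ∈ B → c ∈ D \ B → r ≠ c := fun hr hc h =>
    (Finset.mem_sdiff.1 hc).2 (h ▸ hr)
  have hax : a ≠ x := fun h => hxz (h ▸ haz)
  have hbx : b ≠ x := fun h => hxy (h ▸ hby)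
  have hzy : z ≠ y := fun h => hay (h ▸ haz)
  have hp := hA.pivot h.same hx hy hxy hxy'
  have hmem : ∀ {r}, r ∈ B → r ≠ x → r ∈ insert y (B.erase x) := fun hr hrx => by simp [hr, hrx]
  have hmem' : ∀ {c}, c ∈ D \ B → c ≠ y → c ∈ D \ insert y (B.erase x) := fun hc hcy => by
    simp only [Finset.mem_sdiff, Finset.mem_insert, Finset.mem_erase] at hc ⊢
    tauto
  have key := h.lifts_of_common hp (a := a) (b := b) (c := z) (by simp [hye.symm, he])
    (by simp [hyf.symm, hf]) (hmem ha hax) (hmem hb hbx) (hmem' hz hzy) hze hzf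
    (by rw [pivot_of_ne _ (ne ha hy) (ne hx hz).symm, haz]; simp [hay, hxz, hxy])
    (by rw [pivot_of_ne _ (ne hb hy) (ne hx hz).symm, hby]; simpa using hbz)
  have hcomp := h.same.compat hp.three hp.two (hmem ha hax) (hmem hb hbx) (hmem' heD hye.symm)
    (hmem' hfD hyf.symm)
  have hlq := h.right.lifts _ _ _ hf hA.two hA.lift a ha x hx y hy e heD hyf h.ne
  have hcq := h.same.compat hA.three hA.two ha hx hy heD
  have hcp := h.same.compat hA.three hA.two ha hb heD hfD
  have hp0 : crossRatio A a b e f ≠ 0 := by simp [crossRatio, *]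
  have hq0 : crossRatio A a x y e ≠ 0 := by simp [crossRatio, *]
  unfold Lifts at key hlq ⊢
  rw [crossRatio_pivot_row_zero hxy' hae' ((S hb hy).1 hby) ((S hx hfD).1 hxf) (ne ha hy)
    (ne hb hy) (ne hx heD).symm (ne hx hfD).symm,
    crossRatio_pivot_row_zero hxy hae hby hxf (ne ha hy) (ne hb hy) (ne hx heD).symm
    (ne hx hfD).symm, hlq] at key
  rw [crossRatio_pivot_row_zero hxy hae hby hxf (ne ha hy) (ne hb hy) (ne hx heD).symm
    (ne hx hfD).symm,
    crossRatio_pivot_row_zero (mt (S3 hx hy).1 hxy) (mt (S3 ha heD).1 hae)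
    ((S3 hb hy).2 hby) ((S3 hx hfD).2 hxf) (ne ha hy) (ne hb hy) (ne hx heD).symm
    (ne hx hfD).symm] at hcomp
  rw [← h.lift.one_sub] at key
  have hL0 : L (1 - crossRatio A a x y e) ≠ 0 :=
    h.lift.ne_zero (sub_ne_zero.2 (Ne.symm hq))
  have hq3 : crossRatio A₃ a x y e = -1 := by
    rcases zmod_three (crossRatio A₃ a x y e) with h | h | h
    · exact absurd (hcq.1.1 h) hq0
    · exact absurd (hcq.2.1 h) hq
    · exact h
  rcases zmod_three (crossRatio A₃ a b e f) with h3 | h3 | h3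
  · exact absurd (hcp.1.1 h3) hp0
  · rw [hcp.2.1 h3, one_mul] at key
    rw [hcp.2.1 h3, h.lift.one]
    exact mul_right_cancel₀ hL0 (by rw [key, one_mul])
  · have h1 := hcomp.2.1 (by rw [hq3, h3]; decide)
    rw [h1, h.lift.one] at key
    rw [eq_inv_of_mul_eq_one_left h1, h.lift.inv]
    exact eq_inv_of_mul_eq_one_left key

theorem Pair.lifts_of_two_of_zero [CharP F 2] (hxe : A x e ≠ 0) (hxf : A x f = 0) :
    Lifts L A A' a b e f := by
  have heD : e ∈ D \ B := by simp [h.mem_left, he]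
  have hfD : f ∈ D \ B := by simp [h.mem_right, hf]
  have S := fun {r c} (hr : r ∈ B) (hc : c ∈ D \ B) => h.support_iff hA he hf hr hc
  have S3 := fun {r c} (hr : r ∈ B) (hc : c ∈ D \ B) => h.same.support_iff hA.three hA.two hr hc
  by_cases hq : crossRatio A a x y e = 1
  swap
  · exact h.lifts_of_ne_one hA he hf ha hb hx hy hz hye hyf hze hzf hay hxy hxz hbz haz hby
      hae haf hbe hbf hxe hxf hq
  by_cases hq' : crossRatio A b x z e = 1
  swap
  · exact (h.lifts_of_ne_one hA he hf hb ha hx hz hy hze hzf hye hyf hbz hxz hxy hay hby haz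
      hbe hbf hae haf hxe hxf hq').swap_rows h.lift
  exfalso
  have ne : ∀ {r c}, r ∈ B → c ∈ D \ B → r ≠ c := fun hr hc h =>
    (Finset.mem_sdiff.1 hc).2 (h ▸ hr)
  have hax : a ≠ x := fun h => hxz (h ▸ haz)
  have hbx : b ≠ x := fun h => hxy (h ▸ hby)
  have hzy : y ≠ z := fun h => hay (h ▸ haz)
  have hp := hA.pivot h.same hx hz hxz (mt (S hx hz).2 hxz)
  have hmem : ∀ {r}, r ∈ B → r ≠ x → r ∈ insert z (B.erase x) := fun hr hrx => by simp [hr, hrx]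
  have hmem' : ∀ {c}, c ∈ D \ B → c ≠ z → c ∈ D \ insert z (B.erase x) := fun hc hcy => by
    simp only [Finset.mem_sdiff, Finset.mem_insert, Finset.mem_erase] at hc ⊢
    tauto
  have hcp := h.same.compat hA.three hA.two ha hb heD hfD
  have hcomp := h.same.compat hp.three hp.two (hmem ha hax) (hmem hb hbx) (hmem' hfD hzf.symm)
    (hmem' hy hzy)
  have hp0 : crossRatio A a b e f ≠ 0 := by simp [crossRatio, *]
  rw [crossRatio_pivot_fano hxy hxz hae hay hbe hbf hby haz hxf hxe hbz hq hq'
      (ne ha hz) (ne hb hz) (ne hx hfD).symm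
      (ne hx hy).symm,
    crossRatio_pivot_fano (mt (S3 hx hy).1 hxy) (mt (S3 hx hz).1 hxz) (mt (S3 ha heD).1 hae)
      (mt (S3 ha hy).1 hay) (mt (S3 hb heD).1 hbe) (mt (S3 hb hfD).1 hbf)
      ((S3 hb hy).2 hby) ((S3 ha hz).2 haz) ((S3 hx hfD).2 hxf) (mt (S3 hx heD).1 hxe)
      (mt (S3 hb hz).1 hbz) ((h.same.compat hA.three hA.two ha hx hy heD).2.2 hq)
      ((h.same.compat hA.three hA.two hb hx hz heD).2.2 hq')
      (ne ha hz) (ne hb hz) (ne hx hfD).symm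
      (ne hx hy).symm] at hcomp
  rcases zmod_three (crossRatio A₃ a b e f) with h3 | h3 | h3
  · exact hp0 (hcp.1.1 h3)
  · rw [h3, hcp.2.1 h3] at hcomp
    have := hcomp.2.2 (by rw [inv_one, CharTwo.neg_eq])
    rw [inv_one] at this
    revert this; decide
  · have h1 := hcomp.2.1 (by rw [h3, inv_neg, inv_one, neg_neg])
    rw [CharTwo.neg_eq, inv_eq_one] at h1
    have := hcp.2.2 h1
    rw [h3] at this
    revert this; decide

theorem Pair.lifts_of_two [CharP F 2] : Lifts L A A' a b e f := by
  have heD : e ∈ D \ B := by simp [h.mem_left, he]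
  have hfD : f ∈ D \ B := by simp [h.mem_right, hf]
  have S := fun {r c} (hr : r ∈ B) (hc : c ∈ D \ B) => h.support_iff hA he hf hr hc
  by_cases hxe : A x e = 0
  · by_cases hxf : A x f = 0
    · have ne : ∀ {r c}, r ∈ B → c ∈ D \ B → r ≠ c := fun hr hc h =>
        (Finset.mem_sdiff.1 hc).2 (h ▸ hr)
      have hax : a ≠ x := fun h => hxz (h ▸ haz)
      have hbx : b ≠ x := fun h => hxy (h ▸ hby)
      have hzy : y ≠ z := fun h => hay (h ▸ haz)
      have hp := hA.pivot h.same hx hz hxz (mt (S hx hz).2 hxz)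
      have key := h.lifts_of_common hp (a := a) (b := b) (c := y) (by simp [hze.symm, he])
        (by simp [hzf.symm, hf]) (by simp [ha, hax]) (by simp [hb, hbx])
        (by
          rw [Finset.mem_sdiff] at hy
          simp [hy, hzy]) hye hyf
        (by rw [pivot_of_ne _ (ne ha hz) (ne hx hy).symm, haz]; simpa using hay)
        (by rw [pivot_of_ne _ (ne hb hz) (ne hx hy).symm, hby]; simp [hbz, hxz, hxy])
      unfold Lifts at key ⊢
      rwa [crossRatio_pivot_of_row_eq_zero hxe hxf (ne ha hz) (ne hb hz)
        (ne hx heD).symm (ne hx hfD).symm,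
        crossRatio_pivot_of_row_eq_zero ((S hx heD).1 hxe) ((S hx hfD).1 hxf) (ne ha hz) (ne hb hz)
        (ne hx heD).symm (ne hx hfD).symm] at key
    · exact (h.symm.lifts_of_two_of_zero hA hf he ha hb hx hy hz hyf hye hzf hze hay hxy hxz hbz
        haz hby haf hae hbf hbe hxf hxe).swap_cols h.lift
  · by_cases hxf : A x f = 0
    · exact h.lifts_of_two_of_zero hA he hf ha hb hx hy hz hye hyf hze hzf hay hxy hxz hbz haz hby
        hae haf hbe hbf hxe hxf
    · exact Lifts.mul_rows h.lift h.same hA.three hA.two ha hx hb heD hfD hxe hxf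
        (mt (S hx heD).2 hxe) (mt (S hx hfD).2 hxf)
        (h.lifts_of_common hA he hf ha hx hy hye hyf hay hxy)
        (h.lifts_of_common hA he hf hx hb hz hze hzf hxz hbz)

end Local

theorem Link.pivot {n : ℕ} (hx : x ∈ B) (hy : y ∈ D \ B) (hxy : A x y ≠ 0)
    (hl : Link D B A e f n a b) (hn : ∀ k ≤ n, ¬ Link D B A e f k x b) :
    Link D (insert y (B.erase x)) (Paper.pivot A x y) e f n a b := by
  induction n generalizing a with
  | zero => exact hl
  | succ n ih =>
    obtain ⟨r, ⟨ha, hr, c, hc, hce, hcf, hac, hrc⟩, hl⟩ := hl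
    have hxc : A x c = 0 := by
      by_contra hxc
      exact hn (n + 1) le_rfl ⟨r, ⟨hx, hr, c, hc, hce, hcf, hxc, hrc⟩, hl⟩
    have hax : a ≠ x := fun h => hac (h ▸ hxc)
    have hrx : r ≠ x := fun h => hrc (h ▸ hxc)
    have hcy : c ≠ y := fun h => hxy (h ▸ hxc)
    have hcx : c ≠ x := fun h => (Finset.mem_sdiff.1 hc).2 (h ▸ hx)
    have ne : ∀ {r}, r ∈ B → r ≠ y := fun hr h => (Finset.mem_sdiff.1 hy).2 (h ▸ hr)
    refine ⟨r, ⟨by simp [ha, hax], by simp [hr, hrx], c, ?_, hce, hcf, ?_, ?_⟩,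
      ih hl fun k hk => hn k (by omega)⟩
    · rw [Finset.mem_sdiff] at hc
      simp [hc, hcy]
    · rw [pivot_of_ne _ (ne ha) hcx, hxc]
      simpa using hac
    · rw [pivot_of_ne _ (ne hr) hcx, hxc]
      simpa using hrc

theorem Pair.lifts_of_link [CharP F 2] (h : Pair L D U₃ U U' e f) {n : ℕ}
    (hA : Frames D U₃ U U' B A₃ A A') (he : e ∉ B) (hf : f ∉ B) (ha : a ∈ B) (hb : b ∈ B)
    (hae : A a e ≠ 0) (haf : A a f ≠ 0) (hbe : A b e ≠ 0) (hbf : A b f ≠ 0)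
    (hl : Link D B A e f n a b) : Lifts L A A' a b e f := by
  induction n using Nat.strong_induction_on generalizing B A₃ A A' with
  | _ n ih =>
  by_cases hmin : ∃ k < n, Link D B A e f k a b
  · obtain ⟨k, hk, hkl⟩ := hmin
    exact ih k hk hA he hf ha hb hae haf hbe hbf hkl
  push Not at hmin
  have heD : e ∈ D \ B := by simp [h.mem_left, he]
  have hfD : f ∈ D \ B := by simp [h.mem_right, hf]
  have S := fun {r c} (hr : r ∈ B) (hc : c ∈ D \ B) => h.support_iff hA he hf hr hc
  match n with
  | 0 =>
    cases hl
    exact lifts_self_rows h.lift (S ha heD) (S ha hfD)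
  | 1 =>
    obtain ⟨r, ⟨-, hr, c, hc, hce, hcf, hac, hrc⟩, rfl⟩ := hl
    exact h.lifts_of_common hA he hf ha hr hc hce hcf hac hrc
  | n + 2 =>
    obtain ⟨x, ⟨-, hx, y, hy, hye, hyf, hay, hxy⟩, r, ⟨-, hr, z, hz, hze, hzf, hxz, hrz⟩, hl⟩ := hl
    have haz : A a z = 0 := by
      by_contra haz
      exact hmin (n + 1) (by omega) ⟨r, ⟨ha, hr, z, hz, hze, hzf, haz, hrz⟩, hl⟩
    have hry : A r y = 0 := by
      by_contra hry
      exact hmin (n + 1) (by omega) ⟨r, ⟨ha, hr, y, hy, hye, hyf, hay, hry⟩, hl⟩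
    match n with
    | 0 =>
      cases hl
      exact h.lifts_of_two hA he hf ha hb hx hy hz hye hyf hze hzf hay hxy hxz hrz haz hry hae haf
        hbe hbf
    | n + 1 =>
      have hbz : A b z = 0 := by
        by_contra hbz
        exact hmin 2 (by omega) ⟨x, ⟨ha, hx, y, hy, hye, hyf, hay, hxy⟩, b,
          ⟨hx, hb, z, hz, hze, hzf, hxz, hbz⟩, rfl⟩
      have hax : a ≠ x := fun h => hxz (h ▸ haz)
      have hbx : b ≠ x := fun h => hxz (h ▸ hbz)
      have hrx : r ≠ x := fun h => hxy (h ▸ hry)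
      have hyz : y ≠ z := fun h => hay (h ▸ haz)
      have ne : ∀ {r c}, r ∈ B → c ∈ D \ B → r ≠ c := fun hr hc h =>
        (Finset.mem_sdiff.1 hc).2 (h ▸ hr)
      have hp := hA.pivot h.same hx hz hxz (mt (S hx hz).2 hxz)
      have hl' := hl.pivot hx hz hxz fun k hk hkl => hmin (k + 1) (by omega)
        ⟨x, ⟨ha, hx, y, hy, hye, hyf, hay, hxy⟩, hkl⟩
      have hpe : ∀ {c}, c ∈ D \ B → Paper.pivot A x z a c = A a c := fun hc => by
        rw [pivot_of_ne _ (ne ha hz) (ne hx hc).symm, haz]; simp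
      have hpe' : ∀ {c}, c ∈ D \ B → Paper.pivot A x z b c = A b c := fun hc => by
        rw [pivot_of_ne _ (ne hb hz) (ne hx hc).symm, hbz]; simp
      have ha' : a ∈ insert z (B.erase x) := by simp [ha, hax]
      have hb' : b ∈ insert z (B.erase x) := by simp [hb, hbx]
      have key := ih (n + 2) (by omega) hp (by simp [hze.symm, he]) (by simp [hzf.symm, hf])
        ha' hb' (by rwa [hpe heD]) (by rwa [hpe hfD]) (by rwa [hpe' heD]) (by rwa [hpe' hfD])
        ⟨r, ⟨ha', by simp [hr, hrx], y, by
          rw [Finset.mem_sdiff] at hy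
          simp [hy, hyz], hye, hyf, by rwa [hpe hy], by
          rw [pivot_of_ne _ (ne hr hz) (ne hx hy).symm, hry]; simp [hrz, hxz, hxy]⟩, hl'⟩
      unfold Lifts at key ⊢
      rwa [crossRatio_pivot_of_eq_zero haz hbz (ne ha hz) (ne hb hz) (ne hx heD).symm
        (ne hx hfD).symm, crossRatio_pivot_of_eq_zero ((S ha hz).1 haz) ((S hb hz).1 hbz)
        (ne ha hz) (ne hb hz) (ne hx heD).symm (ne hx hfD).symm] at key

end Parallel

section Closure

variable {E : Type*} [DecidableEq E] {F K : Type*} [Field F] [Field K]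

/-- All cross-ratios with respect to the basis `B` lift. -/
def AllLift (L : F → K) (D : Finset E) (U : Set (E → F)) (U' : Set (E → K)) (B : Finset E) :
    Prop :=
  ∀ A A', IsFrame D U B A → IsFrame D U' B A' →
    ∀ a ∈ B, ∀ b ∈ B, ∀ c ∈ D \ B, ∀ d ∈ D \ B, Lifts L A A' a b c d

/-- The configurations over `ZMod 3`, `F`, `K` have the same bases. -/
structure Triple (L : F → K) (D : Finset E) (U₃ : Set (E → ZMod 3)) (U : Set (E → F))
    (U' : Set (E → K)) : Prop where
  lift : IsLift L
  same : SameFrames D U₃ U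
  same' : SameFrames D U U'

variable {D B B' : Finset E} {U₃ : Set (E → ZMod 3)} {U : Set (E → F)} {U' : Set (E → K)}
  {A₃ : E → E → ZMod 3} {A : E → E → F} {A' : E → E → K} {L : F → K}
  {a b c d e f g x y z : E}

theorem lifts_of_eq_zero (hL : IsLift L) (h1 : A a c = 0 ↔ A' a c = 0)
    (h2 : A a d = 0 ↔ A' a d = 0) (h3 : A b c = 0 ↔ A' b c = 0) (h4 : A b d = 0 ↔ A' b d = 0)
    (h : A a c ≠ 0 → A a d ≠ 0 → A b c ≠ 0 → A b d ≠ 0 → Lifts L A A' a b c d) :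
    Lifts L A A' a b c d := by
  unfold Lifts
  by_cases k1 : A a c = 0
  · simp [crossRatio, k1, h1.1 k1, hL.zero]
  by_cases k2 : A a d = 0
  · simp [crossRatio, k2, h2.1 k2, hL.zero]
  by_cases k3 : A b c = 0
  · simp [crossRatio, k3, h3.1 k3, hL.zero]
  by_cases k4 : A b d = 0
  · simp [crossRatio, k4, h4.1 k4, hL.zero]
  exact h k1 k2 k3 k4

theorem ne_of_mem_sdiff {r c : E} (hr : r ∈ B) (hc : c ∈ D \ B) : r ≠ c := fun h =>
  (Finset.mem_sdiff.1 hc).2 (h ▸ hr)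

theorem mem_exchange {r x y : E} (hr : r ∈ B) (hrx : r ≠ x) : r ∈ insert y (B.erase x) := by
  simp [hr, hrx]

theorem mem_sdiff_exchange {c x y : E} (hc : c ∈ D \ B) (hcy : c ≠ y) :
    c ∈ D \ insert y (B.erase x) := by
  simp only [Finset.mem_sdiff, Finset.mem_insert, Finset.mem_erase] at hc ⊢
  tauto

theorem mem_sdiff_exchange_self {x y : E} (hB : B ⊆ D) (hx : x ∈ B) (hy : y ∈ D \ B) :
    x ∈ D \ insert y (B.erase x) := by
  simp [hB hx, ne_of_mem_sdiff hx hy]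

namespace Triple

variable (h : Triple L D U₃ U U') (hA : Frames D U₃ U U' B A₃ A A')
include h hA

theorem support_iff (hb : b ∈ B) (hc : c ∈ D \ B) : A b c = 0 ↔ A' b c = 0 :=
  h.same'.support_iff hA.two hA.lift hb hc

theorem pivot (hx : x ∈ B) (hy : y ∈ D \ B) (hxy : A x y ≠ 0) :
    Frames D U₃ U U' (insert y (B.erase x)) (Paper.pivot A₃ x y) (Paper.pivot A x y)
      (Paper.pivot A' x y) :=
  hA.pivot h.same hx hy hxy (mt (h.support_iff hA hx hy).2 hxy)

theorem lifts_of_eq_zero (ha : a ∈ B) (hb : b ∈ B) (hc : c ∈ D \ B) (hd : d ∈ D \ B)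
    (hl : A a c ≠ 0 → A a d ≠ 0 → A b c ≠ 0 → A b d ≠ 0 → Lifts L A A' a b c d) :
    Lifts L A A' a b c d :=
  Paper.lifts_of_eq_zero h.lift (h.support_iff hA ha hc) (h.support_iff hA ha hd)
    (h.support_iff hA hb hc) (h.support_iff hA hb hd) hl

theorem lifts_row (he : e ∈ B) (hb : b ∈ B) (hc : c ∈ D \ B) (hd : d ∈ D \ B) (hec : A e c ≠ 0)
    (hl : AllLift L D U U' (insert c (B.erase e))) : Lifts L A A' e b c d := by
  refine h.lifts_of_eq_zero hA he hb hc hd fun _ hed hbc hbd => ?_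
  by_cases hbe : b = e
  · subst hbe
    exact lifts_self_rows h.lift (h.support_iff hA he hc) (h.support_iff hA he hd)
  by_cases hcd : d = c
  · subst hcd
    exact lifts_self_cols h.lift (h.support_iff hA he hc) (h.support_iff hA hb hc)
  have hp := h.pivot hA he hc hec
  rw [← lifts_pivot_iff h.lift hec hed hbc (mt (h.support_iff hA he hc).2 hec)
    (mt (h.support_iff hA he hd).2 hed) (mt (h.support_iff hA hb hc).2 hbc)
    (ne_of_mem_sdiff hb hc) (ne_of_mem_sdiff he hd).symm]
  exact hl _ _ hp.two hp.lift c (by simp) b (mem_exchange hb hbe) e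
    (mem_sdiff_exchange_self hA.two.1 he hc) d (mem_sdiff_exchange hd hcd)

theorem lifts_of_row_ne_zero (he : e ∈ B) (ha : a ∈ B) (hb : b ∈ B) (hc : c ∈ D \ B)
    (hd : d ∈ D \ B) (hec : A e c ≠ 0) (hed : A e d ≠ 0)
    (hl : AllLift L D U U' (insert c (B.erase e))) : Lifts L A A' a b c d :=
  Lifts.mul_rows h.lift h.same hA.three hA.two ha he hb hc hd hec hed
    (mt (h.support_iff hA he hc).2 hec) (mt (h.support_iff hA he hd).2 hed)
    ((h.lifts_row hA he ha hc hd hec hl).swap_rows h.lift) (h.lifts_row hA he hb hc hd hec hl)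

theorem lifts_of_row_eq_zero_left (he : e ∈ B) (ha : a ∈ B) (hb : b ∈ B) (hc : c ∈ D \ B)
    (hd : d ∈ D \ B) (hae : a ≠ e) (hbe : b ≠ e) (hec : A e c = 0) (hed : A e d ≠ 0)
    (hl : AllLift L D U U' (insert d (B.erase e))) : Lifts L A A' a b c d := by
  have hp := h.pivot hA he hd hed
  have hcd : c ≠ d := fun h => hed (h ▸ hec)
  have := hl _ _ hp.two hp.lift a (mem_exchange ha hae) b (mem_exchange hb hbe) c
    (mem_sdiff_exchange hc hcd) e (mem_sdiff_exchange_self hA.two.1 he hd)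
  unfold Lifts at this ⊢
  rwa [crossRatio_pivot_col hed hec (ne_of_mem_sdiff ha hd) (ne_of_mem_sdiff hb hd)
    (ne_of_mem_sdiff he hc).symm, crossRatio_pivot_col (mt (h.support_iff hA he hd).2 hed)
    ((h.support_iff hA he hc).1 hec) (ne_of_mem_sdiff ha hd) (ne_of_mem_sdiff hb hd)
    (ne_of_mem_sdiff he hc).symm] at this

theorem lifts_of_row_eq_zero (he : e ∈ B) (ha : a ∈ B) (hb : b ∈ B) (hc : c ∈ D \ B)
    (hd : d ∈ D \ B) (hg : g ∈ D \ B) (hae : a ≠ e) (hbe : b ≠ e) (hec : A e c = 0)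
    (hed : A e d = 0) (heg : A e g ≠ 0) (hl : AllLift L D U U' (insert g (B.erase e))) :
    Lifts L A A' a b c d := by
  have hp := h.pivot hA he hg heg
  have hcg : c ≠ g := fun h => heg (h ▸ hec)
  have hdg : d ≠ g := fun h => heg (h ▸ hed)
  have := hl _ _ hp.two hp.lift a (mem_exchange ha hae) b (mem_exchange hb hbe) c
    (mem_sdiff_exchange hc hcg) d (mem_sdiff_exchange hd hdg)
  unfold Lifts at this ⊢
  rwa [crossRatio_pivot_of_row_eq_zero hec hed (ne_of_mem_sdiff ha hg) (ne_of_mem_sdiff hb hg)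
    (ne_of_mem_sdiff he hc).symm (ne_of_mem_sdiff he hd).symm,
    crossRatio_pivot_of_row_eq_zero ((h.support_iff hA he hc).1 hec)
    ((h.support_iff hA he hd).1 hed) (ne_of_mem_sdiff ha hg) (ne_of_mem_sdiff hb hg)
    (ne_of_mem_sdiff he hc).symm (ne_of_mem_sdiff he hd).symm] at this

end Triple

theorem lift_of_exchange (hL : IsLift L) {p₃ r₃ s₃ : ZMod 3} {p r s : F} {p' r' s' : K}
    (hp0 : p ≠ 0) (hp : Compat p₃ p) (hr : Compat r₃ r) (hs : s₃ = 0 ↔ s = 0)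
    (hsp : Compat (s₃ / p₃) (s / p)) (hsr : Compat (s₃ / r₃) (s / r))
    (hrps : Compat (r₃ * p₃ / s₃) (r * p / s))
    (h6 : Compat ((p₃ - s₃) / (1 - r₃)) ((p - s) / (1 - r)))
    (hs' : s = 0 ↔ s' = 0) (hp' : p = 0 ↔ p' = 0) (hrps' : Compat (r * p / s) (r' * p' / s'))
    (kr : r' = L r) (ksp : s' / p' = L (s / p)) (ksr : s' / r' = L (s / r))
    (k6 : (p' - s') / (1 - r') = L ((p - s) / (1 - r)))
    (k7 : (r' - s') / (1 - p') = L ((r - s) / (1 - p))) (hp1 : p = 1 ↔ p' = 1) : p' = L p := by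
  have hp0' : p' ≠ 0 := mt hp'.2 hp0
  rcases zmod_three p₃ with rfl | rfl | rfl
  · exact absurd (hp.1.1 rfl) hp0
  · have := hp.2.1 rfl
    rw [hp1.1 this, this, hL.one]
  have hne : p ≠ 1 := fun h => by have := hp.2.2 h; revert this; decide
  have hne' : p' ≠ 1 := mt hp1.2 hne
  have r0 : r₃ = 0 → r = 0 ∧ r' = 0 := fun h => by
    have := hr.1.1 h
    exact ⟨this, by rw [kr, this, hL.zero]⟩
  have r1 : r₃ = 1 → r = 1 ∧ r' = 1 := fun h => by
    have := hr.2.1 h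
    exact ⟨this, by rw [kr, this, hL.one]⟩
  have s0 : s₃ = 0 → s = 0 ∧ s' = 0 := fun h => ⟨hs.1 h, hs'.1 (hs.1 h)⟩
  have sp : s₃ / -1 = 1 → s = p ∧ s' = p' := fun h => by
    have := hsp.2.1 h
    rw [this, hL.one] at ksp
    exact ⟨(div_eq_one_iff_eq hp0).1 this, (div_eq_one_iff_eq hp0').1 ksp⟩
  have sr : r₃ ≠ 0 → s₃ / r₃ = 1 → s = r ∧ s' = r' := fun h0 h => by
    have h1 := mt hr.1.2 h0
    have := hsr.2.1 h
    rw [this, hL.one] at ksr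
    exact ⟨(div_eq_one_iff_eq h1).1 this, (div_eq_one_iff_eq (kr ▸ hL.ne_zero h1)).1 ksr⟩
  have neg_div : (-1 : ZMod 3) / -1 = 1 := div_self (by decide)
  rcases zmod_three r₃ with rfl | rfl | rfl <;> rcases zmod_three s₃ with rfl | rfl | rfl
  · simpa [r0 rfl, s0 rfl] using k6
  · have h1 := h6.2.1 (by rw [sub_zero, div_one]; decide)
    rw [h1, hL.one] at k6
    simp only [r0 rfl, sub_zero, div_one] at h1 k6
    have e1 : s = p - 1 := by linear_combination -h1
    have e2 : s' = p' - 1 := by linear_combination -k6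
    rw [e1, e2, sub_div, sub_div, div_self hp0, div_self hp0', hL.one_sub, one_div, one_div,
      hL.inv] at ksp
    have : p'⁻¹ = (L p)⁻¹ := by linear_combination -ksp
    exact inv_injective this
  · obtain ⟨rfl, rfl⟩ := sp neg_div
    simp only [r0 rfl] at k7
    have e : (0 - s) / (1 - s) = (1 - s⁻¹)⁻¹ := by
      have : s - 1 ≠ 0 := sub_ne_zero.2 hne
      have : 1 - s ≠ 0 := sub_ne_zero.2 hne.symm
      field_simp
      ring
    have e' : (0 - s') / (1 - s') = (1 - s'⁻¹)⁻¹ := by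
      have : s' - 1 ≠ 0 := sub_ne_zero.2 hne'
      have : 1 - s' ≠ 0 := sub_ne_zero.2 hne'.symm
      field_simp
      ring
    rw [e, e', hL.inv, hL.one_sub, hL.inv] at k7
    have := inv_injective k7
    exact inv_injective (by linear_combination -this)
  · simp only [r1 rfl, s0 rfl, sub_zero] at k7
    rw [one_div, one_div, hL.inv, hL.one_sub] at k7
    have := inv_injective k7
    linear_combination -this
  · obtain ⟨hs1, hs1'⟩ := sr (by decide) (by simp)
    rw [hs1, hs1', (r1 rfl).1, (r1 rfl).2, one_div, one_div, hL.inv] at ksp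
    exact inv_injective ksp
  · obtain ⟨rfl, rfl⟩ := sp neg_div
    simpa [r1 rfl] using ksr
  · have h1 := h6.2.1 (by rw [sub_zero, show (1 - -1 : ZMod 3) = -1 by decide, neg_div])
    rw [h1, hL.one] at k6
    simp only [s0 rfl, sub_zero] at h1 k6
    have e1 := eq_of_div_eq_one h1
    have e2 := eq_of_div_eq_one k6
    rw [e2, kr, ← hL.one_sub, e1]
  · have h1 := hrps.2.1 (by rw [div_one]; decide)
    have h2 := eq_of_div_eq_one h1
    have h3 := eq_of_div_eq_one (hrps'.2.1 h1)
    have hr0 : r ≠ 0 := fun h => by have := hr.1.2 h; revert this; decide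
    rw [← h2, ← h3, mul_div_cancel_left₀ _ hr0,
      mul_div_cancel_left₀ _ (kr ▸ hL.ne_zero hr0)] at ksr
    exact ksr
  · obtain ⟨h1, h1'⟩ := sp neg_div
    obtain ⟨h2, h2'⟩ := sr (by decide) neg_div
    rw [← h1, ← h1', h2, h2', kr]

end Closure

section Closure

variable {E : Type*} [DecidableEq E] {F K : Type*} [Field F] [Field K]

variable {D B B₀ B' : Finset E} {U₃ : Set (E → ZMod 3)} {U : Set (E → F)} {U' : Set (E → K)}
  {A₃ : E → E → ZMod 3} {A : E → E → F} {A' : E → E → K} {L : F → K}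
  {a b c d e f g x y z : E}

theorem HasFrame.of_off (hL : ∀ B, e ∉ B → (HasFrame D U B ↔ HasFrame D U' B))
    (hR : ∀ B, f ∉ B → (HasFrame D U B ↔ HasFrame D U' B))
    (hone : ∀ B A A', e ∉ B → f ∉ B → IsFrame D U B A → IsFrame D U' B A' →
      ∀ a ∈ B, ∀ b ∈ B, crossRatio A' a b e f = 1 → crossRatio A a b e f = 1)
    (h₀ : HasFrame D U B₀) (he : e ∉ B₀) (hf : f ∉ B₀) (hef : e ≠ f) (heD : e ∈ D) (hfD : f ∈ D)
    (hB : HasFrame D U B) : HasFrame D U' B := by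
  by_cases heB : e ∉ B
  · exact (hL B heB).1 hB
  by_cases hfB : f ∉ B
  · exact (hR B hfB).1 hB
  rw [not_not] at heB hfB
  obtain ⟨A, hA⟩ := hB
  obtain ⟨g, hg, heg⟩ := hA.exists_exchange_symm h₀ (Finset.mem_sdiff.2 ⟨heB, he⟩)
  have hg' := Finset.mem_sdiff.1 hg
  have hgD : g ∈ D \ B := Finset.mem_sdiff.2 ⟨h₀.subset hg'.1, hg'.2⟩
  have hge : g ≠ e := fun h => he (h ▸ hg'.1)
  have hgf : g ≠ f := fun h => hf (h ▸ hg'.1)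
  have h1 := hA.pivot heB hgD heg
  set B1 := insert g (B.erase e) with hB1
  have hf1 : f ∈ B1 := mem_exchange hfB hef.symm
  obtain ⟨k, hk, hfk⟩ := h1.exists_exchange_symm h₀ (Finset.mem_sdiff.2 ⟨hf1, hf⟩)
  have hk' := Finset.mem_sdiff.1 hk
  have hkD : k ∈ D \ B1 := Finset.mem_sdiff.2 ⟨h₀.subset hk'.1, hk'.2⟩
  have hke : k ≠ e := fun h => he (h ▸ hk'.1)
  have hkf : k ≠ f := fun h => hf (h ▸ hk'.1)
  have h2 := h1.pivot hf1 hkD hfk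
  set B2 := insert k (B1.erase f) with hB2
  set A2 := pivot (pivot A e g) f k with hA2
  have he2 : e ∉ B2 := by simp [hB2, hB1, hke.symm, hge.symm]
  have hf2 : f ∉ B2 := by simp [hB2, hkf.symm]
  have hk2 : k ∈ B2 := by simp [hB2]
  have hg2 : g ∈ B2 := by simp [hB2, hB1, hgf]
  have heD2 : e ∈ D \ B2 := by simp [heD, he2]
  have hfD2 : f ∈ D \ B2 := by simp [hfD, hf2]
  obtain ⟨A2', h2'⟩ := (hL B2 he2).1 h2.hasFrame
  have S : ∀ {i j}, i ∈ B2 → j ∈ D \ B2 → (A2 i j = 0 ↔ A2' i j = 0) := fun {i j} hi hj => by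
    by_cases hje : j = e
    · subst hje
      exact h2.support_iff h2' hi hj (hR _ (by simp [hef.symm, hf2]))
    · exact h2.support_iff h2' hi hj (hL _ (by simp [Ne.symm hje, he2]))
  have hkf2 : A2 k f ≠ 0 := by
    rw [hA2, pivot_self]
    exact inv_ne_zero hfk
  have hkf2' := mt (S hk2 hfD2).2 hkf2
  have hb1 : insert f (B2.erase k) = B1 := by
    rw [hB2, Finset.erase_insert (by simp [hk'.2]), Finset.insert_erase hf1]
  have hb : insert e (B1.erase g) = B := by
    rw [hB1, Finset.erase_insert (by simp [hg'.2]), Finset.insert_erase heB]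
  have p := h2.pivot hk2 hfD2 hkf2
  have p' := h2'.pivot hk2 hfD2 hkf2'
  rw [hb1] at p p'
  have hg1 : g ∈ B1 := by simp [hB1]
  have he1 : e ∈ D \ B1 := mem_sdiff_exchange_self hA.1 heB hgD
  have key := (p.hasFrame_exchange_iff hg1 he1).1 (by rw [hb]; exact hA.hasFrame)
  rw [← hb, p'.hasFrame_exchange_iff hg1 he1]
  rw [pivot_of_ne _ hgf hke.symm] at key ⊢
  intro h0
  apply key
  by_cases q1 : A2 g f = 0
  · rw [(S hg2 hfD2).1 q1] at h0
    rw [q1]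
    simp only [zero_mul, zero_div, sub_zero] at h0 ⊢
    exact (S hg2 heD2).2 h0
  by_cases q2 : A2 k e = 0
  · rw [(S hk2 heD2).1 q2] at h0
    rw [q2]
    simp only [mul_zero, zero_div, sub_zero] at h0 ⊢
    exact (S hg2 heD2).2 h0
  have q1' := mt (S hg2 hfD2).2 q1
  have q2' := mt (S hk2 heD2).2 q2
  have := hone B2 A2 A2' he2 hf2 h2 h2' g hg2 k hk2
  rw [crossRatio, crossRatio, div_eq_one_iff_eq (mul_ne_zero q1 q2),
    div_eq_one_iff_eq (mul_ne_zero q1' q2')] at this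
  rw [sub_eq_zero, eq_div_iff hkf2'] at h0
  rw [sub_eq_zero, eq_div_iff hkf2]
  exact this h0

/-- The product of ratios relating three rows `a`, `b`, `e` and three columns `d`, `f`, `g`. -/
def hexRatio (A : E → E → F) (a b d e f g : E) : F :=
  A b g * A a d * A e f / (A b d * A a f * A e g)

section HexRatio

variable (haf : A a f ≠ 0) (had : A a d ≠ 0) (hbf : A b f ≠ 0) (hbd : A b d ≠ 0)
  (hed : A e d = 0) (hef : A e f ≠ 0) (heg : A e g ≠ 0)
include haf had hbd heg

theorem hexRatio_div_left (hbf : A b f ≠ 0) :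
    hexRatio A a b d e f g / crossRatio A a b d f = crossRatio A b e g f := by
  unfold crossRatio hexRatio
  field_simp

include hef

theorem hexRatio_div_right :
    hexRatio A a b d e f g / crossRatio A a e g f = crossRatio A b a g d := by
  unfold crossRatio hexRatio
  by_cases h0 : A a g = 0
  · simp [h0]
  field_simp

include hbf

theorem mul_div_hexRatio :
    crossRatio A a e g f * crossRatio A a b d f / hexRatio A a b d e f g =
      crossRatio A a b g f := by
  unfold crossRatio hexRatio
  by_cases h0 : A b g = 0
  · simp [h0]
  field_simp

include hed

theorem crossRatio_pivot_hex_left (ha : a ≠ g) (hb : b ≠ g) (hf : f ≠ e) (hd : d ≠ e) :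
    crossRatio (pivot A e g) b a f d =
      (crossRatio A a b d f - hexRatio A a b d e f g) / (1 - crossRatio A a e g f) := by
  unfold crossRatio hexRatio
  rw [pivot_of_ne _ ha hf, pivot_of_ne _ ha hd, pivot_of_ne _ hb hf, pivot_of_ne _ hb hd, hed]
  simp only [mul_zero, zero_div, sub_zero]
  have e1 : A a f - A a g * A e f / A e g = A a f * (1 - A a g * A e f / (A a f * A e g)) := by
    field_simp
  rw [e1]
  by_cases h1 : 1 - A a g * A e f / (A a f * A e g) = 0
  · simp [h1]
  rw [div_eq_div_iff (by simp [*]) h1]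
  field_simp

theorem crossRatio_pivot_hex_right (ha : a ≠ d) (he : e ≠ d) (hf : f ≠ b) (hg : g ≠ b) :
    crossRatio (pivot A b d) a e g f =
      (crossRatio A a e g f - hexRatio A a b d e f g) / (1 - crossRatio A a b d f) := by
  unfold crossRatio hexRatio
  rw [pivot_of_ne _ ha hf, pivot_of_ne _ ha hg, pivot_of_ne _ he hf, pivot_of_ne _ he hg, hed]
  simp only [zero_mul, zero_div, sub_zero]
  have e1 : A a f - A a d * A b f / A b d = A a f * (1 - A a d * A b f / (A a f * A b d)) := by
    field_simp
  rw [e1]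
  by_cases h1 : 1 - A a d * A b f / (A a f * A b d) = 0
  · simp [h1]
  rw [div_eq_div_iff (by simp [*]) h1]
  field_simp

end HexRatio

/-- The configuration `U'` is good except possibly for the relation between `e` and `f`. -/
structure Nearly (L : F → K) (D : Finset E) (U₃ : Set (E → ZMod 3)) (U : Set (E → F))
    (U' : Set (E → K)) (e f : E) : Prop extends Pair L D U₃ U U' e f where
  exists_off : ∃ B₀, e ∉ B₀ ∧ f ∉ B₀ ∧ HasFrame D U B₀
  off : ∀ B A A', e ∉ B → f ∉ B → IsFrame D U B A → IsFrame D U' B A' →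
      ∀ a ∈ B, ∀ b ∈ B, Lifts L A A' a b e f

namespace Nearly

theorem symm (h : Nearly L D U₃ U U' e f) : Nearly L D U₃ U U' f e :=
  ⟨h.toPair.symm, h.exists_off.imp fun _ hB => ⟨hB.2.1, hB.1, hB.2.2⟩,
    fun B A A' hf he hA hA' a ha b hb => (h.off B A A' he hf hA hA' a ha b hb).swap_cols h.lift⟩

theorem sameFrames (h : Nearly L D U₃ U U' e f) : SameFrames D U U' := by
  obtain ⟨B₀, he, hf, h₀⟩ := h.exists_off
  refine ⟨⟨B₀, h₀⟩, fun B => ⟨?_, ?_⟩⟩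
  · refine HasFrame.of_off h.left.iff h.right.iff (fun B A A' he hf hA hA' a ha b hb h1 => ?_) h₀
      he hf h.ne h.mem_left h.mem_right
    have := h.off B A A' he hf hA hA' a ha b hb
    rw [Lifts, h1] at this
    exact h.lift.eq_one this.symm
  · refine HasFrame.of_off (fun B hB => (h.left.iff B hB).symm)
      (fun B hB => (h.right.iff B hB).symm)
      (fun B A' A he hf hA' hA a ha b hb h1 => ?_) ((h.left.iff B₀ he).1 h₀)
      he hf h.ne h.mem_left h.mem_right
    have := h.off B A A' he hf hA hA' a ha b hb
    rw [Lifts, h1, h.lift.one] at this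
    exact this

theorem triple (h : Nearly L D U₃ U U' e f) : Triple L D U₃ U U' := ⟨h.lift, h.same, h.sameFrames⟩

theorem frames (h : Nearly L D U₃ U U' e f) (hA : IsFrame D U B A) (hA' : IsFrame D U' B A') :
    ∃ A₃, Frames D U₃ U U' B A₃ A A' := by
  obtain ⟨A₃, h3⟩ := (h.same.iff B).2 hA.hasFrame
  exact ⟨A₃, h3, hA, hA'⟩

theorem allLift_off (h : Nearly L D U₃ U U' e f) (he : e ∉ B) (hf : f ∉ B) :
    AllLift L D U U' B := by
  intro A A' hA hA' a ha b hb c hc d hd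
  have S := fun {r c} (hr : r ∈ B) (hc : c ∈ D \ B) => h.sameFrames.support_iff hA hA' hr hc
  by_cases hcd : c = d
  · subst hcd
    exact lifts_self_cols h.lift (S ha hc) (S hb hc)
  by_cases hce : c = e
  · subst hce
    by_cases hdf : d = f
    · subst hdf
      exact h.off B A A' he hf hA hA' a ha b hb
    · exact h.right.lifts B A A' hf hA hA' a ha b hb c hc d hd h.ne hdf
  by_cases hde : d = e
  · subst hde
    by_cases hcf : c = f
    · subst hcf
      exact (h.off B A A' he hf hA hA' a ha b hb).swap_cols h.lift
    · exact h.right.lifts B A A' hf hA hA' a ha b hb c hc d hd hcf h.ne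
  exact h.left.lifts B A A' he hA hA' a ha b hb c hc d hd hce hde

theorem lifts_of_exchange (h : Nearly L D U₃ U U' e f) (hA : Frames D U₃ U U' B A₃ A A')
    (he : e ∈ B) (hf : f ∈ D \ B) (ha : a ∈ B) (hb : b ∈ B) (hd : d ∈ D \ B) (hg : g ∈ D \ B)
    (hab : a ≠ b) (hae : a ≠ e) (hbe : b ≠ e) (hdf : d ≠ f) (hgf : g ≠ f)
    (haf : A a f ≠ 0) (had : A a d ≠ 0) (hbf : A b f ≠ 0) (hbd : A b d ≠ 0) (hed : A e d = 0)
    (hef : A e f ≠ 0) (heg : A e g ≠ 0) : Lifts L A A' a b d f := by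
  have T := h.triple
  have S := fun {r c} (hr : r ∈ B) (hc : c ∈ D \ B) => T.support_iff hA hr hc
  have S3 := fun {r c} (hr : r ∈ B) (hc : c ∈ D \ B) => h.same.support_iff hA.three hA.two hr hc
  have hgd : g ≠ d := fun h => heg (h ▸ hed)
  have haf' := mt (S ha hf).2 haf
  have had' := mt (S ha hd).2 had
  have hbf' := mt (S hb hf).2 hbf
  have hbd' := mt (S hb hd).2 hbd
  have hed' := (S he hd).1 hed
  have hef' := mt (S he hf).2 hef
  have heg' := mt (S he hg).2 heg
  have haf3 := mt (S3 ha hf).1 haf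
  have had3 := mt (S3 ha hd).1 had
  have hbf3 := mt (S3 hb hf).1 hbf
  have hbd3 := mt (S3 hb hd).1 hbd
  have hed3 := (S3 he hd).2 hed
  have hef3 := mt (S3 he hf).1 hef
  have heg3 := mt (S3 he hg).1 heg
  have fB := (Finset.mem_sdiff.1 hf).2
  have heg_ne := ne_of_mem_sdiff he hg
  have l0 : AllLift L D U U' (insert g (B.erase e)) :=
    h.allLift_off (by simp [heg_ne]) (by simp [hgf.symm, fB])
  have hP := T.pivot hA he hg heg
  have ma := mem_exchange ha hae (y := g)
  have mb := mem_exchange hb hbe (y := g)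
  have mf := mem_sdiff_exchange hf hgf.symm (x := e)
  have md := mem_sdiff_exchange hd hgd.symm (x := e)
  have hQ := T.pivot hA hb hd hbd
  have na : a ≠ d := ne_of_mem_sdiff ha hd
  have ned := ne_of_mem_sdiff he hd
  have nag := ne_of_mem_sdiff ha hg
  have nbg := ne_of_mem_sdiff hb hg
  have nfe := (ne_of_mem_sdiff he hf).symm
  have nde := ned.symm
  have nfb := (ne_of_mem_sdiff hb hf).symm
  have ngb := nbg.symm
  have l1 : AllLift L D U U' (insert g ((insert d (B.erase b)).erase e)) :=
    h.allLift_off (by simp [heg_ne]) (by simp [hgf.symm, hdf.symm, fB])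
  have row : pivot A b d e g ≠ 0 := by
    rw [pivot_of_ne _ (ne_of_mem_sdiff he hd) (ne_of_mem_sdiff hb hg).symm, hed]
    simpa using heg
  have C3 := fun {i j k l} (hi : i ∈ B) (hj : j ∈ B) (hk : k ∈ D \ B) (hl : l ∈ D \ B) =>
    h.same.compat hA.three hA.two hi hj hk hl
  have C := fun {i j k l} (hi : i ∈ B) (hj : j ∈ B) (hk : k ∈ D \ B) (hl : l ∈ D \ B) =>
    h.sameFrames.compat hA.two hA.lift hi hj hk hl
  refine lift_of_exchange h.lift (p₃ := crossRatio A₃ a b d f) (r₃ := crossRatio A₃ a e g f)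
    (s₃ := hexRatio A₃ a b d e f g)
    (r := crossRatio A a e g f) (s := hexRatio A a b d e f g)
    (r' := crossRatio A' a e g f) (s' := hexRatio A' a b d e f g)
    (by simp [crossRatio, *]) (C3 ha hb hd hf)
    (C3 ha he hg hf) ?_ ?_ ?_ ?_ ?_ ?_ ?_ ?_ ?_ ?_ ?_ ?_ ?_
    (C ha hb hd hf).2
  · simp [hexRatio, S3 hb hg, *]
  · rw [hexRatio_div_left haf had hbd heg hbf, hexRatio_div_left haf3 had3 hbd3 heg3 hbf3]
    exact C3 hb he hg hf
  · rw [hexRatio_div_right haf had hbd hef heg, hexRatio_div_right haf3 had3 hbd3 hef3 heg3]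
    exact C3 hb ha hg hd
  · rw [mul_div_hexRatio haf had hbf hbd hef heg, mul_div_hexRatio haf3 had3 hbf3 hbd3 hef3 heg3]
    exact C3 ha hb hg hf
  · rw [← crossRatio_pivot_hex_left haf had hbf hbd hed hef heg nag nbg nfe nde,
      ← crossRatio_pivot_hex_left haf3 had3 hbf3 hbd3 hed3 hef3 heg3 nag nbg nfe nde]
    exact h.same.compat hP.three hP.two mb ma mf md
  · simp [hexRatio, S hb hg, *]
  · exact (C ha hb hd hf).1
  · rw [mul_div_hexRatio haf had hbf hbd hef heg, mul_div_hexRatio haf' had' hbf' hbd' hef' heg']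
    exact C ha hb hg hf
  · exact (T.lifts_row hA he ha hg hf heg l0).swap_rows h.lift
  · rw [hexRatio_div_left haf had hbd heg hbf, hexRatio_div_left haf' had' hbd' heg' hbf']
    exact (T.lifts_row hA he hb hg hf heg l0).swap_rows h.lift
  · rw [hexRatio_div_right haf had hbd hef heg, hexRatio_div_right haf' had' hbd' hef' heg']
    exact h.right.lifts B A A' fB hA.two hA.lift b hb a ha g hg d hd hgf hdf
  · rw [← crossRatio_pivot_hex_left haf had hbf hbd hed hef heg nag nbg nfe nde,
      ← crossRatio_pivot_hex_left haf' had' hbf' hbd' hed' hef' heg' nag nbg nfe nde]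
    exact l0 _ _ hP.two hP.lift b mb a ma f mf d md
  · rw [← crossRatio_pivot_hex_right haf had hbf hbd hed hef heg na ned nfb ngb,
      ← crossRatio_pivot_hex_right haf' had' hbf' hbd' hed' hef' heg' na ned nfb ngb]
    exact (T.lifts_row hQ (mem_exchange he hbe.symm) (mem_exchange ha hab)
      (mem_sdiff_exchange hg hgd) (mem_sdiff_exchange hf hdf.symm) row l1).swap_rows h.lift

theorem allLift_left (h : Nearly L D U₃ U U' e f) (he : e ∈ B) (hf : f ∉ B) :
    AllLift L D U U' B := by
  intro A A' hA hA' a ha b hb c hc d hd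
  obtain ⟨A₃, hF⟩ := h.frames hA hA'
  have T := h.triple
  have off : ∀ {d}, d ∈ D \ B → d ≠ f → AllLift L D U U' (insert d (B.erase e)) := fun hd hdf =>
    h.allLift_off (by simp [ne_of_mem_sdiff he hd]) (by simp [hdf.symm, hf])
  have key : ∀ d ∈ D \ B, f ∈ D \ B → d ≠ f → Lifts L A A' a b d f := by
    intro d hd hfD hdf
    refine T.lifts_of_eq_zero hF ha hb hd hfD fun had haf hbd hbf => ?_
    have hl := off hd hdf
    by_cases hae : a = e
    · subst hae
      exact T.lifts_row hF ha hb hd hfD had hl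
    by_cases hbe : b = e
    · subst hbe
      exact (T.lifts_row hF hb ha hd hfD hbd hl).swap_rows h.lift
    by_cases hab : a = b
    · subst hab
      exact lifts_self_rows h.lift (T.support_iff hF ha hd) (T.support_iff hF ha hfD)
    obtain ⟨B₀, he₀, hf₀, h₀⟩ := h.exists_off
    obtain ⟨g, hg, heg⟩ := hA.exists_exchange_symm h₀ (Finset.mem_sdiff.2 ⟨he, he₀⟩)
    rw [Finset.mem_sdiff] at hg
    have hgD : g ∈ D \ B := Finset.mem_sdiff.2 ⟨h₀.subset hg.1, hg.2⟩
    have hgf : g ≠ f := fun h => hf₀ (h ▸ hg.1)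
    by_cases hed : A e d = 0
    · by_cases hef : A e f = 0
      · exact T.lifts_of_row_eq_zero hF he ha hb hd hfD hgD hae hbe hed hef heg (off hgD hgf)
      · exact h.lifts_of_exchange hF he hfD ha hb hd hgD hab hae hbe hdf hgf haf had hbf hbd hed
          hef heg
    · by_cases hef : A e f = 0
      · exact (T.lifts_of_row_eq_zero_left hF he ha hb hfD hd hae hbe hef hed hl).swap_cols h.lift
      · exact T.lifts_of_row_ne_zero hF he ha hb hd hfD hed hef hl
  by_cases hcf : c = f
  · by_cases hdf : d = f
    · subst hcf hdf
      exact lifts_self_cols h.lift (T.support_iff hF ha hc) (T.support_iff hF hb hc)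
    · subst hcf
      exact (key d hd hc hdf).swap_cols h.lift
  · by_cases hdf : d = f
    · subst hdf
      exact key c hc hd hcf
    · exact h.right.lifts B A A' hf hA hA' a ha b hb c hc d hd hcf hdf

theorem allLift_both (h : Nearly L D U₃ U U' e f) (he : e ∈ B) (hf : f ∈ B) :
    AllLift L D U U' B := by
  intro A A' hA hA' a ha b hb c hc d hd
  obtain ⟨A₃, hF⟩ := h.frames hA hA'
  have T := h.triple
  have le : ∀ {d}, d ∈ D \ B → AllLift L D U U' (insert d (B.erase e)) := fun hd =>
    h.symm.allLift_left (mem_exchange hf h.ne.symm) (by simp [ne_of_mem_sdiff he hd])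
  have lf : ∀ {d}, d ∈ D \ B → AllLift L D U U' (insert d (B.erase f)) := fun hd =>
    h.allLift_left (mem_exchange he h.ne) (by simp [ne_of_mem_sdiff hf hd])
  refine T.lifts_of_eq_zero hF ha hb hc hd fun hac had hbc hbd => ?_
  by_cases hae : a = e
  · subst hae
    exact T.lifts_row hF ha hb hc hd hac (le hc)
  by_cases hbe : b = e
  · subst hbe
    exact (T.lifts_row hF hb ha hc hd hbc (le hc)).swap_rows h.lift
  by_cases hec : A e c = 0
  · by_cases hed : A e d = 0
    · obtain ⟨B₀, he₀, hf₀, h₀⟩ := h.exists_off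
      obtain ⟨g, hg, heg⟩ := hA.exists_exchange_symm h₀ (Finset.mem_sdiff.2 ⟨he, he₀⟩)
      rw [Finset.mem_sdiff] at hg
      have hgD : g ∈ D \ B := Finset.mem_sdiff.2 ⟨h₀.subset hg.1, hg.2⟩
      exact T.lifts_of_row_eq_zero hF he ha hb hc hd hgD hae hbe hec hed heg (le hgD)
    · exact T.lifts_of_row_eq_zero_left hF he ha hb hc hd hae hbe hec hed (le hd)
  · by_cases hed : A e d = 0
    · exact (T.lifts_of_row_eq_zero_left hF he ha hb hd hc hae hbe hed hec (le hc)).swap_cols h.lift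
    · exact T.lifts_of_row_ne_zero hF he ha hb hc hd hec hed (le hc)

theorem good (h : Nearly L D U₃ U U' e f) : Good L D U U' := by
  refine ⟨h.sameFrames, fun B => ?_⟩
  by_cases he : e ∈ B <;> by_cases hf : f ∈ B
  · exact h.allLift_both he hf
  · exact h.allLift_left he hf
  · exact h.symm.allLift_left hf he
  · exact h.allLift_off he hf

end Nearly

end Closure

open Relation

section Extension

variable {E : Type*} [DecidableEq E] {F K : Type*} [Field F] [Field K]

variable {D D' D'' B B₀ B' : Finset E} {U₃ : Set (E → ZMod 3)} {U : Set (E → F)} {U' : Set (E → K)}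
  {A₃ : E → E → ZMod 3} {A A₁ : E → E → F} {A' : E → E → K} {L : F → K}
  {a b c d e f g t x y z : E}

theorem MeetsOff.symm (h : MeetsOff D B A e f a b) : MeetsOff D B A e f b a :=
  ⟨h.1.symm, h.2.2.2.1, h.2.2.2.2, h.2.1, h.2.2.1⟩

theorem reflTransGen_meetsOff_symm (h : ReflTransGen (MeetsOff D B A e f) a b) :
    ReflTransGen (MeetsOff D B A e f) b a := by
  induction h with
  | refl => exact .refl
  | tail _ hm ih => exact .head hm.symm ih

theorem reflTransGen_pivot (he : e ∉ B) (hf : f ∉ B) (hB : B ⊆ D) (hx : x ∈ B) (hy : y ∈ D \ B)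
    (hye : y ≠ e) (hyf : y ≠ f) (hxy : A x y ≠ 0) (h : ReflTransGen (MeetsOff D B A e f) a b) :
    ReflTransGen (MeetsOff D (insert y (B.erase x)) (pivot A x y) e f) a b := by
  have hxe : x ≠ e := fun h => he (h ▸ hx)
  have hxf : x ≠ f := fun h => hf (h ▸ hx)
  have hyx := (ne_of_mem_sdiff hx hy).symm
  have mx := mem_sdiff_exchange_self hB hx hy
  have m0 : MeetsOff D (insert y (B.erase x)) (pivot A x y) e f y x :=
    ⟨Or.inl ⟨by simp, mx, by rw [pivot_self]; exact inv_ne_zero hxy⟩, hye, hyf, hxe, hxf⟩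
  have mc : ∀ {i}, i ∈ B → i ≠ x → A i y ≠ 0 →
      MeetsOff D (insert y (B.erase x)) (pivot A x y) e f i x := fun {i} hi hix hiy =>
    ⟨Or.inl ⟨mem_exchange hi hix, mx, by
      rw [pivot_col _ (ne_of_mem_sdiff hi hy)]; simp [hiy, hxy]⟩,
      fun h => he (h ▸ hi), fun h => hf (h ▸ hi), hxe, hxf⟩
  have mr : ∀ {j}, j ∈ D \ B → j ≠ y → j ≠ e → j ≠ f → A x j ≠ 0 →
      MeetsOff D (insert y (B.erase x)) (pivot A x y) e f y j := fun {j} hj hjy hje hjf hxj =>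
    ⟨Or.inl ⟨by simp, mem_sdiff_exchange hj hjy, by
      rw [pivot_row _ (ne_of_mem_sdiff hx hj).symm]; simp [hxj, hxy]⟩, hye, hyf, hje, hjf⟩
  have key : ∀ i ∈ B, ∀ j ∈ D \ B, j ≠ e → j ≠ f → A i j ≠ 0 →
      ReflTransGen (MeetsOff D (insert y (B.erase x)) (pivot A x y) e f) i j := by
    intro i hi j hj hje hjf hij
    by_cases hix : i = x
    · subst hix
      by_cases hjy : j = y
      · subst hjy
        exact .single m0.symm
      · exact .head m0.symm (.single (mr hj hjy hje hjf hij))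
    by_cases hjy : j = y
    · subst hjy
      exact .head (mc hi hix hij) (.single m0.symm)
    by_cases h0 : pivot A x y i j = 0
    · rw [pivot_of_ne _ (ne_of_mem_sdiff hi hy) (ne_of_mem_sdiff hx hj).symm] at h0
      have h1 : A i y ≠ 0 := fun h => hij (by simpa [h] using h0)
      have h2 : A x j ≠ 0 := fun h => hij (by simpa [h] using h0)
      exact .head (mc hi hix h1) (.head m0.symm (.single (mr hj hjy hje hjf h2)))
    · exact .single ⟨Or.inl ⟨mem_exchange hi hix, mem_sdiff_exchange hj hjy, h0⟩,
        fun h => he (h ▸ hi), fun h => hf (h ▸ hi), hje, hjf⟩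
  induction h with
  | refl => exact .refl
  | tail _ hm ih =>
    refine ih.trans ?_
    obtain ⟨⟨hu, hv, huv⟩ | ⟨hu, hv, huv⟩, h1, h2, h3, h4⟩ := hm
    · exact key _ hu _ hv h3 h4 huv
    · exact reflTransGen_meetsOff_symm (key _ hu _ hv h1 h2 huv)

theorem Clustered.congr (h : Clustered D B A e f) (he : e ∈ D \ B)
    (hA : ∀ b ∈ B, ∀ c ∈ D \ B, A b c = 0 ↔ A' b c = 0) : Clustered D B A' e f := by
  obtain ⟨z, hz⟩ := h
  refine ⟨z, fun i hi hie =>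
    Relation.ReflTransGen.mono (fun u v (h : MeetsOff D B A e f u v) => ⟨?_, h.2⟩) _ _
      (hz i hi (mt (hA i hi e he).1 hie))⟩
  refine h.1.imp (fun h => ?_) fun h => ?_
  all_goals exact ⟨h.1, h.2.1, mt (hA _ h.1 _ h.2.1).2 h.2.2⟩

theorem Clustered.pivot (h : Clustered D B A e f) (he : e ∈ D \ B) (hf : f ∉ B) (hB : B ⊆ D)
    (hx : x ∈ B) (hy : y ∈ D \ B) (hye : y ≠ e) (hyf : y ≠ f) (hxy : A x y ≠ 0) :
    Clustered D (insert y (B.erase x)) (pivot A x y) e f := by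
  have he' := (Finset.mem_sdiff.1 he).2
  have hyx := (ne_of_mem_sdiff hx hy).symm
  have hxe := ne_of_mem_sdiff hx he
  have hxf : x ≠ f := fun h => hf (h ▸ hx)
  obtain ⟨z, hz⟩ := h
  refine ⟨z, fun i hi hie => reflTransGen_pivot he' hf hB hx hy hye hyf hxy ?_⟩
  have m0 : MeetsOff D B A e f y x := ⟨Or.inr ⟨hx, hy, hxy⟩, hye, hyf, hxe, hxf⟩
  by_cases hiy : i = y
  · subst hiy
    rw [pivot_row _ hxe.symm] at hie
    exact .head m0 (hz x hx fun h => hie (by simp [h]))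
  have hi' : i ∈ B := by
    simp only [Finset.mem_insert, hiy, Finset.mem_erase, false_or] at hi
    exact hi.2
  by_cases h0 : A i e = 0
  · rw [pivot_of_ne _ hiy hxe.symm, h0] at hie
    have h1 : A i y ≠ 0 := fun h => hie (by simp [h])
    have h2 : A x e ≠ 0 := fun h => hie (by simp [h])
    exact .head ⟨Or.inl ⟨hi', hy, h1⟩, ne_of_mem_sdiff hi' he, fun h => hf (h ▸ hi'), hye, hyf⟩
      (.head m0 (hz x hx h2))
  · exact hz i hi' h0

theorem Clustered.of_frame (h : Clustered D B A e f) (hA : IsFrame D U B A) (he : e ∈ D \ B)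
    (hf : f ∉ B) (hA₁ : IsFrame D U B' A₁) (he' : e ∉ B') (hf' : f ∉ B') :
    Clustered D B' A₁ e f := by
  have heD := (Finset.mem_sdiff.1 he).1
  have := hA.induction hA₁.hasFrame
    (fun C => e ∉ C ∧ f ∉ C ∧ ∃ A, IsFrame D U C A ∧ Clustered D C A e f)
    ⟨(Finset.mem_sdiff.1 he).2, hf, A, hA, h⟩ ?_
  · obtain ⟨-, -, A₂, hA₂, h₂⟩ := this
    exact h₂.congr (by simp [heD, he']) fun b hb c hc => by rw [hA₂.unique hA₁ hb hc]
  · rintro C A x y hC ⟨heC, hfC, A₂, hA₂, h₂⟩ hx hy hxy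
    rw [Finset.mem_sdiff] at hx hy
    have hyD : y ∈ D \ C := by simp [hA₁.1 hy.1, hy.2]
    have hye : y ≠ e := fun h => he' (h ▸ hy.1)
    have hyf : y ≠ f := fun h => hf' (h ▸ hy.1)
    rw [hC.unique hA₂ hx.1 hyD] at hxy
    exact ⟨by simp [heC, hye.symm], by simp [hfC, hyf.symm], _, hA₂.pivot hx.1 hyD hxy,
      h₂.pivot (by simp [heD, heC]) hfC hA₂.1 hx.1 hyD hye hyf hxy⟩

theorem exists_link (hb : b ∈ B) (h : ReflTransGen (MeetsOff D B A e f) a b) :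
    (a ∈ B → ∃ n, Link D B A e f n a b) ∧
      (a ∈ D \ B → ∃ r ∈ B, A r a ≠ 0 ∧ ∃ n, Link D B A e f n r b) := by
  induction h using ReflTransGen.head_induction_on with
  | refl => exact ⟨fun _ => ⟨0, rfl⟩, fun h => absurd hb (Finset.mem_sdiff.1 h).2⟩
  | head hm _ ih =>
    obtain ⟨⟨hu, hv, huv⟩ | ⟨hv, hu, huv⟩, h1, h2, h3, h4⟩ := hm
    · refine ⟨fun _ => ?_, fun h => absurd hu (Finset.mem_sdiff.1 h).2⟩
      obtain ⟨r, hr, hrv, n, hn⟩ := ih.2 hv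
      exact ⟨n + 1, r, ⟨hu, hr, _, hv, h3, h4, huv, hrv⟩, hn⟩
    · exact ⟨fun h => absurd h (Finset.mem_sdiff.1 hu).2, fun _ => ⟨_, hv, huv, ih.1 hv⟩⟩

theorem Pair.nearly [CharP F 2] (h : Pair L D U₃ U U' e f) (hA : IsFrame D U B A) (he : e ∉ B)
    (hf : f ∉ B) (hcl : Clustered D B A e f) : Nearly L D U₃ U U' e f := by
  refine ⟨h, ⟨B, he, hf, hA.hasFrame⟩, fun C A₁ A' heC hfC hA₁ hA' a ha b hb => ?_⟩
  obtain ⟨A₃, h3⟩ := (h.same.iff C).2 hA₁.hasFrame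
  have hF : Frames D U₃ U U' C A₃ A₁ A' := ⟨h3, hA₁, hA'⟩
  have heD : e ∈ D \ C := by simp [h.mem_left, heC]
  have hfD : f ∈ D \ C := by simp [h.mem_right, hfC]
  have S := fun {r c} (hr : r ∈ C) (hc : c ∈ D \ C) => h.support_iff hF heC hfC hr hc
  refine lifts_of_eq_zero h.lift (S ha heD) (S ha hfD) (S hb heD) (S hb hfD)
    fun hae haf hbe hbf => ?_
  obtain ⟨z, hz⟩ := hcl.of_frame hA (by simp [h.mem_left, he]) hf hA₁ heC hfC
  obtain ⟨n, hn⟩ := (exists_link hb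
    ((hz a ha hae).trans (reflTransGen_meetsOff_symm (hz b hb hbe)))).1 ha
  exact h.lifts_of_link hF heC hfC ha hb hae haf hbe hbf hn

theorem IsFrame.restrict (h : IsFrame D U B A) (hD : D' ⊆ D) (hB : B ⊆ D') :
    IsFrame D' (minorSpace D' ∅ U) B A :=
  IsFrame.minor' (by simpa using h) hD hB (Finset.disjoint_empty_left _)

theorem Good.restrict (h : Good L D U U') (hA : IsFrame D U B A) (hD : D' ⊆ D) (hB : B ⊆ D') :
    Good L D' (minorSpace D' ∅ U) (minorSpace D' ∅ U') :=
  h.minor (C := B) (X := ∅) (by simpa using hA.hasFrame) hD hB (Finset.disjoint_empty_left _)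

theorem SameFrames.restrict (h : SameFrames D U U') (hA : IsFrame D U B A) (hD : D' ⊆ D)
    (hB : B ⊆ D') : SameFrames D' (minorSpace D' ∅ U) (minorSpace D' ∅ U') :=
  h.minor (C := B) (X := ∅) (by simpa using hA.hasFrame) hD hB (Finset.disjoint_empty_left _)

theorem minorSpace_minorSpace (h : D'' ⊆ D') (U : Set (E → F)) :
    minorSpace D'' ∅ (minorSpace D' ∅ U) = minorSpace D'' ∅ U := by
  ext v
  simp only [minorSpace, Set.mem_ofPred_eq, Finset.notMem_empty, false_imp_iff, implies_true,
    true_and]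
  constructor
  · rintro ⟨u, ⟨w, hw, h1⟩, h2⟩
    exact ⟨w, hw, fun e he => (h1 e (h he)).trans (h2 e he)⟩
  · rintro ⟨u, hu, h1⟩
    exact ⟨u, ⟨u, hu, fun _ _ => rfl⟩, h1⟩

theorem HasUniqueGood.exists_scale (h : HasUniqueGood L D U) {U₁ U₂ : Set (E → K)}
    {A₁ A₂ : E → E → K} (h₁ : Good L D U U₁) (h₂ : Good L D U U₂) (hA₁ : IsFrame D U₁ B A₁)
    (hA₂ : IsFrame D U₂ B A₂) : ∃ g : E → K, (∀ e, g e ≠ 0) ∧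
      ∀ b ∈ B, ∀ c ∈ D \ B, A₂ b c = (g c)⁻¹ * A₁ b c * g b := by
  obtain ⟨g, hg, rfl⟩ := h.2 _ _ h₁ h₂
  exact ⟨g, hg, fun b hb c hc => hA₂.unique (hA₁.scale hg) hb hc⟩

theorem eq_scale {U₁ U₂ : Set (E → K)} {A₁ A₂ : E → E → K} {g : E → K} (hg : ∀ e, g e ≠ 0)
    (hA₁ : IsFrame D U₁ B A₁) (hA₂ : IsFrame D U₂ B A₂)
    (h : ∀ b ∈ B, ∀ c ∈ D \ B, A₂ b c = (g c)⁻¹ * A₁ b c * g b) : U₂ = scale g U₁ := by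
  rw [(hA₂.congr h).eq_frameSpace, (hA₁.scale hg).eq_frameSpace]

section

variable [CharP F 2] (hL : IsLift L) (hS : SameFrames D U₃ U) (hA : IsFrame D U B A)
  (heD : e ∈ D) (hfD : f ∈ D) (hef : e ≠ f) (he : e ∉ B) (hf : f ∉ B)
  (hcl : Clustered D B A e f)
  (hle : HasUniqueGood L (D.erase e) (minorSpace (D.erase e) ∅ U))
  (hlf : HasUniqueGood L (D.erase f) (minorSpace (D.erase f) ∅ U))

include hL hS hA heD hfD hef he hf hcl hle hlf

theorem exists_good (hlef : HasUniqueGood L ((D.erase e).erase f)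
    (minorSpace ((D.erase e).erase f) ∅ U)) : ∃ U', Good L D U U' := by
  have he_sub := Finset.erase_subset e D
  have hf_sub := Finset.erase_subset f D
  have hBe : B ⊆ D.erase e := Finset.subset_erase.2 ⟨hA.1, he⟩
  have hBf : B ⊆ D.erase f := Finset.subset_erase.2 ⟨hA.1, hf⟩
  have hBef : B ⊆ (D.erase e).erase f := Finset.subset_erase.2 ⟨hBe, hf⟩
  have hsub1 : (D.erase e).erase f ⊆ D.erase e := Finset.erase_subset _ _
  have hsub2 : (D.erase e).erase f ⊆ D.erase f := by
    rw [Finset.erase_right_comm]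
    exact Finset.erase_subset _ _
  obtain ⟨U₁, h₁⟩ := hle.1
  obtain ⟨U₂, h₂⟩ := hlf.1
  obtain ⟨A₁, hA₁⟩ := (h₁.same.iff B).1 (hA.restrict he_sub hBe).hasFrame
  obtain ⟨A₂, hA₂⟩ := (h₂.same.iff B).1 (hA.restrict hf_sub hBf).hasFrame
  have r₁ := h₁.restrict (hA.restrict he_sub hBe) hsub1 hBef
  have r₂ := h₂.restrict (hA.restrict hf_sub hBf) hsub2 hBef
  rw [minorSpace_minorSpace hsub1] at r₁
  rw [minorSpace_minorSpace hsub2] at r₂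
  obtain ⟨g, hg, hgA⟩ := hlef.exists_scale r₂ r₁ (hA₂.restrict hsub2 hBef) (hA₁.restrict hsub1 hBef)
  set Â : E → E → K := fun b c => if c = e then A₂ b e * g b else A₁ b c with hÂ
  have hU := isFrame_frameSpace hA.1 Â
  have off_e : GoodOff L D U (frameSpace D B Â) e := by
    refine (good_erase_iff hA.hasFrame hU.hasFrame he).1 ?_
    convert h₁
    rw [(hU.restrict he_sub hBe).eq_frameSpace, (hA₁.congr (A' := Â) ?_).eq_frameSpace]
    intro b hb c hc
    simp only [Finset.mem_sdiff, Finset.mem_erase] at hc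
    simp [hÂ, hc.1.1]
  have off_f : GoodOff L D U (frameSpace D B Â) f := by
    refine (good_erase_iff hA.hasFrame hU.hasFrame hf).1 ?_
    have hg' : ∀ x, Function.update g e 1 x ≠ 0 := fun x => by
      by_cases h : x = e
      · simp [h]
      · simp [h, hg]
    convert h₂.scale hg'
    rw [(hU.restrict hf_sub hBf).eq_frameSpace,
      ((hA₂.scale hg').congr (A' := Â) ?_).eq_frameSpace]
    intro b hb c hc
    have hbe : b ≠ e := fun h => he (h ▸ hb)
    simp only [Finset.mem_sdiff, Finset.mem_erase] at hc
    by_cases hce : c = e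
    · simp [hÂ, hce, hbe]
    · simp only [hÂ, hce, hbe, if_false, ne_eq, not_false_eq_true, Function.update_of_ne]
      exact (hgA b hb c (by simp [hc, hce])).symm
  exact ⟨_, (Pair.nearly ⟨hL, hS, off_e, off_f, hef, heD, hfD⟩ hA he hf hcl).good⟩

theorem exists_scale_of_good {U₁ U₂ : Set (E → K)} (h₁ : Good L D U U₁) (h₂ : Good L D U U₂) :
    ∃ g : E → K, (∀ e, g e ≠ 0) ∧ U₂ = scale g U₁ := by
  have he_sub := Finset.erase_subset e D
  have hf_sub := Finset.erase_subset f D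
  have hBe : B ⊆ D.erase e := Finset.subset_erase.2 ⟨hA.1, he⟩
  have hBf : B ⊆ D.erase f := Finset.subset_erase.2 ⟨hA.1, hf⟩
  obtain ⟨A₁, hA₁⟩ := (h₁.same.iff B).1 hA.hasFrame
  obtain ⟨A₂, hA₂⟩ := (h₂.same.iff B).1 hA.hasFrame
  obtain ⟨g, hg, hgA⟩ := hle.exists_scale (h₁.restrict hA he_sub hBe) (h₂.restrict hA he_sub hBe)
    (hA₁.restrict he_sub hBe) (hA₂.restrict he_sub hBe)
  obtain ⟨k, hk, hkA⟩ := hlf.exists_scale (h₁.restrict hA hf_sub hBf) (h₂.restrict hA hf_sub hBf)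
    (hA₁.restrict hf_sub hBf) (hA₂.restrict hf_sub hBf)
  have step : ∀ u ∈ B, ∀ v ∈ D \ B, A u v ≠ 0 → v ≠ e → v ≠ f → g u / k u = g v / k v := by
    intro u hu v hv huv hve hvf
    have hv' := Finset.mem_sdiff.1 hv
    have h1 := hgA u hu v (by simp [hv', hve])
    rw [hkA u hu v (by simp [hv', hvf])] at h1
    have h0 := mt (h₁.same.support_iff hA hA₁ hu hv).2 huv
    have := hg u; have := hg v; have := hk u; have := hk v
    field_simp at h1 ⊢
    linear_combination -h1
  obtain ⟨z, hz⟩ := hcl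
  have conn : ∀ u, ReflTransGen (MeetsOff D B A e f) u z → g u / k u = g z / k z := by
    intro u h
    induction h using ReflTransGen.head_induction_on with
    | refl => rfl
    | head hm _ ih =>
      rw [← ih]
      obtain ⟨⟨hu, hv, huv⟩ | ⟨hu, hv, huv⟩, k1, k2, k3, k4⟩ := hm
      · exact step _ hu _ hv huv k3 k4
      · exact (step _ hu _ hv huv k1 k2).symm
  have hg' : ∀ x, Function.update g e (g z / k z * k e) x ≠ 0 := fun x => by
    by_cases h : x = e
    · simp [h, hg, hk]
    · simp [h, hg]
  refine ⟨_, hg', eq_scale hg' hA₁ hA₂ fun b hb c hc => ?_⟩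
  have hbe : b ≠ e := fun h => he (h ▸ hb)
  have hc' := Finset.mem_sdiff.1 hc
  by_cases hce : c = e
  · subst hce
    rw [hkA b hb c (by simp [hc', hef])]
    by_cases h0 : A b c = 0
    · simp [(h₁.same.support_iff hA hA₁ hb hc).1 h0]
    · have := conn b (hz b hb h0)
      rw [← this]
      have := hg b; have := hk b; have := hk c
      simp only [Function.update_self, hbe, ne_eq, not_false_eq_true, Function.update_of_ne]
      field_simp
  · simp only [hce, hbe, ne_eq, not_false_eq_true, Function.update_of_ne]
    exact hgA b hb c (by simp [hc', hce])

theorem hasUniqueGood_of_clustered (hlef : HasUniqueGood L ((D.erase e).erase f)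
    (minorSpace ((D.erase e).erase f) ∅ U)) : HasUniqueGood L D U :=
  ⟨exists_good hL hS hA heD hfD hef he hf hcl hle hlf hlef,
    fun _ _ => exists_scale_of_good hL hS hA heD hfD hef he hf hcl hle hlf⟩

end

end Extension

section Small

variable {E : Type*} [DecidableEq E] {F K : Type*} [Field F] [Field K]
  {D B B' C : Finset E} {U : Set (E → F)} {U' U'' : Set (E → K)}
  {A : E → E → F} {A' A'' : E → E → K} {L : F → K} {a b c d x y : E}

/-- The supports of `A` and `A'` agree and the cross-ratios of `A'` are the lifts of those
of `A`. -/
structure Matched (L : F → K) (D B : Finset E) (A : E → E → F) (A' : E → E → K) : Prop where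
  support : ∀ b ∈ B, ∀ c ∈ D \ B, A b c = 0 ↔ A' b c = 0
  lifts : ∀ a ∈ B, ∀ b ∈ B, ∀ c ∈ D \ B, ∀ d ∈ D \ B, Lifts L A A' a b c d

theorem Matched.pivot_support (hL : IsLift L) (h : Matched L D B A A') (hx : x ∈ B)
    (hy : y ∈ D \ B) (hxy : A x y ≠ 0) (hb : b ∈ insert y (B.erase x))
    (hc : c ∈ D \ insert y (B.erase x)) : pivot A x y b c = 0 ↔ pivot A' x y b c = 0 := by
  have hxy' := mt (h.support x hx y hy).2 hxy
  obtain ⟨hcD, hc⟩ := Finset.mem_sdiff.1 hc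
  simp only [Finset.mem_insert, Finset.mem_erase, not_or, not_and_or, not_not] at hb hc
  by_cases hcx : c = x
  · subst hcx
    rcases hb with rfl | hb
    · simp [pivot_self, hxy, hxy']
    · have := ne_of_mem_sdiff hb.2 hy
      simp [pivot_col _ this, hxy, hxy', h.support b hb.2 y hy]
  have hcB : c ∈ D \ B := by simp [hcD, hc.2.resolve_left hcx]
  rcases hb with rfl | hb
  · simp [pivot_row _ hcx, hxy, hxy', h.support x hx c hcB]
  have hby := ne_of_mem_sdiff hb.2 hy
  rw [pivot_of_ne _ hby hcx, pivot_of_ne _ hby hcx]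
  have e1 := h.support b hb.2 y hy
  have e2 := h.support x hx c hcB
  by_cases h1 : A b y = 0
  · simp [h1, e1.1 h1, h.support b hb.2 c hcB]
  by_cases h2 : A x c = 0
  · simp [h2, e2.1 h2, h.support b hb.2 c hcB]
  have h1' := mt e1.2 h1
  have h2' := mt e2.2 h2
  have key := h.lifts b hb.2 x hx c hcB y hy
  have hl : A b c - A b y * A x c / A x y = 0 ↔ crossRatio A b x c y = 1 := by
    unfold crossRatio
    rw [sub_eq_zero, div_eq_one_iff_eq (mul_ne_zero h1 h2), eq_div_iff hxy]
  have hr : A' b c - A' b y * A' x c / A' x y = 0 ↔ crossRatio A' b x c y = 1 := by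
    unfold crossRatio
    rw [sub_eq_zero, div_eq_one_iff_eq (mul_ne_zero h1' h2'), eq_div_iff hxy']
  rw [hl, hr, key]
  exact ⟨fun h => by rw [h, hL.one], hL.eq_one⟩

theorem Matched.pivot (hL : IsLift L) (h : Matched L D B A A') (hB : B ⊆ D) (hx : x ∈ B)
    (hy : y ∈ D \ B) (hxy : A x y ≠ 0) (h1 : B.card ≤ 2) (h2 : (D \ B).card ≤ 2) :
    Matched L D (insert y (B.erase x)) (pivot A x y) (pivot A' x y) := by
  have S := fun {b c} => h.pivot_support (b := b) (c := c) hL hx hy hxy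
  refine ⟨fun b hb c hc => S hb hc, ?_⟩
  have hyB := Finset.mem_sdiff.1 hy
  have hset : D \ insert y (B.erase x) = insert x ((D \ B).erase y) := by
    ext z
    have : x ≠ y := ne_of_mem_sdiff hx hy
    simp only [Finset.mem_sdiff, Finset.mem_insert, Finset.mem_erase, not_or, not_and_or, not_not]
    by_cases hz : z = x
    · simp [hz, hB hx, this]
    · tauto
  have c1 : (B.erase x).card ≤ 1 := by rw [Finset.card_erase_of_mem hx]; omega
  have c2 : ((D \ B).erase y).card ≤ 1 := by rw [Finset.card_erase_of_mem hy]; omega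
  rw [Finset.card_le_one] at c1 c2
  have main : ∀ i ∈ B.erase x, ∀ j ∈ (D \ B).erase y,
      Lifts L (Paper.pivot A x y) (Paper.pivot A' x y) y i x j := by
    intro i hi j hj
    have hi' : i ∈ insert y (B.erase x) := Finset.mem_insert_of_mem hi
    have hj' : j ∈ D \ insert y (B.erase x) := hset ▸ Finset.mem_insert_of_mem hj
    have hyn : y ∈ insert y (B.erase x) := Finset.mem_insert_self _ _
    have hxn : x ∈ D \ insert y (B.erase x) := hset ▸ Finset.mem_insert_self _ _
    rw [Finset.mem_erase] at hi hj
    have hiy := ne_of_mem_sdiff hi.2 hy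
    have hjx := (ne_of_mem_sdiff hx hj.2).symm
    refine lifts_of_eq_zero hL (S hyn hxn) (S hyn hj') (S hi' hxn) (S hi' hj') fun k1 k2 k3 k4 => ?_
    rw [pivot_row _ hjx] at k2
    rw [pivot_col _ hiy] at k3
    have k2' : A x j ≠ 0 := fun h => k2 (by simp [h])
    have k3' : A i y ≠ 0 := fun h => k3 (by simp [h])
    exact (lifts_pivot_iff hL hxy k2' k3' (mt (h.support _ hx _ hy).2 hxy)
      (mt (h.support _ hx _ hj.2).2 k2') (mt (h.support _ hi.2 _ hy).2 k3') hiy hjx).2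
      (h.lifts _ hx _ hi.2 _ hy _ hj.2)
  intro a ha b hb c hc d hd
  by_cases hab : a = b
  · subst hab
    exact lifts_self_rows hL (S ha hc) (S ha hd)
  by_cases hcd : c = d
  · subst hcd
    exact lifts_self_cols hL (S ha hc) (S hb hc)
  rw [hset] at hc hd
  rw [Finset.mem_insert] at ha hb hc hd
  rcases ha with rfl | ha <;> rcases hb with rfl | hb
  · exact absurd rfl hab
  · rcases hc with rfl | hc <;> rcases hd with rfl | hd
    · exact absurd rfl hcd
    · exact main _ hb _ hd
    · exact (main _ hb _ hc).swap_cols hL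
    · exact absurd (c2 _ hc _ hd) hcd
  · rcases hc with rfl | hc <;> rcases hd with rfl | hd
    · exact absurd rfl hcd
    · exact (main _ ha _ hd).swap_rows hL
    · exact ((main _ ha _ hc).swap_cols hL).swap_rows hL
    · exact absurd (c2 _ hc _ hd) hcd
  · exact absurd (c1 _ ha _ hb) hab

theorem Matched.exists_step (hL : IsLift L) (hc1 : C.card ≤ 2) (hc2 : (D \ C).card ≤ 2)
    (hC : ∃ A A', IsFrame D U C A ∧ IsFrame D U' C A' ∧ Matched L D C A A')
    (hx : x ∈ C) (hy : y ∈ D \ C)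
    (h : HasFrame D U (insert y (C.erase x)) ∨ HasFrame D U' (insert y (C.erase x))) :
    ∃ A A', IsFrame D U (insert y (C.erase x)) A ∧ IsFrame D U' (insert y (C.erase x)) A' ∧
      Matched L D (insert y (C.erase x)) A A' := by
  obtain ⟨A, A', hA, hA', hM⟩ := hC
  have hxy : A x y ≠ 0 := by
    rcases h with h | h
    · exact (hA.hasFrame_exchange_iff hx hy).1 h
    · exact mt (hM.support _ hx _ hy).1 ((hA'.hasFrame_exchange_iff hx hy).1 h)
  exact ⟨_, _, hA.pivot hx hy hxy, hA'.pivot hx hy (mt (hM.support _ hx _ hy).2 hxy),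
    hM.pivot hL hA.1 hx hy hxy hc1 hc2⟩

theorem Matched.good (hL : IsLift L) (h : Matched L D B A A') (hA : IsFrame D U B A)
    (hA' : IsFrame D U' B A') (h1 : B.card ≤ 2) (h2 : (D \ B).card ≤ 2) : Good L D U U' := by
  have hcard : ∀ {C : Finset E}, C ⊆ D → C.card = B.card → C.card ≤ 2 ∧ (D \ C).card ≤ 2 := by
    intro C hC hCB
    rw [Finset.card_sdiff_of_subset hA.1] at h2
    rw [Finset.card_sdiff_of_subset hC, hCB]
    exact ⟨h1, h2⟩
  have h0 : ∃ A A', IsFrame D U B A ∧ IsFrame D U' B A' ∧ Matched L D B A A' :=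
    ⟨A, A', hA, hA', h⟩
  have hU : ∀ C, HasFrame D U C →
      ∃ A A', IsFrame D U C A ∧ IsFrame D U' C A' ∧ Matched L D C A A' := by
    refine fun C hC => hA.induction hC
      (fun C => ∃ A A', IsFrame D U C A ∧ IsFrame D U' C A' ∧ Matched L D C A A')
      h0 fun C' A₁ x y hA₁ hp hx hy hxy => ?_
    rw [Finset.mem_sdiff] at hx hy
    have hy' : y ∈ D \ C' := by simp [hC.subset hy.1, hy.2]
    obtain ⟨k1, k2⟩ := hcard hA₁.1 (hA.card_eq hA₁.hasFrame)
    exact Matched.exists_step hL k1 k2 hp hx.1 hy' (.inl (hA₁.pivot hx.1 hy' hxy).hasFrame)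
  have hU' : ∀ C, HasFrame D U' C →
      ∃ A A', IsFrame D U C A ∧ IsFrame D U' C A' ∧ Matched L D C A A' := by
    refine fun C hC => hA'.induction hC
      (fun C => ∃ A A', IsFrame D U C A ∧ IsFrame D U' C A' ∧ Matched L D C A A')
      h0 fun C' A₁ x y hA₁ hp hx hy hxy => ?_
    rw [Finset.mem_sdiff] at hx hy
    have hy' : y ∈ D \ C' := by simp [hC.subset hy.1, hy.2]
    obtain ⟨k1, k2⟩ := hcard hA₁.1 (hA'.card_eq hA₁.hasFrame)
    exact Matched.exists_step hL k1 k2 hp hx.1 hy' (.inr (hA₁.pivot hx.1 hy' hxy).hasFrame)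
  refine ⟨⟨⟨B, hA.hasFrame⟩, fun C => ⟨fun h => ?_, fun h => ?_⟩⟩, ?_⟩
  · obtain ⟨_, A₂, -, h, -⟩ := hU C h
    exact ⟨A₂, h⟩
  · obtain ⟨A₁, _, h, -⟩ := hU' C h
    exact ⟨A₁, h⟩
  · intro C A₁ A₁' hA₁ hA₁' a ha b hb c hc d hd
    obtain ⟨A₂, A₂', h₂, h₂', hM⟩ := hU C hA₁.hasFrame
    have := hM.lifts a ha b hb c hc d hd
    unfold Lifts at this ⊢
    rwa [crossRatio_congr (h₂.unique hA₁ ha hc) (h₂.unique hA₁ ha hd) (h₂.unique hA₁ hb hc)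
      (h₂.unique hA₁ hb hd), crossRatio_congr (h₂'.unique hA₁' ha hc) (h₂'.unique hA₁' ha hd)
      (h₂'.unique hA₁' hb hc) (h₂'.unique hA₁' hb hd)] at this

/-- The matrix over `K` with support that of `A`, all of whose nonzero entries are one with a
possible exception in row `x` and column `y`. -/
theorem exists_matched (hL : IsLift L) (A : E → E → F) (h1 : B.card ≤ 2) (h2 : (D \ B).card ≤ 2) :
    ∃ A' : E → E → K, Matched L D B A A' := by
  classical
  by_cases H : ∃ a ∈ B, ∃ b ∈ B, ∃ c ∈ D \ B, ∃ d ∈ D \ B, a ≠ b ∧ c ≠ d ∧ crossRatio A a b c d ≠ 0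
  · obtain ⟨a, ha, b, hb, c, hc, d, hd, hab, hcd, h0⟩ := H
    have hne : A a c ≠ 0 ∧ A b d ≠ 0 ∧ A a d ≠ 0 ∧ A b c ≠ 0 := by
      refine ⟨?_, ?_, ?_, ?_⟩ <;> intro h <;> exact h0 (by simp [crossRatio, h])
    have hBe : ∀ z ∈ B, z = a ∨ z = b := fun z hz => by
      by_contra! h
      have : ({a, b, z} : Finset E) ⊆ B := by
        intro w; simp only [Finset.mem_insert, Finset.mem_singleton]; rintro (rfl | rfl | rfl) <;>
          assumption
      have := Finset.card_le_card this
      rw [Finset.card_eq_three.2 ⟨a, b, z, hab, h.1.symm, h.2.symm, rfl⟩] at this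
      omega
    have hDe : ∀ z ∈ D \ B, z = c ∨ z = d := fun z hz => by
      by_contra! h
      have : ({c, d, z} : Finset E) ⊆ D \ B := by
        intro w; simp only [Finset.mem_insert, Finset.mem_singleton]; rintro (rfl | rfl | rfl) <;>
          assumption
      have := Finset.card_le_card this
      rw [Finset.card_eq_three.2 ⟨c, d, z, hcd, h.1.symm, h.2.symm, rfl⟩] at this
      omega
    set A' : E → E → K := fun r s => if r = a ∧ s = c then L (crossRatio A a b c d) else 1 with hA'
    have hl := hL.ne_zero h0
    have hS : ∀ r ∈ B, ∀ s ∈ D \ B, A r s = 0 ↔ A' r s = 0 := by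
      intro r hr s hs
      have k1 : A r s ≠ 0 := by
        rcases hBe r hr with rfl | rfl <;> rcases hDe s hs with rfl | rfl <;> tauto
      have k2 : A' r s ≠ 0 := by
        simp only [hA']
        split_ifs
        · exact hl
        · exact one_ne_zero
      exact iff_of_false k1 k2
    have main : Lifts L A A' a b c d := by
      simp [Lifts, crossRatio, hA', hab.symm, hcd.symm]
    refine ⟨A', hS, fun r hr s hs t ht u hu => ?_⟩
    by_cases hrs : r = s
    · subst hrs
      exact lifts_self_rows hL (hS _ hr _ ht) (hS _ hr _ hu)
    by_cases htu : t = u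
    · subst htu
      exact lifts_self_cols hL (hS _ hr _ ht) (hS _ hs _ ht)
    rcases hBe r hr with rfl | rfl <;> rcases hBe s hs with rfl | rfl <;>
      rcases hDe t ht with rfl | rfl <;> rcases hDe u hu with rfl | rfl <;>
      first | exact absurd rfl hrs | exact absurd rfl htu | exact main | exact main.swap_rows hL |
        exact main.swap_cols hL | exact (main.swap_rows hL).swap_cols hL
  · push Not at H
    set A' : E → E → K := fun r s => if A r s = 0 then 0 else 1 with hA'
    have hS : ∀ r s, A r s = 0 ↔ A' r s = 0 := fun r s => by
      simp only [hA']; split_ifs with h <;> simp [h]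
    refine ⟨A', fun r _ s _ => hS r s, fun r hr s hs t ht u hu => ?_⟩
    by_cases hrs : r = s
    · subst hrs
      exact lifts_self_rows hL (hS _ _) (hS _ _)
    by_cases htu : t = u
    · subst htu
      exact lifts_self_cols hL (hS _ _) (hS _ _)
    have h0 := H r hr s hs t ht u hu hrs htu
    rw [Lifts, h0, hL.zero]
    simpa [crossRatio, hS] using h0

theorem exists_scale_of_two {R : E → E → K} (hR : ∀ r s, R r s ≠ 0) (hB : B = {a, b})
    (hC : D \ B = {c, d}) (hab : a ≠ b) (hcd : c ≠ d) {S : E → E → Prop}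
    (h : S b d → R a c * R b d = R a d * R b c) :
    ∃ g : E → K, (∀ e, g e ≠ 0) ∧ ∀ r ∈ B, ∀ s ∈ D \ B, S r s → g r = R r s * g s := by
  classical
  have ha : a ∈ B := by simp [hB]
  have hb : b ∈ B := by simp [hB]
  have hc : c ∈ D \ B := by simp [hC]
  have hd : d ∈ D \ B := by simp [hC]
  have hac := ne_of_mem_sdiff ha hc
  have had := ne_of_mem_sdiff ha hd
  have hbc := ne_of_mem_sdiff hb hc
  have hbd := ne_of_mem_sdiff hb hd
  have h1 := hR a c
  have h2 := hR a d
  have h3 := hR b c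
  refine ⟨fun e => if e = c then (R a c)⁻¹ else if e = d then (R a d)⁻¹ else
    if e = b then R b c / R a c else 1, fun e => ?_, ?_⟩
  · dsimp only
    split_ifs <;> simp [*]
  · intro r hr s hs hrs
    rw [hC] at hs
    simp only [hB, Finset.mem_insert, Finset.mem_singleton] at hr hs
    rcases hr with rfl | rfl <;> rcases hs with rfl | rfl
    · simp [hac, had, hab, h1]
    · simp [hac, had, hab, hcd.symm, h2]
    · simp [hbc, hbd, div_eq_mul_inv]
    · have := h hrs
      simp only [hbc, hbd, if_false, if_true, hcd.symm]
      field_simp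
      linear_combination -this

theorem exists_scale_of_card_le {R : E → E → K} (hR : ∀ r s, R r s ≠ 0) (h1 : B.card ≤ 2)
    (h2 : (D \ B).card ≤ 2) {S : E → E → Prop}
    (h : ∀ a ∈ B, ∀ b ∈ B, ∀ c ∈ D \ B, ∀ d ∈ D \ B, S a c → S b d → S a d → S b c →
      R a c * R b d = R a d * R b c) :
    ∃ g : E → K, (∀ e, g e ≠ 0) ∧ ∀ r ∈ B, ∀ s ∈ D \ B, S r s → g r = R r s * g s := by
  classical
  by_cases hB : B.card = 2
  · by_cases hC : (D \ B).card = 2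
    · obtain ⟨a, b, hab, hB⟩ := Finset.card_eq_two.1 hB
      obtain ⟨c, d, hcd, hC⟩ := Finset.card_eq_two.1 hC
      have hB' : B = {b, a} := by rw [hB, Finset.pair_comm]
      have hC' : D \ B = {d, c} := by rw [hC, Finset.pair_comm]
      by_cases k1 : S b d
      · by_cases k2 : S b c
        · by_cases k3 : S a d
          · by_cases k4 : S a c
            · exact exists_scale_of_two hR hB hC hab hcd fun _ =>
                h a (by simp [hB]) b (by simp [hB]) c (by simp [hC]) d (by simp [hC]) k4 k1 k3 k2
            · exact exists_scale_of_two hR hB' hC' hab.symm hcd.symm fun h => absurd h k4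
          · exact exists_scale_of_two hR hB' hC hab.symm hcd fun h => absurd h k3
        · exact exists_scale_of_two hR hB hC' hab hcd.symm fun h => absurd h k2
      · exact exists_scale_of_two hR hB hC hab hcd fun h => absurd h k1
    · rcases (D \ B).eq_empty_or_nonempty with h0 | ⟨d, hd⟩
      · exact ⟨fun _ => 1, by simp, by simp [h0]⟩
      have hu := Finset.card_le_one.1 (show (D \ B).card ≤ 1 by omega)
      refine ⟨fun e => if e = d then 1 else R e d, fun e => ?_, fun r hr s hs _ => ?_⟩
      · dsimp only
        split_ifs <;> simp [hR]
      · rw [hu s hs d hd]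
        simp [ne_of_mem_sdiff hr hd]
  · rcases B.eq_empty_or_nonempty with h0 | ⟨b, hb⟩
    · exact ⟨fun _ => 1, by simp, by simp [h0]⟩
    have hu := Finset.card_le_one.1 (show B.card ≤ 1 by omega)
    refine ⟨fun e => if e = b then 1 else (R b e)⁻¹, fun e => ?_, fun r hr s hs _ => ?_⟩
    · dsimp only
      split_ifs <;> simp [hR]
    · rw [hu r hr b hb]
      simp [(ne_of_mem_sdiff hb hs).symm, hR]

theorem hasUniqueGood_of_card_le (hL : IsLift L) (hA : IsFrame D U B A) (h1 : B.card ≤ 2)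
    (h2 : (D \ B).card ≤ 2) : HasUniqueGood L D U := by
  classical
  refine ⟨?_, fun U' U'' hU' hU'' => ?_⟩
  · obtain ⟨A', hA'⟩ := exists_matched hL A h1 h2
    exact ⟨_, hA'.good hL hA (isFrame_frameSpace hA.1 A') h1 h2⟩
  obtain ⟨A', hA'⟩ := (hU'.same.iff B).1 hA.hasFrame
  obtain ⟨A'', hA''⟩ := (hU''.same.iff B).1 hA.hasFrame
  have S' := fun {r s} (hr : r ∈ B) (hs : s ∈ D \ B) => hU'.same.support_iff hA hA' hr hs
  have S'' := fun {r s} (hr : r ∈ B) (hs : s ∈ D \ B) => hU''.same.support_iff hA hA'' hr hs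
  obtain ⟨g, hg, hgR⟩ := exists_scale_of_card_le
    (R := fun r s => if A' r s = 0 ∨ A'' r s = 0 then 1 else A'' r s / A' r s)
    (S := fun r s => A r s ≠ 0) (fun r s => by split_ifs with h <;> simp_all) h1 h2 (by
      intro a ha b hb c hc d hd h1 h2 h3 h4
      have e1 := hU'.lifts B A A' hA hA' a ha b hb c hc d hd
      have e2 := hU''.lifts B A A'' hA hA'' a ha b hb c hc d hd
      rw [Lifts, ← e1] at e2
      unfold crossRatio at e2
      have h1' := mt (S'' ha hc).2 h1
      have h2' := mt (S'' hb hd).2 h2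
      have h3' := mt (S'' ha hd).2 h3
      have h4' := mt (S'' hb hc).2 h4
      have h1 := mt (S' ha hc).2 h1
      have h2 := mt (S' hb hd).2 h2
      have h3 := mt (S' ha hd).2 h3
      have h4 := mt (S' hb hc).2 h4
      simp only [h1, h1', h2, h2', h3, h3', h4, h4', or_false, if_false]
      field_simp at e2 ⊢
      linear_combination e2)
  refine ⟨g, hg, eq_scale hg hA' hA'' fun b hb c hc => ?_⟩
  by_cases h0 : A b c = 0
  · simp [(S' hb hc).1 h0, (S'' hb hc).1 h0]
  have h := hgR b hb c hc h0
  have k1 := mt (S' hb hc).2 h0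
  have k2 := mt (S'' hb hc).2 h0
  have := hg c
  simp only [k1, k2, or_false, if_false] at h
  rw [h]
  field_simp

end Small

section Leaves

variable {V : Type*} {G : SimpleGraph V} {u v : V}

theorem exists_closer (h : G.Reachable u v) (huv : u ≠ v) :
    ∃ w, G.Adj u w ∧ G.Reachable w v ∧ G.dist w v < G.dist u v := by
  obtain ⟨p, hp⟩ := h.exists_walk_length_eq_dist
  cases p with
  | nil => exact absurd rfl huv
  | cons hadj q =>
    refine ⟨_, hadj, ⟨q⟩, ?_⟩
    have := SimpleGraph.dist_le q
    rw [SimpleGraph.Walk.length_cons] at hp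
    omega

/-- The leaves of a breadth-first search tree with root `v`: there are at least as many of them as
`v` has neighbours, and every vertex is joined to `v` by a path avoiding all of them. -/
theorem exists_leaves (hfin : {u | G.Reachable u v}.Finite) : ∃ S : Set V,
    (∀ u ∈ S, u ≠ v ∧ G.Reachable u v) ∧
    (∃ l : V → V, Set.InjOn l {a | G.Adj v a} ∧ ∀ a, G.Adj v a → l a ∈ S) ∧
    ∀ u, G.Reachable u v → ReflTransGen (fun a b => G.Adj a b ∧ b ∉ S ∧ G.Reachable b v) u v := by
  classical
  have hp : ∀ u, ∃ w, G.Reachable u v → u ≠ v →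
      G.Adj u w ∧ G.Reachable w v ∧ G.dist w v < G.dist u v := by
    intro u
    by_cases h : G.Reachable u v ∧ u ≠ v
    · obtain ⟨w, hw⟩ := exists_closer h.1 h.2
      exact ⟨w, fun _ _ => hw⟩
    · exact ⟨v, fun h1 h2 => absurd ⟨h1, h2⟩ h⟩
  choose p hp using hp
  let r : V → V → Prop := fun a b => G.Reachable a v ∧ a ≠ v ∧ p a = b
  have hr : Relator.RightUnique r := fun a b c h1 h2 => h1.2.2.symm.trans h2.2.2
  have hnbr : ∀ {a}, G.Adj v a → p a = v ∧ a ≠ v ∧ G.Reachable a v := fun {a} ha => by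
    have hav : G.Reachable a v := ha.symm.reachable
    obtain ⟨-, h2, h3⟩ := hp a hav ha.symm.ne
    rw [SimpleGraph.dist_eq_one_iff_adj.2 ha.symm] at h3
    exact ⟨h2.dist_eq_zero_iff.1 (by omega), ha.symm.ne, hav⟩
  have hstuck : ∀ {b}, ReflTransGen r v b → b = v := fun {b} h => by
    rcases ReflTransGen.cases_head h with h | ⟨c, hc, -⟩
    · exact h.symm
    · exact absurd rfl hc.2.1
  have hpath : ∀ {a b}, G.Adj v a → G.Adj v b → ReflTransGen r a b → a = b := by
    intro a b ha hb h
    rcases ReflTransGen.cases_head h with h | ⟨c, hc, h⟩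
    · exact h
    · rw [← hc.2.2, (hnbr ha).1] at h
      exact absurd (hstuck h) (hnbr hb).2.1
  refine ⟨{u | u ≠ v ∧ G.Reachable u v ∧ ∀ w, ¬ r w u}, fun u hu => ⟨hu.1, hu.2.1⟩, ?_, ?_⟩
  · have hl : ∀ a, ∃ l, G.Adj v a →
        ReflTransGen r l a ∧ l ∈ {u | u ≠ v ∧ G.Reachable u v ∧ ∀ w, ¬ r w u} := by
      intro a
      by_cases ha : G.Adj v a
      · have hne : {u | G.Reachable u v ∧ ReflTransGen r u a}.Nonempty :=
          ⟨a, (hnbr ha).2.2, .refl⟩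
        obtain ⟨l, ⟨hl1, hl2⟩, hmax⟩ := (hfin.subset fun u hu => hu.1 :
          {u | G.Reachable u v ∧ ReflTransGen r u a}.Finite).exists_maximalFor
            (fun u => G.dist u v) _ hne
        refine ⟨l, fun _ => ⟨hl2, ?_, hl1, fun w hw => ?_⟩⟩
        · rintro rfl
          exact (hnbr ha).2.1 (hstuck hl2)
        · have h1 := (hp w hw.1 hw.2.1).2.2
          rw [hw.2.2] at h1
          have := hmax (j := w) ⟨hw.1, .head hw hl2⟩ h1.le
          simp only at this
          omega
      · exact ⟨v, fun h => absurd h ha⟩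
    choose l hl using hl
    refine ⟨l, fun a ha b hb hab => ?_, fun a ha => (hl a ha).2⟩
    rcases ReflTransGen.total_of_right_unique hr (hl a ha).1 (hab ▸ (hl b hb).1) with h | h
    · exact hpath ha hb h
    · exact (hpath hb ha h).symm
  · intro u hu
    induction hn : G.dist u v using Nat.strong_induction_on generalizing u with
    | _ n ih =>
      by_cases huv : u = v
      · rw [huv]
      · obtain ⟨h1, h2, h3⟩ := hp u hu huv
        refine .head ⟨h1, fun h => h.2.2 u ⟨hu, huv, rfl⟩, h2⟩ (ih _ (hn ▸ h3) _ h2 rfl)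

end Leaves

section Selection

variable {E : Type*} [DecidableEq E] {F : Type*} [Field F]
  {D B : Finset E} {U : Set (E → F)} {A : E → E → F} {a b c e f u v x y z : E}

/-- The fundamental graph of the basis `B`. -/
def fundGraph (D B : Finset E) (A : E → E → F) : SimpleGraph E where
  Adj := Meets D B A
  symm := ⟨fun _ _ h => h.symm⟩
  loopless := ⟨fun _ h => h.elim (fun h => (Finset.mem_sdiff.1 h.2.1).2 h.1)
    fun h => (Finset.mem_sdiff.1 h.2.1).2 h.1⟩

/-- The elements `e` and `f` are distinct and on the same side of the fundamental graph, and the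
neighbours of `e` are connected to each other after deleting `e` and `f`. -/
structure Removable (D B : Finset E) (A : E → E → F) (e f : E) : Prop where
  ne : e ≠ f
  side : (e ∈ B ∧ f ∈ B) ∨ (e ∈ D \ B ∧ f ∈ D \ B)
  joined : ∃ z, ∀ i, Meets D B A i e → ReflTransGen (MeetsOff D B A e f) i z

theorem Meets.side (h : Meets D B A u v) : (u ∈ B ∧ v ∈ D \ B) ∨ (u ∈ D \ B ∧ v ∈ B) :=
  h.imp (fun h => ⟨h.1, h.2.1⟩) fun h => ⟨h.2.1, h.1⟩

theorem removable_of_path {S : Set E} (hef : e ≠ f)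
    (side : (e ∈ B ∧ f ∈ B) ∨ (e ∈ D \ B ∧ f ∈ D \ B)) (he : e ∈ S)
    (hev : (fundGraph D B A).Reachable e v)
    (hf : f ∈ S ∨ ¬ (fundGraph D B A).Reachable f v)
    (hS : ∀ u, (fundGraph D B A).Reachable u v → ReflTransGen
      (fun a b => (fundGraph D B A).Adj a b ∧ b ∉ S ∧ (fundGraph D B A).Reachable b v) u v) :
    Removable D B A e f := by
  refine ⟨hef, side, v, fun i hi => ?_⟩
  have hie : i ≠ e ∧ i ≠ f := by
    have := hi.side
    constructor <;> rintro rfl <;> simp only [Finset.mem_sdiff] at * <;> tauto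
  have hiv : (fundGraph D B A).Reachable i v :=
    (SimpleGraph.Adj.reachable (G := fundGraph D B A) hi).trans hev
  have h := hS i hiv
  clear hi hiv
  induction h using ReflTransGen.head_induction_on with
  | refl => exact .refl
  | head hm _ ih =>
    have h1 : ∀ {b}, b ∉ S → (fundGraph D B A).Reachable b v → b ≠ e ∧ b ≠ f := fun hb hbv =>
      ⟨fun h => hb (h ▸ he), fun h => hf.elim (fun hf => hb (h ▸ hf)) fun hf => hf (h ▸ hbv)⟩
    have h2 := h1 hm.2.1 hm.2.2
    exact .head ⟨hm.1, hie.1, hie.2, h2.1, h2.2⟩ (ih h2)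

theorem mem_of_reachable (hB : B ⊆ D) (h : (fundGraph D B A).Reachable u v) (huv : u ≠ v) :
    u ∈ D := by
  obtain ⟨w, hw, -⟩ := exists_closer h huv
  rcases Meets.side hw with h | h
  · exact hB h.1
  · exact (Finset.mem_sdiff.1 h.1).1

theorem finite_reachable (hB : B ⊆ D) : {u | (fundGraph D B A).Reachable u v}.Finite := by
  refine ((insert v D).finite_toSet).subset fun u hu => ?_
  by_cases huv : u = v
  · simp [huv]
  · simp [mem_of_reachable hB hu huv]

theorem exists_removable_of_three (hB : B ⊆ D) (ha : Meets D B A v a) (hb : Meets D B A v b)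
    (hc : Meets D B A v c) (hab : a ≠ b) (hac : a ≠ c) (hbc : b ≠ c) :
    ∃ e f, Removable D B A e f := by
  obtain ⟨S, hS, ⟨l, hl, hlS⟩, hpath⟩ := exists_leaves (finite_reachable (A := A) (v := v) hB)
  have key : ∀ {a b}, Meets D B A v a → Meets D B A v b → a ≠ b →
      (l a ∈ B ∧ l b ∈ B ∨ l a ∈ D \ B ∧ l b ∈ D \ B) → ∃ e f, Removable D B A e f :=
    fun {a b} ha hb hab hs => ⟨l a, l b, removable_of_path (fun h => hab (hl ha hb h)) hs
      (hlS a ha) (hS _ (hlS a ha)).2 (Or.inl (hlS b hb)) hpath⟩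
  have hD : ∀ {a}, Meets D B A v a → l a ∈ B ∨ l a ∈ D \ B := fun {a} ha => by
    have := hS _ (hlS a ha)
    have := mem_of_reachable hB this.2 this.1
    by_cases h : l a ∈ B <;> simp [h, this]
  rcases hD ha with h1 | h1 <;> rcases hD hb with h2 | h2 <;> rcases hD hc with h3 | h3
  all_goals first
    | exact key ha hb hab (.inl ⟨h1, h2⟩)
    | exact key ha hb hab (.inr ⟨h1, h2⟩)
    | exact key ha hc hac (.inl ⟨h1, h3⟩)
    | exact key ha hc hac (.inr ⟨h1, h3⟩)
    | exact key hb hc hbc (.inl ⟨h2, h3⟩)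
    | exact key hb hc hbc (.inr ⟨h2, h3⟩)

theorem exists_removable_of_not_reachable (hB : B ⊆ D) (ha : Meets D B A v a)
    (hb : Meets D B A u b) (h : ¬ (fundGraph D B A).Reachable u v) :
    ∃ e f, Removable D B A e f := by
  obtain ⟨S, hS, ⟨l, hl, hlS⟩, hpath⟩ := exists_leaves (finite_reachable (A := A) (v := v) hB)
  have hla := hS _ (hlS a ha)
  have hD := mem_of_reachable hB hla.2 hla.1
  have key : ∀ f, ¬ (fundGraph D B A).Reachable f v →
      (l a ∈ B ∧ f ∈ B ∨ l a ∈ D \ B ∧ f ∈ D \ B) → ∃ e f, Removable D B A e f :=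
    fun f hf hs => ⟨l a, f, removable_of_path (fun h => hf (h ▸ hla.2)) hs (hlS a ha) hla.2
      (Or.inr hf) hpath⟩
  have hb' : ¬ (fundGraph D B A).Reachable b v := fun h' =>
    h ((SimpleGraph.Adj.reachable (G := fundGraph D B A) hb).trans h')
  by_cases hlB : l a ∈ B <;> rcases hb.side with hs | hs
  · exact key u h (Or.inl ⟨hlB, hs.1⟩)
  · exact key b hb' (Or.inl ⟨hlB, hs.2⟩)
  · exact key b hb' (Or.inr ⟨by simp [hD, hlB], hs.2⟩)
  · exact key u h (Or.inr ⟨by simp [hD, hlB], hs.1⟩)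

theorem removable_of_subsingleton (hef : e ≠ f)
    (side : (e ∈ B ∧ f ∈ B) ∨ (e ∈ D \ B ∧ f ∈ D \ B))
    (h : ∀ i j, Meets D B A i e → Meets D B A j e → i = j) : Removable D B A e f := by
  refine ⟨hef, side, ?_⟩
  by_cases hz : ∃ z, Meets D B A z e
  · obtain ⟨z, hz⟩ := hz
    exact ⟨z, fun i hi => h i z hi hz ▸ .refl⟩
  · exact ⟨e, fun i hi => absurd ⟨i, hi⟩ hz⟩

theorem IsFrame.exists_removable (hA : IsFrame D U B A) (hcard : 3 ≤ B.card ∨ 3 ≤ (D \ B).card) :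
    ∃ B A, IsFrame D U B A ∧ ∃ e f, Removable D B A e f := by
  by_contra! hno
  have no := fun e f => hno B A hA e f
  have hB := hA.1
  have two : ∀ e f, e ≠ f → (e ∈ B ∧ f ∈ B) ∨ (e ∈ D \ B ∧ f ∈ D \ B) →
      ∃ i j, i ≠ j ∧ Meets D B A i e ∧ Meets D B A j e := by
    intro e f hef hs
    by_contra! h
    exact no e f (removable_of_subsingleton hef hs fun i j hi hj => by
      by_contra hij; exact h i j hij hi hj)
  have other : ∀ {S : Finset E}, 2 ≤ S.card → ∀ e, ∃ f ∈ S, e ≠ f := fun {S} hS e => by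
    obtain ⟨f, hf, hfe⟩ := Finset.exists_mem_ne (show 1 < S.card by omega) e
    exact ⟨f, hf, hfe.symm⟩
  have hcards : 2 ≤ B.card ∧ 2 ≤ (D \ B).card := by
    have gen : ∀ {S T : Finset E}, 3 ≤ S.card → (∀ e ∈ S, ∀ f ∈ S, e ≠ f →
        ∃ i ∈ T, ∃ j ∈ T, i ≠ j) → 2 ≤ T.card := by
      intro S T hS h
      obtain ⟨e, he, f, hf, hef⟩ := Finset.one_lt_card.1 (show 1 < S.card by omega)
      obtain ⟨i, hi, j, hj, hij⟩ := h e he f hf hef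
      exact Finset.one_lt_card.2 ⟨i, hi, j, hj, hij⟩
    rcases hcard with h | h
    · refine ⟨by omega, gen h fun e he f hf hef => ?_⟩
      obtain ⟨i, j, hij, hi, hj⟩ := two e f hef (Or.inl ⟨he, hf⟩)
      have h1 := hi.side
      have h2 := hj.side
      simp only [Finset.mem_sdiff, he, not_true, and_false, false_or, and_true] at h1 h2
      exact ⟨i, Finset.mem_sdiff.2 h1, j, Finset.mem_sdiff.2 h2, hij⟩
    · refine ⟨gen h fun e he f hf hef => ?_, by omega⟩
      obtain ⟨i, j, hij, hi, hj⟩ := two e f hef (Or.inr ⟨he, hf⟩)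
      have h1 := hi.side
      have h2 := hj.side
      have he' := (Finset.mem_sdiff.1 he).2
      simp only [he', and_false, or_false] at h1 h2
      exact ⟨i, h1.1, j, h2.1, hij⟩
  have deg : ∀ e ∈ D, ∃ i j, i ≠ j ∧ Meets D B A e i ∧ Meets D B A e j := by
    intro e he
    have : ∃ i j, i ≠ j ∧ Meets D B A i e ∧ Meets D B A j e := by
      by_cases heB : e ∈ B
      · obtain ⟨f, hf, hef⟩ := other hcards.1 e
        exact two e f hef (Or.inl ⟨heB, hf⟩)
      · obtain ⟨f, hf, hef⟩ := other hcards.2 e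
        exact two e f hef (Or.inr ⟨by simp [he, heB], hf⟩)
    obtain ⟨i, j, hij, hi, hj⟩ := this
    exact ⟨i, j, hij, hi.symm, hj.symm⟩
  have le_two : ∀ {v a b c}, Meets D B A v a → Meets D B A v b → a ≠ b → Meets D B A v c →
      c = a ∨ c = b := by
    intro v a b c ha hb hab hc
    by_contra! h
    obtain ⟨e, f, hef⟩ := exists_removable_of_three hB ha hb hc hab h.1.symm h.2.symm
    exact no e f hef
  obtain ⟨x, hx⟩ : B.Nonempty := Finset.card_pos.1 (by omega)
  obtain ⟨y, y₂, hyy, hy, hy₂⟩ := deg x (hB hx)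
  have adj : ∀ {x y}, x ∈ B → Meets D B A x y → y ∈ D \ B ∧ A x y ≠ 0 := by
    intro x y hx h
    rcases h with h | h
    · exact h.2
    · exact absurd hx (Finset.mem_sdiff.1 h.2.1).2
  obtain ⟨hyD, hxy⟩ := adj hx hy
  obtain ⟨hy₂D, hxy₂⟩ := adj hx hy₂
  obtain ⟨x₂, hxx, hx₂⟩ : ∃ x₂, x₂ ≠ x ∧ Meets D B A y x₂ := by
    obtain ⟨i, j, hij, hi, hj⟩ := deg y (Finset.mem_sdiff.1 hyD).1
    by_cases h : i = x
    · exact ⟨j, fun h' => hij (h.trans h'.symm), hj⟩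
    · exact ⟨i, h, hi⟩
  have hx₂B : x₂ ∈ B := by
    rcases hx₂.side with h | h
    · exact absurd h.1 (Finset.mem_sdiff.1 hyD).2
    · exact h.2
  have hx₂y := (adj hx₂B hx₂.symm).2
  by_cases hsq : Meets D B A x₂ y₂
  · have closed : ∀ u, (fundGraph D B A).Reachable x u → u = x ∨ u = x₂ ∨ u = y ∨ u = y₂ := by
      intro u hu
      rw [SimpleGraph.reachable_iff_reflTransGen] at hu
      induction hu with
      | refl => simp
      | tail _ hm ih =>
        rcases ih with rfl | rfl | rfl | rfl
        · rcases le_two hy hy₂ hyy hm with h | h <;> simp [h]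
        · rcases le_two hx₂.symm hsq hyy hm with h | h <;> simp [h]
        · rcases le_two hy.symm hx₂ hxx.symm hm with h | h <;> simp [h]
        · rcases le_two hy₂.symm hsq.symm hxx.symm hm with h | h <;> simp [h]
    have all : ∀ u ∈ D, u = x ∨ u = x₂ ∨ u = y ∨ u = y₂ := by
      intro u hu
      by_contra h
      obtain ⟨i, j, -, hi, -⟩ := deg u hu
      obtain ⟨e, f, hef⟩ := exists_removable_of_not_reachable hB hy hi
        fun h' => h (closed u h'.symm)
      exact no e f hef
    have hBs : B ⊆ {x, x₂} := fun u hu => by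
      rcases all u (hB hu) with rfl | rfl | rfl | rfl
      · simp
      · simp
      · exact absurd hu (Finset.mem_sdiff.1 hyD).2
      · exact absurd hu (Finset.mem_sdiff.1 hy₂D).2
    have hDs : D \ B ⊆ {y, y₂} := fun u hu => by
      rw [Finset.mem_sdiff] at hu
      rcases all u hu.1 with rfl | rfl | rfl | rfl
      · exact absurd hx hu.2
      · exact absurd hx₂B hu.2
      · simp
      · simp
    have := (Finset.card_le_card hBs).trans Finset.card_le_two
    have := (Finset.card_le_card hDs).trans Finset.card_le_two
    omega
  · obtain ⟨y₃, hy₃y, hy₃⟩ : ∃ y₃, y₃ ≠ y ∧ Meets D B A x₂ y₃ := by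
      obtain ⟨i, j, hij, hi, hj⟩ := deg x₂ (hB hx₂B)
      by_cases h : i = y
      · exact ⟨j, fun h' => hij (h.trans h'.symm), hj⟩
      · exact ⟨i, h, hi⟩
    have hy₃₂ : y₃ ≠ y₂ := fun h => hsq (h ▸ hy₃)
    obtain ⟨hy₃D, hx₂y₃⟩ := adj hx₂B hy₃
    have h0 : A x₂ y₂ = 0 := by
      by_contra h
      exact hsq (Or.inl ⟨hx₂B, hy₂D, h⟩)
    have h1 : A x y₃ = 0 := by
      by_contra h
      rcases le_two hy hy₂ hyy (Or.inl ⟨hx, hy₃D, h⟩) with h | h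
      · exact hy₃y h
      · exact hy₃₂ h
    have hp := hA.pivot hx hyD hxy
    have hr := mem_exchange (y := y) hx₂B hxx
    have hi := ne_of_mem_sdiff hx₂B hyD
    have n2 := (ne_of_mem_sdiff hx hy₂D).symm
    have n3 := (ne_of_mem_sdiff hx hy₃D).symm
    obtain ⟨e, f, hef⟩ := exists_removable_of_three (A := Paper.pivot A x y)
      (v := x₂) (a := x) (b := y₂) (c := y₃) hp.1
      (Or.inl ⟨hr, mem_sdiff_exchange_self hB hx hyD, by
        rw [pivot_col _ hi]; simp [hxy, hx₂y]⟩)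
      (Or.inl ⟨hr, mem_sdiff_exchange hy₂D hyy.symm, by
        rw [pivot_of_ne _ hi n2, h0]; simp [hxy, hx₂y, hxy₂]⟩)
      (Or.inl ⟨hr, mem_sdiff_exchange hy₃D hy₃y, by
        rw [pivot_of_ne _ hi n3, h1]; simpa using hx₂y₃⟩)
      n2.symm n3.symm hy₃₂.symm
    exact hno _ _ hp e f hef

end Selection

section Main

variable {E : Type*} [DecidableEq E] {F K : Type*} [Field F] [Field K] [CharP F 2]
  {D B : Finset E} {U₃ : Set (E → ZMod 3)} {U : Set (E → F)} {A : E → E → F} {L : F → K} {e f : E}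

theorem hasUniqueGood_of_removable (hL : IsLift L) (hS : SameFrames D U₃ U)
    (ih : ∀ D' : Finset E, D'.card < D.card → ∀ (U₃ : Set (E → ZMod 3)) (U : Set (E → F)),
      SameFrames D' U₃ U → HasUniqueGood L D' U)
    (hA : IsFrame D U B A) (h : Removable D B A e f) (he : e ∈ D \ B) (hf : f ∈ D \ B) :
    HasUniqueGood L D U := by
  obtain ⟨A₃, h₃⟩ := (hS.iff B).2 hA.hasFrame
  have he' := Finset.mem_sdiff.1 he
  have hf' := Finset.mem_sdiff.1 hf
  have c1 := Finset.card_erase_lt_of_mem he'.1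
  have c2 := Finset.card_erase_lt_of_mem hf'.1
  have c3 : ((D.erase e).erase f).card < D.card := (Finset.card_erase_le).trans_lt c1
  have sub : (D.erase e).erase f ⊆ D := (Finset.erase_subset _ _).trans (Finset.erase_subset _ _)
  have hBe : B ⊆ D.erase e := Finset.subset_erase.2 ⟨hA.1, he'.2⟩
  have hBf : B ⊆ D.erase f := Finset.subset_erase.2 ⟨hA.1, hf'.2⟩
  obtain ⟨z, hz⟩ := h.joined
  exact hasUniqueGood_of_clustered hL hS hA he'.1 hf'.1 h.ne he'.2 hf'.2
    ⟨z, fun i hi hie => hz i (Or.inl ⟨hi, he, hie⟩)⟩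
    (ih _ c1 _ _ (hS.restrict h₃ (Finset.erase_subset _ _) hBe))
    (ih _ c2 _ _ (hS.restrict h₃ (Finset.erase_subset _ _) hBf))
    (ih _ c3 _ _ (hS.restrict h₃ sub (Finset.subset_erase.2 ⟨hBe, hf'.2⟩)))

theorem Removable.perp (h : Removable D B A e f) (hB : B ⊆ D) :
    Removable D (D \ B) (fun c b => -A b c) e f := by
  have hBB := Finset.sdiff_sdiff_eq_self hB
  have hm : ∀ u v, Meets D (D \ B) (fun c b => -A b c) u v ↔ Meets D B A u v := fun u v => by
    simp only [Meets, hBB, ne_eq, neg_eq_zero]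
    tauto
  refine ⟨h.ne, by rw [hBB]; exact h.side.symm, ?_⟩
  have ho : MeetsOff D (D \ B) (fun c b => -A b c) e f = MeetsOff D B A e f := by
    ext u v
    simp only [MeetsOff, hm]
  simp only [hm, ho]
  exact h.joined

/-- A configuration over a field of characteristic two with the same bases as a ternary one has
a good lift, unique up to scaling. -/
theorem SameFrames.hasUniqueGood (hL : IsLift L) (hS : SameFrames D U₃ U) :
    HasUniqueGood L D U := by
  induction hn : D.card using Nat.strong_induction_on generalizing D U₃ U with
  | _ n ih =>
    have ih' : ∀ D' : Finset E, D'.card < D.card → ∀ (U₃ : Set (E → ZMod 3)) (U : Set (E → F)),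
      SameFrames D' U₃ U → HasUniqueGood L D' U := fun D' h U₃ U hS => ih _ (hn ▸ h) hS rfl
    obtain ⟨B, A₃, A, hA₃, hA⟩ := hS.exists_pair
    by_cases hc : B.card ≤ 2 ∧ (D \ B).card ≤ 2
    · exact hasUniqueGood_of_card_le hL hA hc.1 hc.2
    obtain ⟨B, A, hA, e, f, h⟩ := hA.exists_removable (by omega)
    rcases h.side with ⟨he, hf⟩ | ⟨he, hf⟩
    · refine .of_perp hA.hasFrame (hasUniqueGood_of_removable hL hS.perp ih' hA.perp
        (h.perp hA.1) ?_ ?_) <;>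
      rwa [Finset.sdiff_sdiff_eq_self hA.1]
    · exact hasUniqueGood_of_removable hL hS ih' hA h he hf

end Main

section Lift

variable {F K : Type*} [Field F] [Field K]

/-- The six values of a cross-ratio under permutations of its arguments. -/
def orb (x : K) : Fin 6 → K := ![x, 1 - x, x⁻¹, 1 - x⁻¹, (1 - x)⁻¹, 1 - (1 - x)⁻¹]

theorem one_sub_orb (x : K) (i : Fin 6) : 1 - orb x i = orb x (![1, 0, 3, 2, 5, 4] i) := by
  fin_cases i <;> simp [orb]

theorem inv_one_sub_inv {x : K} (h0 : x ≠ 0) (h1 : x ≠ 1) : (1 - x⁻¹)⁻¹ = 1 - (1 - x)⁻¹ := by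
  have h2 : 1 - x ≠ 0 := sub_ne_zero.2 h1.symm
  have h3 : x - 1 ≠ 0 := sub_ne_zero.2 h1
  have h4 : 1 - x⁻¹ = (x - 1) / x := by field_simp
  rw [h4, inv_div]
  field_simp
  ring

theorem inv_orb {x : K} (h0 : x ≠ 0) (h1 : x ≠ 1) (i : Fin 6) :
    (orb x i)⁻¹ = orb x (![2, 4, 0, 5, 1, 3] i) := by
  have := inv_one_sub_inv h0 h1
  have h5 : (1 - (1 - x)⁻¹)⁻¹ = 1 - x⁻¹ := by rw [← this, inv_inv]
  fin_cases i <;> simp [orb, this, h5]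

theorem orb_ne_zero {x : K} (h0 : x ≠ 0) (h1 : x ≠ 1) (i : Fin 6) : orb x i ≠ 0 := by
  have h2 : 1 - x ≠ 0 := sub_ne_zero.2 h1.symm
  have h3 : 1 - x⁻¹ ≠ 0 := sub_ne_zero.2 fun h => h1 (inv_eq_one.1 h.symm)
  have h4 : 1 - (1 - x)⁻¹ ≠ 0 := by
    rw [← inv_one_sub_inv h0 h1]
    exact inv_ne_zero h3
  fin_cases i <;> simp [orb, h0, h2, h3, h4]

theorem orb_ne_one {x : K} (h0 : x ≠ 0) (h1 : x ≠ 1) (i : Fin 6) : orb x i ≠ 1 := fun h =>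
  orb_ne_zero h0 h1 _ ((one_sub_orb x i).symm.trans (sub_eq_zero.2 h.symm))

theorem range_orb_one_sub (x : K) : Set.range (orb (1 - x)) = Set.range (orb x) := by
  ext z
  simp only [orb, Matrix.range_cons, Matrix.range_empty, sub_sub_cancel]
  simp only [Set.mem_union, Set.mem_singleton_iff, Set.mem_empty_iff_false]
  tauto

theorem range_orb_inv {x : K} (h0 : x ≠ 0) (h1 : x ≠ 1) :
    Set.range (orb x⁻¹) = Set.range (orb x) := by
  ext z
  simp only [orb, Matrix.range_cons, Matrix.range_empty, inv_inv, inv_one_sub_inv h0 h1,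
    sub_sub_cancel]
  simp only [Set.mem_union, Set.mem_singleton_iff, Set.mem_empty_iff_false]
  tauto

theorem range_orb_orb {x : K} (h0 : x ≠ 0) (h1 : x ≠ 1) (i : Fin 6) :
    Set.range (orb (orb x i)) = Set.range (orb x) := by
  have e2 : 1 - x ≠ 0 := sub_ne_zero.2 h1.symm
  have e3 : 1 - x ≠ 1 := fun h => h0 (by linear_combination -h)
  fin_cases i
  · rfl
  · exact range_orb_one_sub x
  · exact range_orb_inv h0 h1
  · exact (range_orb_one_sub _).trans (range_orb_inv h0 h1)
  · exact (range_orb_inv e2 e3).trans (range_orb_one_sub x)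
  · exact (range_orb_one_sub _).trans ((range_orb_inv e2 e3).trans (range_orb_one_sub x))

theorem orb_injective [CharP F 2] (hF : ∀ y : F, y ^ 2 + y + 1 ≠ 0) {x : F} (h0 : x ≠ 0)
    (h1 : x ≠ 1) : Function.Injective (orb x) := by
  have h2 : (2 : F) = 0 := CharTwo.two_eq_zero
  have h3 := hF x
  have h4 : 1 - x ≠ 0 := sub_ne_zero.2 h1.symm
  intro i j hij
  fin_cases i <;> fin_cases j <;> simp [orb] at hij ⊢ <;> grind

theorem exists_isLift [CharP F 2] (hF : ∀ y : F, y ^ 2 + y + 1 ≠ 0) {a : K} (ha0 : a ≠ 0)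
    (ha1 : a ≠ 1) : ∃ L : F → K, IsLift L := by
  classical
  let rep : F → F := fun p => Classical.epsilon (· ∈ Set.range (orb p))
  have hrep : ∀ p, rep p ∈ Set.range (orb p) := fun p =>
    Classical.epsilon_spec (p := (· ∈ Set.range (orb p))) ⟨_, 0, rfl⟩
  have hrep0 : ∀ {p}, p ≠ 0 → p ≠ 1 → rep p ≠ 0 ∧ rep p ≠ 1 := by
    intro p h0 h1
    obtain ⟨i, hi⟩ := hrep p
    rw [← hi]
    exact ⟨orb_ne_zero h0 h1 i, orb_ne_one h0 h1 i⟩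
  have hidx : ∀ p, ∃ i, p ≠ 0 → p ≠ 1 → orb (rep p) i = p := by
    intro p
    by_cases h : p ≠ 0 ∧ p ≠ 1
    · obtain ⟨i, hi⟩ := hrep p
      have : p ∈ Set.range (orb (rep p)) := by
        rw [← hi, range_orb_orb h.1 h.2]
        exact ⟨0, rfl⟩
      obtain ⟨j, hj⟩ := this
      exact ⟨j, fun _ _ => hj⟩
    · exact ⟨0, fun h0 h1 => absurd ⟨h0, h1⟩ h⟩
  choose idx hidx using hidx
  have huniq : ∀ {p i}, p ≠ 0 → p ≠ 1 → orb (rep p) i = p → idx p = i := fun {p i} h0 h1 h =>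
    orb_injective hF (hrep0 h0 h1).1 (hrep0 h0 h1).2 ((hidx p h0 h1).trans h.symm)
  refine ⟨fun p => if p = 0 then 0 else if p = 1 then 1 else orb a (idx p), by simp, by simp,
    fun p => ?_, fun p => ?_, fun p hp => ?_⟩
  · by_cases h0 : p = 0
    · simp [h0]
    by_cases h1 : p = 1
    · simp [h1]
    have e0 : 1 - p ≠ 0 := sub_ne_zero.2 (Ne.symm h1)
    have e1 : 1 - p ≠ 1 := fun h => h0 (by linear_combination -h)
    simp only [h0, h1, e0, e1, if_false, one_sub_orb]
    congr 1
    refine huniq e0 e1 ?_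
    have : rep (1 - p) = rep p := by simp only [rep, range_orb_one_sub]
    rw [this, ← one_sub_orb, hidx p h0 h1]
  · by_cases h0 : p = 0
    · simp [h0]
    by_cases h1 : p = 1
    · simp [h1]
    have e0 : p⁻¹ ≠ 0 := inv_ne_zero h0
    have e1 : p⁻¹ ≠ 1 := fun h => h1 (inv_eq_one.1 h)
    simp only [h0, h1, e0, e1, if_false, inv_orb ha0 ha1]
    congr 1
    refine huniq e0 e1 ?_
    have : rep p⁻¹ = rep p := by simp only [rep, range_orb_inv h0 h1]
    rw [this, ← inv_orb (hrep0 h0 h1).1 (hrep0 h0 h1).2, hidx p h0 h1]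
  · by_contra h0
    by_cases h1 : p = 1
    · simp [h1] at hp
    · simp [h0, h1, orb_ne_zero ha0 ha1] at hp

theorem galoisField_no_root {r : ℕ} (hodd : Odd r) (y : GaloisField 2 r) : y ^ 2 + y + 1 ≠ 0 := by
  intro h
  have hr : r ≠ 0 := by rintro rfl; simp at hodd
  have h2 : (2 : GaloisField 2 r) = 0 := CharTwo.two_eq_zero
  have h3 : y ^ 3 = 1 := by linear_combination (y - 1) * h
  have hy0 : y ≠ 0 := by rintro rfl; simp at h
  have hy1 : y ≠ 1 := by
    rintro rfl
    exact one_ne_zero (α := GaloisField 2 r) (by linear_combination h - h2)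
  have hord : orderOf y = 3 := orderOf_eq_prime h3 hy1
  have hcard := GaloisField.card 2 r hr
  have hfin : Finite (GaloisField 2 r) := inferInstance
  have := Fintype.ofFinite (GaloisField 2 r)
  have hp : y ^ (2 ^ r - 1) = 1 := by
    rw [← hcard, Nat.card_eq_fintype_card]
    exact FiniteField.pow_card_sub_one_eq_one y hy0
  have hd := orderOf_dvd_of_pow_eq_one hp
  rw [hord] at hd
  obtain ⟨k, rfl⟩ := hodd
  have h5 : 2 ^ (2 * k + 1) % 3 = 2 := by
    rw [pow_succ, pow_mul, Nat.mul_mod, Nat.pow_mod]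
    simp
  have h6 : 1 ≤ 2 ^ (2 * k + 1) := Nat.one_le_two_pow
  generalize 2 ^ (2 * k + 1) = m at *
  omega

end Lift

section RowSpace

variable {E : Type*} [DecidableEq E] {F K : Type*} [Field F] [Field K]
  {V W : Type*} [AddCommGroup V] [Module F V] [AddCommGroup W] [Module K W]

/-- The row space of the vectors `φ e` on the ground set `D`. -/
def rowSpace (F : Type*) [Field F] {V : Type*} [AddCommGroup V] [Module F V] (D : Finset E)
    (φ : E → V) : Set (E → F) :=
  {u | ∃ f : V →ₗ[F] F, ∀ e ∈ D, u e = f (φ e)}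

variable {D D' B : Finset E} {φ : E → V} {ψ : E → W} {A : E → E → F}

theorem isFrame_rowSpace_iff : IsFrame D (rowSpace F D φ) B A ↔
    B ⊆ D ∧ LinearIndepOn F φ B ∧ ∀ c ∈ D \ B, φ c = ∑ b ∈ B, A b c • φ b := by
  constructor
  · refine fun h => ⟨h.1, linearIndepOn_finset_iff.2 fun g hg x hx => ?_, fun c hc => ?_⟩
    · obtain ⟨u, ⟨f, hf⟩, h1, h0, -⟩ := h.exists_single hx
      have := congrArg f hg
      rw [map_sum, map_zero, Finset.sum_eq_single x] at this
      · rwa [map_smul, ← hf x (h.1 hx), h1, smul_eq_mul, mul_one] at this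
      · intro b hb hbx
        rw [map_smul, ← hf b (h.1 hb), h0 b hb hbx, smul_zero]
      · exact fun hx' => absurd hx hx'
    · rw [← sub_eq_zero, ← Module.forall_dual_apply_eq_zero_iff F]
      intro f
      have := (h.2 fun e => f (φ e)).1 ⟨f, fun _ _ => rfl⟩ c hc
      simp [this]
  · rintro ⟨hB, hli, hA⟩
    refine ⟨hB, fun u => ⟨?_, fun hu => ?_⟩⟩
    · rintro ⟨f, hf⟩ c hc
      rw [hf c (Finset.mem_sdiff.1 hc).1, hA c hc, map_sum]
      exact Finset.sum_congr rfl fun b hb => by rw [map_smul, hf b (hB hb), smul_eq_mul]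
    · obtain ⟨f, hf⟩ := LinearMap.exists_extend
        ((Module.Basis.span hli.linearIndependent).constr F fun b : (B : Set E) => u b)
      have key : ∀ b ∈ B, f (φ b) = u b := by
        intro b hb
        have h1 := (Module.Basis.span hli.linearIndependent).constr_basis F
          (fun b : (B : Set E) => u b) ⟨b, hb⟩
        rw [← hf, LinearMap.comp_apply] at h1
        rw [← h1, Submodule.subtype_apply, Module.Basis.span_apply]
      refine ⟨f, fun e he => ?_⟩
      by_cases heB : e ∈ B
      · exact (key e heB).symm
      · have he' := Finset.mem_sdiff.2 ⟨he, heB⟩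
        rw [hu e he', hA e he', map_sum]
        exact Finset.sum_congr rfl fun b hb => by rw [map_smul, key b hb, smul_eq_mul]

theorem hasFrame_rowSpace_iff : HasFrame D (rowSpace F D φ) B ↔
    B ⊆ D ∧ LinearIndepOn F φ B ∧ ∀ c ∈ D \ B, ¬ LinearIndepOn F φ ↑(insert c B) := by
  have key : ∀ c ∉ B, LinearIndepOn F φ (B : Set E) →
      (¬ LinearIndepOn F φ ↑(insert c B) ↔ ∃ a : E → F, ∑ b ∈ B, a b • φ b = φ c) := by
    intro c hc hB
    rw [Finset.coe_insert, linearIndepOn_insert (by simpa using hc)]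
    simp only [hB, true_and, not_not]
    exact Submodule.mem_span_image_finset_iff_exists_fun' F
  constructor
  · rintro ⟨A, hA⟩
    obtain ⟨hBD, hB, h⟩ := isFrame_rowSpace_iff.1 hA
    exact ⟨hBD, hB, fun c hc =>
      (key c (Finset.mem_sdiff.1 hc).2 hB).2 ⟨fun b => A b c, (h c hc).symm⟩⟩
  · rintro ⟨hBD, hB, h⟩
    have : ∀ c, ∃ a : E → F, c ∈ D \ B → φ c = ∑ b ∈ B, a b • φ b := by
      intro c
      by_cases hc : c ∈ D \ B
      · obtain ⟨a, ha⟩ := (key c (Finset.mem_sdiff.1 hc).2 hB).1 (h c hc)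
        exact ⟨a, fun _ => ha.symm⟩
      · exact ⟨0, fun h => absurd h hc⟩
    choose a ha using this
    exact ⟨fun b c => a c b, isFrame_rowSpace_iff.2 ⟨hBD, hB, ha⟩⟩

theorem exists_hasFrame_rowSpace {I : Finset E} (hI : LinearIndepOn F φ I) (hID : I ⊆ D) :
    ∃ B, I ⊆ B ∧ HasFrame D (rowSpace F D φ) B := by
  obtain ⟨b, hbD, hIb, hD, hb⟩ := exists_linearIndepOn_extension hI (Finset.coe_subset.2 hID)
  lift b to Finset E using D.finite_toSet.subset hbD
  refine ⟨b, Finset.coe_subset.1 hIb, hasFrame_rowSpace_iff.2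
    ⟨Finset.coe_subset.1 hbD, hb, fun c hc h => ?_⟩⟩
  rw [Finset.mem_sdiff] at hc
  rw [Finset.coe_insert, linearIndepOn_insert (by simpa using hc.2)] at h
  exact h.2 (hD ⟨c, hc.1, rfl⟩)

theorem sameFrames_rowSpace (h : ∀ I : Finset E, LinearIndepOn F φ I ↔ LinearIndepOn K ψ I)
    (D : Finset E) : SameFrames D (rowSpace F D φ) (rowSpace K D ψ) := by
  refine ⟨?_, fun B => by simp only [hasFrame_rowSpace_iff, h]⟩
  obtain ⟨B, -, hB⟩ := exists_hasFrame_rowSpace (F := F) (φ := φ) (I := ∅) (by simp)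
    (Finset.empty_subset D)
  exact ⟨B, hB⟩

theorem linearIndepOn_iff_of_sameFrames {I : Finset E} (hI : I ⊆ D)
    (h : SameFrames D (rowSpace F D φ) (rowSpace K D ψ)) :
    LinearIndepOn F φ I ↔ LinearIndepOn K ψ I := by
  constructor <;> intro hli
  · obtain ⟨B, hIB, hB⟩ := exists_hasFrame_rowSpace hli hI
    exact (hasFrame_rowSpace_iff.1 ((h.iff B).1 hB)).2.1.mono (by simpa using hIB)
  · obtain ⟨B, hIB, hB⟩ := exists_hasFrame_rowSpace hli hI
    exact (hasFrame_rowSpace_iff.1 ((h.iff B).2 hB)).2.1.mono (by simpa using hIB)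

end RowSpace

section Glue

variable {E : Type*} {K : Type*} [Field K]

/-- The product of the entries of the matrix along a walk in the bipartite graph of its support,
where `B₀` is the set of row indices. -/
noncomputable def walkWeight (B₀ : Set E) (A : E → E → K) {G : SimpleGraph E} :
    {x y : E} → G.Walk x y → K
  | _, _, .nil => 1
  | x, _, .cons (v := z) _ p =>
    open Classical in (if x ∈ B₀ then A x z else (A z x)⁻¹) * walkWeight B₀ A p

/-- The bipartite graph of the support of a matrix with row indices `B₀`. -/
def supportGraph {F : Type*} [Field F] (B₀ : Set E) (A : E → E → F) : SimpleGraph E where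
  Adj x y := (x ∈ B₀ ∧ y ∉ B₀ ∧ A x y ≠ 0) ∨ (y ∈ B₀ ∧ x ∉ B₀ ∧ A y x ≠ 0)
  symm := ⟨fun _ _ h => h.symm⟩
  loopless := ⟨fun _ h => h.elim (fun h => h.2.1 h.1) (fun h => h.2.1 h.1)⟩

/-- A walk to the vertex `v` from a fixed representative of its component. -/
noncomputable def rootWalk (G : SimpleGraph E) (v : E) :
    G.Walk (Quot.out (G.connectedComponentMk v)) v :=
  (SimpleGraph.ConnectedComponent.exact (Quot.out_eq (G.connectedComponentMk v))).some

variable {F : Type*} [Field F] {B₀ D : Set E} {A₀ : E → E → F} {A A' : E → E → K} {x y : E}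

theorem walkWeight_ne_zero (hA : ∀ b ∈ D, ∀ c ∈ D, b ∈ B₀ → c ∉ B₀ → A₀ b c ≠ 0 → A b c ≠ 0)
    (p : (supportGraph B₀ A₀).Walk x y) (hp : ∀ z ∈ p.support, z ∈ D) :
    walkWeight B₀ A p ≠ 0 := by
  induction p with
  | nil => simp [walkWeight]
  | @cons x z y h p ih =>
    simp only [SimpleGraph.Walk.support_cons, List.mem_cons, forall_eq_or_imp] at hp
    have hz := hp.2 z p.start_mem_support
    refine mul_ne_zero ?_ (ih hp.2)
    rcases h with ⟨h1, h2, h3⟩ | ⟨h1, h2, h3⟩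
    · rw [if_pos h1]
      exact hA x hp.1 z hz h1 h2 h3
    · rw [if_neg h2]
      exact inv_ne_zero (hA z hz x hp.1 h1 h2 h3)

theorem walkWeight_scale {g : E → K} (hg : ∀ e, g e ≠ 0)
    (hA : ∀ b ∈ D, ∀ c ∈ D, b ∈ B₀ → c ∉ B₀ → A' b c = (g c)⁻¹ * A b c * g b)
    (p : (supportGraph B₀ A₀).Walk x y) (hp : ∀ z ∈ p.support, z ∈ D) :
    walkWeight B₀ A' p = g x * walkWeight B₀ A p * (g y)⁻¹ := by
  induction p with
  | nil => simp [walkWeight, hg]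
  | @cons x z y h p ih =>
    simp only [SimpleGraph.Walk.support_cons, List.mem_cons, forall_eq_or_imp] at hp
    have hz := hp.2 z p.start_mem_support
    have := hg x; have := hg y; have := hg z
    rw [walkWeight, walkWeight, ih hp.2]
    rcases h with ⟨h1, h2, h3⟩ | ⟨h1, h2, h3⟩
    · rw [if_pos h1, if_pos h1, hA x hp.1 z hz h1 h2]
      field_simp
    · rw [if_neg h2, if_neg h2, hA z hz x hp.1 h1 h2, mul_inv, mul_inv, inv_inv]
      field_simp

end Glue

section Assembly

/-- The elements of a finite set and the supports of their columns. -/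
def columnClosure {E F : Type*} [DecidableEq E] [Field F] (a : E → E →₀ F) (D : Finset E) :
    Finset E :=
  D ∪ D.biUnion fun c => (a c).support

/-- The column supports of the elements of `D` outside `B₀` lie in `D`. -/
def ColumnClosed {E F : Type*} [Field F] (B₀ : Set E) (a : E → E →₀ F) (D : Finset E) : Prop :=
  ∀ c ∈ D, c ∉ B₀ → (a c).support ⊆ D

variable {E : Type*} [DecidableEq E] {F K : Type*} [Field F] [Field K]
  {V : Type*} [AddCommGroup V] [Module F V]
  {D D' : Finset E} {φ : E → V} {B₀ : Set E} {a : E → E →₀ F} {L : F → K}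

theorem subset_columnClosure : D ⊆ columnClosure a D := by
  exact Finset.subset_union_left

theorem columnClosure_mono (h : D ⊆ D') : columnClosure a D ⊆ columnClosure a D' := by
  exact Finset.union_subset_union h (Finset.biUnion_subset_biUnion_of_subset_left _ h)

theorem columnClosed_columnClosure (ha : ∀ c, ↑(a c).support ⊆ B₀) (D : Finset E) :
    ColumnClosed B₀ a (columnClosure a D) := by
  intro c hc hcB
  rcases Finset.mem_union.1 hc with h | h
  · exact (Finset.subset_biUnion_of_mem (fun c => (a c).support) h).trans Finset.subset_union_right
  · obtain ⟨e, -, he⟩ := Finset.mem_biUnion.1 h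
    exact absurd (ha e he) hcB

open Classical in
theorem isFrame_of_columnClosed (hB₀ : LinearIndepOn F φ B₀) (ha : ∀ c, ↑(a c).support ⊆ B₀)
    (hφ : ∀ c ∉ B₀, Finsupp.linearCombination F φ (a c) = φ c) (hD : ColumnClosed B₀ a D) :
    IsFrame D (rowSpace F D φ) (D.filter (· ∈ B₀)) (fun b c => a c b) := by
  refine isFrame_rowSpace_iff.2 ⟨Finset.filter_subset _ _, hB₀.mono fun b hb => ?_,
    fun c hc => ?_⟩
  · exact (Finset.mem_filter.1 (Finset.mem_coe.1 hb)).2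
  · simp only [Finset.mem_sdiff, Finset.mem_filter, not_and] at hc
    rw [← hφ c (hc.2 hc.1), Finsupp.linearCombination_apply]
    refine Finsupp.sum_of_support_subset _ (fun b hb => ?_) _ (by simp)
    exact Finset.mem_filter.2 ⟨hD c hc.1 (hc.2 hc.1) hb, ha c hb⟩

open Classical in
theorem exists_global_matrix (hB₀ : LinearIndepOn F φ B₀) (ha : ∀ c, ↑(a c).support ⊆ B₀)
    (hφ : ∀ c ∉ B₀, Finsupp.linearCombination F φ (a c) = φ c)
    (hgood : ∀ D, HasUniqueGood L D (rowSpace F D φ)) :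
    ∃ Â : E → E → K, ∀ D, ColumnClosed B₀ a D →
      Good L D (rowSpace F D φ) (frameSpace D (D.filter (· ∈ B₀)) Â) := by
  have hfr := fun {D} hD => isFrame_of_columnClosed (D := D) hB₀ ha hφ hD
  have hex : ∀ D, ∃ Â : E → E → K, ColumnClosed B₀ a D →
      Good L D (rowSpace F D φ) (frameSpace D (D.filter (· ∈ B₀)) Â) := by
    intro D
    by_cases hD : ColumnClosed B₀ a D
    · obtain ⟨U', hU'⟩ := (hgood D).1
      obtain ⟨Â, hÂ⟩ := (hU'.same.iff _).1 (hfr hD).hasFrame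
      exact ⟨Â, fun _ => hÂ.eq_frameSpace ▸ hU'⟩
    · exact ⟨0, fun h => absurd h hD⟩
  choose A hA using hex
  have hmem : ∀ {D : Finset E} {b}, b ∈ D → b ∈ B₀ → b ∈ D.filter (· ∈ B₀) :=
    fun h h' => Finset.mem_filter.2 ⟨h, h'⟩
  have hmem' : ∀ {D : Finset E} {c}, c ∈ D → c ∉ B₀ → c ∈ D \ D.filter (· ∈ B₀) :=
    fun h h' => Finset.mem_sdiff.2 ⟨h, fun h'' => h' (Finset.mem_filter.1 h'').2⟩
  have hres : ∀ {D D'}, ColumnClosed B₀ a D → ColumnClosed B₀ a D' → D ⊆ D' →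
      Good L D (rowSpace F D φ) (minorSpace D (D'.filter (· ∈ B₀) \ D)
        (frameSpace D' (D'.filter (· ∈ B₀)) (A D'))) ∧
      IsFrame D (minorSpace D (D'.filter (· ∈ B₀) \ D) (frameSpace D' (D'.filter (· ∈ B₀)) (A D')))
        (D.filter (· ∈ B₀)) (A D') := by
    intro D D' hD hD' hDD'
    have hu : D.filter (· ∈ B₀) ∪ (D'.filter (· ∈ B₀) \ D) = D'.filter (· ∈ B₀) := by
      ext e
      simp only [Finset.mem_union, Finset.mem_filter, Finset.mem_sdiff]
      have := @hDD' e
      tauto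
    have hdis : Disjoint (D'.filter (· ∈ B₀) \ D) D := Finset.sdiff_disjoint
    have hsub := Finset.filter_subset (· ∈ B₀) D
    refine ⟨?_, IsFrame.minor' (by rw [hu]; exact isFrame_frameSpace (Finset.filter_subset _ _) _)
      hDD' hsub hdis⟩
    have h1 := (hA D' hD').minor (by rw [hu]; exact (hfr hD').hasFrame) hDD' hsub hdis
    rwa [(IsFrame.minor' (by rw [hu]; exact hfr hD') hDD' hsub hdis).eq_frameSpace,
      ← (hfr hD).eq_frameSpace] at h1
  have hcomp : ∀ {D D'}, ColumnClosed B₀ a D → ColumnClosed B₀ a D' → D ⊆ D' →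
      ∃ g : E → K, (∀ e, g e ≠ 0) ∧ ∀ b ∈ (D : Set E), ∀ c ∈ (D : Set E), b ∈ B₀ → c ∉ B₀ →
        A D' b c = (g c)⁻¹ * A D b c * g b := by
    intro D D' hD hD' hDD'
    obtain ⟨g, hg, h⟩ := (hgood D).exists_scale (hA D hD) (hres hD hD' hDD').1
      (isFrame_frameSpace (Finset.filter_subset _ _) _) (hres hD hD' hDD').2
    exact ⟨g, hg, fun b hb c hc hbB hcB => h b (hmem hb hbB) c (hmem' hc hcB)⟩
  let G := supportGraph B₀ fun b c => a c b
  let T : E → Finset E := fun v => (rootWalk G v).support.toFinset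
  let w : (E → E → K) → E → K := fun A v => walkWeight B₀ A (rootWalk G v)
  let N : (E → E → K) → E → E → K := fun A b c => w A b * A b c * (w A c)⁻¹
  have hT : ∀ v, v ∈ T v := fun v => List.mem_toFinset.2 (SimpleGraph.Walk.end_mem_support _)
  have hN : ∀ {D D' b c}, ColumnClosed B₀ a D → ColumnClosed B₀ a D' → D ⊆ D' → T b ⊆ D →
      T c ⊆ D → b ∈ B₀ → c ∉ B₀ → a c b ≠ 0 → N (A D') b c = N (A D) b c := by
    intro D D' b c hD hD' hDD' hb hc hbB hcB hbc
    obtain ⟨g, hg, h⟩ := hcomp hD hD' hDD'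
    have hw : ∀ v, T v ⊆ D →
        w (A D') v = g (Quot.out (G.connectedComponentMk v)) * w (A D) v * (g v)⁻¹ :=
      fun v hv => walkWeight_scale hg h (rootWalk G v) fun z hz => hv (List.mem_toFinset.2 hz)
    have hroot : G.connectedComponentMk b = G.connectedComponentMk c :=
      SimpleGraph.ConnectedComponent.sound
        (SimpleGraph.Adj.reachable (show G.Adj b c from Or.inl ⟨hbB, hcB, hbc⟩))
    change w (A D') b * A D' b c * (w (A D') c)⁻¹ = w (A D) b * A D b c * (w (A D) c)⁻¹
    rw [hw b hb, hw c hc, hroot, h b (hb (hT b)) c (hc (hT c)) hbB hcB]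
    have := hg b; have := hg c; have := hg (Quot.out (G.connectedComponentMk c))
    rw [mul_inv, mul_inv, inv_inv]
    field_simp
  have hcl := fun D => columnClosed_columnClosure ha D
  refine ⟨fun b c => if b ∈ B₀ ∧ c ∉ B₀ ∧ a c b ≠ 0 then
    N (A (columnClosure a (T b ∪ T c))) b c else 0, fun D hD => ?_⟩
  set D' := columnClosure a (D ∪ D.biUnion T) with hD'def
  have hD' : ColumnClosed B₀ a D' := hcl _
  have hDD' : D ⊆ D' := Finset.subset_union_left.trans subset_columnClosure
  have hTD : ∀ v ∈ D, T v ⊆ D ∪ D.biUnion T := fun v hv =>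
    (Finset.subset_biUnion_of_mem T hv).trans Finset.subset_union_right
  have hsupp : ∀ {b c}, b ∈ D' → c ∈ D' → b ∈ B₀ → c ∉ B₀ → (a c b = 0 ↔ A D' b c = 0) :=
    fun hb hc hbB hcB => (hA D' hD').same.support_iff (hfr hD')
      (isFrame_frameSpace (Finset.filter_subset _ _) _) (hmem hb hbB) (hmem' hc hcB)
  have hw : ∀ v ∈ D, w (A D') v ≠ 0 := fun v hv =>
    walkWeight_ne_zero (D := D')
      (fun b hb c hc hbB hcB hbc => mt (hsupp hb hc hbB hcB).2 hbc) (rootWalk G v)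
      fun z hz => subset_columnClosure (hTD v hv (List.mem_toFinset.2 hz))
  let g : E → K := fun v => if w (A D') v = 0 then 1 else w (A D') v
  have hg : ∀ v, g v ≠ 0 := by
    intro v
    by_cases h : w (A D') v = 0 <;> simp [g, h]
  have hgw : ∀ v ∈ D, g v = w (A D') v := fun v hv => if_neg (hw v hv)
  obtain ⟨h1, h2⟩ := hres hD hD' hDD'
  convert h1.scale hg
  refine (((h2.scale hg).congr fun b hb c hc => ?_).eq_frameSpace).symm
  rw [Finset.mem_filter] at hb
  simp only [Finset.mem_sdiff, Finset.mem_filter, not_and] at hc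
  have hcB := hc.2 hc.1
  rw [hgw b hb.1, hgw c hc.1]
  split_ifs with h
  · rw [← hN (hcl _) hD' (columnClosure_mono
      (Finset.union_subset (hTD b hb.1) (hTD c hc.1)))
      (Finset.subset_union_left.trans subset_columnClosure)
      (Finset.subset_union_right.trans subset_columnClosure) hb.2 hcB h.2.2]
    change _ = w (A D') b * A D' b c * (w (A D') c)⁻¹
    ring
  · have h0 : a c b = 0 := by
      by_contra h0
      exact h ⟨hb.2, hcB, h0⟩
    rw [(hsupp (hDD' hb.1) (hDD' hc.1) hb.2 hcB).1 h0, mul_zero, zero_mul]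

end Assembly

section Representation

open Classical in
/-- If two families of vectors over `𝔽₃` and `F` have the same finite independent subfamilies, then
some family of vectors over `K` has the same independent subfamilies. -/
theorem exists_linearIndepOn_iff {E F K V V₃ : Type*} [Field F] [CharP F 2] [Field K]
    [AddCommGroup V] [Module F V] [AddCommGroup V₃] [Module (ZMod 3) V₃] {φ : E → V} {φ₃ : E → V₃}
    {L : F → K} (hL : IsLift L)
    (h : ∀ I : Finset E, LinearIndepOn (ZMod 3) φ₃ (I : Set E) ↔ LinearIndepOn F φ (I : Set E)) :
    ∃ ψ : E → (E →₀ K), ∀ I : Set E, LinearIndepOn F φ I ↔ LinearIndepOn K ψ I := by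
  obtain ⟨B₀, -, -, hspan, hB₀⟩ := exists_linearIndepOn_extension
    (linearIndepOn_empty F φ) (Set.empty_subset Set.univ)
  have hcol : ∀ c, ∃ a : E →₀ F, ↑a.support ⊆ B₀ ∧ Finsupp.linearCombination F φ a = φ c := by
    intro c
    obtain ⟨a, ha, h⟩ := (Finsupp.mem_span_image_iff_linearCombination F).1
      (hspan ⟨c, Set.mem_univ c, rfl⟩)
    exact ⟨a, (Finsupp.mem_supported F a).1 ha, h⟩
  choose a ha hφ using hcol
  obtain ⟨Â, hÂ⟩ := exists_global_matrix hB₀ ha (fun c _ => hφ c)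
    fun D => (sameFrames_rowSpace h D).hasUniqueGood hL
  let ψ : E → (E →₀ K) := fun c =>
    if c ∈ B₀ then Finsupp.single c 1 else ∑ b ∈ (a c).support, Finsupp.single b (Â b c)
  have hψB : ∀ b ∈ B₀, ψ b = Finsupp.single b 1 := fun b hb => if_pos hb
  have hψ : ∀ D, ColumnClosed B₀ a D →
      IsFrame D (rowSpace K D ψ) (D.filter (· ∈ B₀)) Â := by
    intro D hD
    refine isFrame_rowSpace_iff.2 ⟨Finset.filter_subset _ _, ?_, fun c hc => ?_⟩
    · refine (((Finsupp.linearIndependent_single_one K E).linearIndepOn _).congr fun b hb => ?_)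
      exact (hψB b (Finset.mem_filter.1 (Finset.mem_coe.1 hb)).2).symm
    · have hc' := hc
      simp only [Finset.mem_sdiff, Finset.mem_filter, not_and] at hc'
      have hcB := hc'.2 hc'.1
      rw [show ψ c = ∑ b ∈ (a c).support, Finsupp.single b (Â b c) from if_neg hcB]
      have hsub : (a c).support ⊆ D.filter (· ∈ B₀) := fun b hb =>
        Finset.mem_filter.2 ⟨hD c hc'.1 hcB hb, ha c hb⟩
      rw [Finset.sum_subset hsub]
      · refine Finset.sum_congr rfl fun b hb => ?_
        rw [hψB b (Finset.mem_filter.1 hb).2, Finsupp.smul_single, smul_eq_mul, mul_one]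
      · intro b hb hbs
        rw [((hÂ D hD).same.support_iff
          (isFrame_of_columnClosed hB₀ ha (fun c _ => hφ c) hD)
          (isFrame_frameSpace (Finset.filter_subset _ _) _) hb hc).1 (by simpa using hbs),
          Finsupp.single_zero]
  have hfin : ∀ I : Finset E, LinearIndepOn F φ (I : Set E) ↔ LinearIndepOn K ψ (I : Set E) := by
    intro I
    have hD := columnClosed_columnClosure ha I
    refine linearIndepOn_iff_of_sameFrames (subset_columnClosure (a := a)) ?_
    rw [(hψ _ hD).eq_frameSpace]
    exact (hÂ _ hD).same
  refine ⟨ψ, fun I => ⟨fun hI => linearIndepOn_of_finite I fun t ht htf => ?_,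
    fun hI => linearIndepOn_of_finite I fun t ht htf => ?_⟩⟩
  · lift t to Finset E using htf
    exact (hfin t).1 (hI.mono ht)
  · lift t to Finset E using htf
    exact (hfin t).2 (hI.mono ht)

/-- A family of vectors indexed by `E` may be taken in the space of finitely supported
functions on `E`. -/
theorem exists_finsupp_linearIndepOn_iff {E F V : Type*} [Field F] [AddCommGroup V] [Module F V]
    (φ : E → V) : ∃ ψ : E → (E →₀ F), ∀ I, LinearIndepOn F φ I ↔ LinearIndepOn F ψ I := by
  obtain ⟨B₀, -, -, hspan, hB₀⟩ := exists_linearIndepOn_extension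
    (linearIndepOn_empty F φ) (Set.empty_subset Set.univ)
  have hcol : ∀ c, ∃ a ∈ Finsupp.supported F F B₀, Finsupp.linearCombination F φ a = φ c :=
    fun c => (Finsupp.mem_span_image_iff_linearCombination F).1 (hspan ⟨c, Set.mem_univ c, rfl⟩)
  choose a ha hφ using hcol
  refine ⟨a, fun I => ?_⟩
  rw [← (Finsupp.linearCombination F φ).linearIndepOn_iff_of_injOn (v := a)]
  · exact linearIndepOn_congr fun c _ => (hφ c).symm
  · refine Set.InjOn.mono (Submodule.span_le.2 (Set.image_subset_iff.2 fun c _ => ha c))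
      fun x hx y hy hxy => ?_
    exact linearIndepOn_iffₛ.1 hB₀ x hx y hy hxy

/-- Extending a representation by zero outside the ground set. -/
theorem Representable.exists_forall {α : Type u} {M : Matroid α} {K : Type v} [Field K]
    (h : Representable M K) : ∃ (V : Type (max u v)) (_ : AddCommGroup V) (_ : Module K V)
      (φ : α → V), ∀ I, M.Indep I ↔ LinearIndepOn K φ I := by
  classical
  obtain ⟨V, _, _, φ, hφ⟩ := h
  refine ⟨V, inferInstance, inferInstance, fun e => if e ∈ M.E then φ e else 0, fun I => ?_⟩
  by_cases hI : I ⊆ M.E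
  · rw [hφ I hI]
    exact linearIndepOn_congr fun e he => (if_pos (hI he)).symm
  · refine iff_of_false (fun h => hI h.subset_ground) fun h => ?_
    obtain ⟨e, heI, he⟩ := Set.not_subset.1 hI
    exact h.ne_zero heI (if_neg he)

/-- Representability depends only on the field up to isomorphism, in any universe. -/
theorem Representable.of_ringEquiv {α : Type u} {M : Matroid α} {K : Type v} {F : Type w} [Field K]
    [Field F] (σ : F ≃+* K) (h : Representable M K) : Representable M F := by
  obtain ⟨V, _, _, φ, hφ⟩ := h
  let : Module F V := Module.compHom V σ.toRingHom
  have hσ : ∀ I, LinearIndepOn K φ I ↔ LinearIndepOn F φ I := fun I =>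
    ⟨fun h => h.linearIndependent.map_of_injective_injectiveₛ σ (AddMonoidHom.id V) σ.injective
      Function.injective_id fun _ _ => rfl,
    fun h => h.linearIndependent.map_of_surjective_injectiveₛ σ (AddMonoidHom.id V) σ.surjective
      Function.injective_id fun _ _ => rfl⟩
  obtain ⟨ψ, hψ⟩ := exists_finsupp_linearIndepOn_iff (F := F) φ
  exact ⟨α →₀ F, inferInstance, inferInstance, ψ,
    fun I hI => (hφ I hI).trans <| (hσ I).trans (hψ I)⟩

end Representation

end Paper

/-- Let `M` be a matroid without large uniform minors and let `r ≥ 3` be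
an odd integer. Then `M` is representable over both the finite field `𝔽_{2^r}` and `𝔽₃` if
and only if `M` is representable over every field with at least three elements. -/
theorem representable_F2r_odd_and_F3_iff_near_regular
    {α : Type u} (M : Matroid α) (hM : Paper.NoLargeUniformMinors M)
    (r : ℕ) (hr : 3 ≤ r) (hodd : Odd r) :
    (Paper.Representable M (GaloisField 2 r) ∧ Paper.Representable M (ZMod 3)) ↔
      ∀ (K : Type v) [Field K], 3 ≤ Cardinal.mk K → Paper.Representable M K := by
  constructor
  · rintro ⟨h₂, h₃⟩ K _ hK
    obtain ⟨V₂, _, _, φ₂, h₂⟩ := h₂.exists_forall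
    obtain ⟨V₃, _, _, φ₃, h₃⟩ := h₃.exists_forall
    obtain ⟨a, ha0, ha1⟩ := Cardinal.exists_ne_ne_of_three_le hK 0 1
    obtain ⟨L, hL⟩ := Paper.exists_isLift (Paper.galoisField_no_root hodd) ha0 ha1
    obtain ⟨ψ, hψ⟩ := Paper.exists_linearIndepOn_iff hL
      fun I : Finset α => (h₃ I).symm.trans (h₂ I)
    exact ⟨α →₀ K, inferInstance, inferInstance, ψ, fun I _ => (h₂ I).trans (hψ I)⟩
  · intro h
    have key : ∀ (F : Type) [Field F], 3 ≤ Cardinal.mk F → Paper.Representable M F :=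
      fun F _ hF => (h (ULift.{v} F) (by simpa using hF)).of_ringEquiv ULift.ringEquiv.symm
    refine ⟨key _ ?_, key _ (by simp)⟩
    rw [← Nat.cast_card, GaloisField.card 2 r (by omega)]
    have : 2 ^ 3 ≤ 2 ^ r := Nat.pow_le_pow_right (by norm_num) hr
    exact_mod_cast (by omega : 3 ≤ 2 ^ r)
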